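/- Let S¹ = N(σ_0¹, …, σ_{m₁}¹) and S² = N(σ_0², …, σ_{m₂}²) be two Nikishin systems with σ_0¹ = σ_0², and let n = (n_1; n_2) ∈ ℤ₊^{m₁+1} × ℤ₊^{m₂+1} with |n_1| = |n_2| + 1. Then every mixed type vector polynomial A_n = (a_{n,0}, …, a_{n,m₁}) relative to (S¹, S²) and n satisfies deg a_{n,k} = n_{1,k} − 1 for every k = 0, …, m₁ (with the convention that the zero polynomial has degree −1). Moreover, A_n is uniquely determined up to a constant factor: if A_n and A_n' are two mixed type vector polynomials for the same data, then there is a real constant c ≠ 0 with A_n' = c·A_n. -/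

import Mathlib

open MeasureTheory Set Polynomial Filter

noncomputable section

/-- A signed Borel measure on `ℝ`, represented by a pair of (nonnegative) measures
(a "positive part" and a "negative part"). -/
structure SignedM where
  pos : MeasureTheory.Measure ℝ
  neg : MeasureTheory.Measure ℝ

namespace SignedM

/-- Integral of a complex-valued function against a signed measure. -/
def cintegral (s : SignedM) (f : ℝ → ℂ) : ℂ :=
  (∫ x, f x ∂s.pos) - ∫ x, f x ∂s.neg

/-- Integral of a real-valued function against a signed measure. -/
def rintegral (s : SignedM) (f : ℝ → ℝ) : ℝ :=
  (∫ x, f x ∂s.pos) - ∫ x, f x ∂s.neg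

/-- The Cauchy transform `ŝ(z) = ∫ ds(x)/(z - x)` at a complex point. -/
def cauchy (s : SignedM) (z : ℂ) : ℂ :=
  s.cintegral fun x => (z - (x : ℂ))⁻¹

/-- The Cauchy transform at a real point (real-valued). -/
def cauchyR (s : SignedM) (x : ℝ) : ℝ :=
  s.rintegral fun t => (x - t)⁻¹

/-- The total variation `|s|` (for the constant-sign representation used here). -/
def mass (s : SignedM) : ℝ :=
  (s.pos Set.univ).toReal + (s.neg Set.univ).toReal

/-- The (topological) support of a nonnegative measure. -/
def msupport (μ : MeasureTheory.Measure ℝ) : Set ℝ :=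
  {x | ∀ U : Set ℝ, IsOpen U → x ∈ U → μ U ≠ 0}

/-- The support of a signed measure. -/
def supp (s : SignedM) : Set ℝ := msupport s.pos ∪ msupport s.neg

/-- The signed measure `g·s` with (real, possibly sign-changing) density `g` w.r.t. `s`. -/
def withDensityR (s : SignedM) (g : ℝ → ℝ) : SignedM where
  pos := s.pos.withDensity (fun x => ENNReal.ofReal (g x)) +
    s.neg.withDensity (fun x => ENNReal.ofReal (-g x))
  neg := s.pos.withDensity (fun x => ENNReal.ofReal (-g x)) +
    s.neg.withDensity (fun x => ENNReal.ofReal (g x))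

/-- The product `⟨a, b⟩`: the measure with density `b̂` with respect to `a`. -/
def nik (a b : SignedM) : SignedM := a.withDensityR b.cauchyR

end SignedM

/-- `s ∈ M(Δ)`: a finite Borel measure with constant sign, whose support is compact and
consists of infinitely many points, `Δ` being the smallest closed interval containing it. -/
structure IsM (s : SignedM) (Δ : Set ℝ) : Prop where
  posFinite : MeasureTheory.IsFiniteMeasure s.pos
  negFinite : MeasureTheory.IsFiniteMeasure s.neg
  constSign : s.pos = 0 ∨ s.neg = 0
  compactSupp : IsCompact s.supp
  infiniteSupp : s.supp.Infinite
  hullEq : Δ = Set.Icc (sInf s.supp) (sSup s.supp)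

/-- A set of reals, viewed inside `ℂ`. -/
def cSet (Δ : Set ℝ) : Set ℂ := (fun x : ℝ => (x : ℂ)) '' Δ

/-- `τ` is the inverse measure of `s`: `1/ŝ(z) = z/|s| + b + τ̂(z)` on `ℂ ∖ Δ`. -/
def IsInverse (s τ : SignedM) (Δ : Set ℝ) : Prop :=
  ∃ b : ℝ, ∀ z : ℂ, z ∉ cSet Δ →
    (s.cauchy z)⁻¹ = z / (s.mass : ℂ) + (b : ℂ) + τ.cauchy z

/-- The iterated products `s_{j,k} = ⟨σ_j, σ_{j+1}, …, σ_k⟩` of a Nikishin system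
(`s_{j,k} = σ_j` when `j ≥ k`). -/
def nikSys (σ : ℕ → SignedM) : ℕ → ℕ → SignedM
  | j, k => if h : j < k then (σ j).nik (nikSys σ (j + 1) k) else σ j
  termination_by j k => k - j
  decreasing_by omega

/-- `ŝ_{1,k}` as a real function, with the convention `ŝ_{1,0} ≡ 1`. -/
def sh1R (σ : ℕ → SignedM) (k : ℕ) (x : ℝ) : ℝ :=
  if k = 0 then 1 else (nikSys σ 1 k).cauchyR x

/-- `ŝ_{1,k}` as a complex function, with the convention `ŝ_{1,0} ≡ 1`. -/
def sh1C (σ : ℕ → SignedM) (k : ℕ) (z : ℂ) : ℂ :=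
  if k = 0 then 1 else (nikSys σ 1 k).cauchy z

/-- `A = (a_0, …, a_{m₁})` is a mixed type vector polynomial relative to the pair of
Nikishin systems generated by `σ1 = (σ₀¹, …, σ_{m₁}¹)` and `σ2 = (σ₀², …, σ_{m₂}²)`
(with `σ₀¹ = σ₀²`) and the multi-index `n = (n1; n2)`: the `a_k` are real polynomials,
not all zero, `deg a_k ≤ n_{1,k} − 1`, and for each `i ≤ m₂` there is a polynomial `d_i`
with `Σ_k a_k(z) ∫ ŝ²_{1,i}(x) ŝ¹_{1,k}(x) dσ₀²(x)/(z−x) − d_i(z) = O(1/z^{n_{2,i}+1})`. -/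
def IsMixedVP (σ1 σ2 : ℕ → SignedM) (m1 m2 : ℕ) (n1 n2 : ℕ → ℕ)
    (a : ℕ → Polynomial ℝ) : Prop :=
  (¬ ∀ k ≤ m1, a k = 0) ∧
  (∀ k ≤ m1, (a k).degree < (n1 k : WithBot ℕ)) ∧
  (∀ i ≤ m2, ∃ d : Polynomial ℝ, ∃ C R : ℝ, ∀ z : ℂ, R ≤ ‖z‖ →
    ‖(∑ k ∈ Finset.range (m1 + 1), aeval z (a k) *
        (σ2 0).cintegral (fun x =>
          ((sh1R σ2 i x * sh1R σ1 k x : ℝ) : ℂ) * (z - (x : ℂ))⁻¹)) -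
      aeval z d‖ ≤ C / ‖z‖ ^ (n2 i + 1))

/-- Points of the complex plane off the real segment `[a, b]`. -/
def OffSeg (a b : ℝ) (z : ℂ) : Prop := ∀ y ∈ Icc a b, z ≠ (y : ℂ)

theorem exists_spectral_measure {H : Type*} [NormedAddCommGroup H] [InnerProductSpace ℂ H]
    [CompleteSpace H] (T : H →L[ℂ] H) (hT : IsSelfAdjoint T) {a b : ℝ} (hab : a ≤ b)
    (ha : algebraMap ℝ (H →L[ℂ] H) a ≤ T) (hb : T ≤ algebraMap ℝ (H →L[ℂ] H) b) (v : H) :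
    ∃ τ : Measure ℝ, IsFiniteMeasure τ ∧ τ (Icc a b)ᶜ = 0 ∧
      ∀ z : ℂ, OffSeg a b z → ∀ w : H, z • w - T w = v →
        inner ℂ v w = ∫ y, (z - (y : ℂ))⁻¹ ∂τ := by
  have hsp : spectrum ℝ T ⊆ Icc a b := fun x hx =>
    ⟨(algebraMap_le_iff_le_spectrum hT).1 ha x hx, (le_algebraMap_iff_spectrum_le hT).1 hb x hx⟩
  have hcont : ∀ f : C(Icc a b, ℝ), ContinuousOn (IccExtend hab f) (spectrum ℝ T) := fun f =>
    (f.continuous.Icc_extend' ).continuousOn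
  have hself : ∀ f : ℝ → ℝ, IsSelfAdjoint (cfc f T) := fun f => cfc_predicate f T
  have hreal : ∀ f : ℝ → ℝ, inner ℂ v (cfc f T v) = (((inner ℂ v (cfc f T v)).re : ℝ) : ℂ) := by
    intro f
    have h := ContinuousLinearMap.isSelfAdjoint_iff'.1 (hself f)
    have h2 : (starRingEnd ℂ) (inner ℂ v (cfc f T v)) = inner ℂ v (cfc f T v) := by
      rw [inner_conj_symm]
      conv_lhs => rw [← h]
      rw [ContinuousLinearMap.adjoint_inner_left]
    exact (Complex.conj_eq_iff_re.1 h2).symm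
  have hmono : ∀ f g : ℝ → ℝ, ContinuousOn f (spectrum ℝ T) → ContinuousOn g (spectrum ℝ T) →
      (∀ x ∈ spectrum ℝ T, f x ≤ g x) →
      (inner ℂ v (cfc f T v)).re ≤ (inner ℂ v (cfc g T v)).re := by
    intro f g hf hg hfg
    have h := cfc_mono (a := T) hfg hf hg
    rw [ContinuousLinearMap.le_def] at h
    have := h.re_inner_nonneg_right v
    simp [inner_sub_right] at this
    linarith
  let Λ : CompactlySupportedContinuousMap (Icc a b) ℝ →ₚ[ℝ] ℝ :=
  { toFun := fun f => (inner ℂ v (cfc (IccExtend hab f) T v)).re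
    map_add' := by
      intro f g
      have : IccExtend hab (⇑(f + g)) = fun x => IccExtend hab f x + IccExtend hab g x := by
        ext x; simp [IccExtend]
      rw [this, cfc_add (a := T) (IccExtend hab f) (IccExtend hab g) (hcont f.1) (hcont g.1)]
      simp
    map_smul' := by
      intro c f
      have : IccExtend hab (⇑(c • f)) = fun x => c • IccExtend hab f x := by
        ext x; simp [IccExtend]
      rw [this, cfc_smul c (IccExtend hab f) T (hcont f.1)]
      rw [_root_.smul_apply, ← Complex.coe_smul, inner_smul_right]
      simp
    monotone' := by
      intro f g hfg
      exact hmono _ _ (hcont f.1) (hcont g.1) (fun x _ => hfg _) }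
  have hΛ : ∀ f : ℝ → ℝ, ContinuousOn f (Icc a b) →
      ∃ hf : Continuous fun x : Icc a b => f x,
      (inner ℂ v (cfc f T v)).re =
      Λ ⟨⟨fun x : Icc a b => f x, hf⟩, HasCompactSupport.of_compactSpace _⟩ := by
    intro f hf
    refine ⟨continuousOn_iff_continuous_domRestrict.1 hf, ?_⟩
    change _ = (inner ℂ v (cfc (IccExtend hab _) T v)).re
    congr 3
    apply cfc_congr
    intro x hx
    have := IccExtend_of_mem hab (fun x : Icc a b => f x) (hsp hx)
    exact this.symm
  refine ⟨(RealRMK.rieszMeasure Λ).map Subtype.val, inferInstance, ?_, ?_⟩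
  · rw [Measure.map_apply measurable_subtype_coe measurableSet_Icc.compl]
    simp
  intro z hz w hw
  set N : ℝ → ℝ := fun y => (z.re - y) ^ 2 + z.im ^ 2
  have hN : ∀ y ∈ Icc a b, N y ≠ 0 := by
    intro y hy h0
    apply hz y hy
    have h1 : z.re - y = 0 := by nlinarith [sq_nonneg (z.re - y), sq_nonneg z.im]
    have h2 : z.im = 0 := by nlinarith [sq_nonneg (z.re - y), sq_nonneg z.im]
    apply Complex.ext <;> simp <;> linarith
  set u : ℝ → ℝ := fun y => (z.re - y) / N y
  set q : ℝ → ℝ := fun y => - z.im / N y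
  have hu : ContinuousOn u (Icc a b) := by
    apply ContinuousOn.div (by fun_prop) (by fun_prop) hN
  have hq : ContinuousOn q (Icc a b) := by
    apply ContinuousOn.div (by fun_prop) (by fun_prop) hN
  have hus := hu.mono hsp
  have hqs := hq.mono hsp
  have hinv : ∀ y ∈ Icc a b, (z - (y : ℂ))⁻¹ = (u y : ℂ) + (q y : ℂ) * Complex.I := by
    intro y hy
    have hne : z - y ≠ 0 := sub_ne_zero.2 (hz y hy)
    rw [inv_eq_of_mul_eq_one_right]
    apply Complex.ext
    · simp [u, q]; have := hN y hy; field_simp; simp [N]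
    · simp [u, q]; have := hN y hy; field_simp; ring
  set W : H →L[ℂ] H := cfc u T + Complex.I • cfc q T
  have hT' : T = cfc (fun x : ℝ => x) T := (cfc_id' ℝ T).symm
  have hone : (1 : H →L[ℂ] H) = cfc (fun _ : ℝ => (1 : ℝ)) T := (cfc_const_one ℝ T).symm
  have hprod1 : cfc u T * T = cfc (fun x => u x * x) T := by
    conv_lhs => rw [hT']
    rw [← hT', cfc_mul (a := T) u (fun x => x) hus continuousOn_id, ← hT']
  have hprod2 : cfc q T * T = cfc (fun x => q x * x) T := by
    conv_lhs => rw [hT']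
    rw [← hT', cfc_mul (a := T) q (fun x => x) hqs continuousOn_id, ← hT']
  have e1 : z.re • cfc u T - cfc u T * T - z.im • cfc q T = 1 := by
    rw [hprod1, ← cfc_smul z.re u T hus, ← cfc_smul z.im q T hqs,
      ← cfc_sub (fun x => z.re • u x) (fun x => u x * x) T (by fun_prop)
        (by fun_prop), ← cfc_sub _ _ T _ (by fun_prop), hone]
    · apply cfc_congr
      intro y hy
      simp [u, q]; have := hN y (hsp hy); field_simp; simp [N]
    · fun_prop
  have e2 : z.re • cfc q T - cfc q T * T + z.im • cfc u T = 0 := by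
    rw [hprod2, ← cfc_smul z.re q T hqs, ← cfc_smul z.im u T hus,
      ← cfc_sub (fun x => z.re • q x) (fun x => q x * x) T (by fun_prop)
        (by fun_prop), ← cfc_add (a := T) _ _ _ (by fun_prop),
        ← cfc_const_zero ℝ T]
    · apply cfc_congr
      intro y hy
      simp [u, q]; have := hN y (hsp hy); field_simp; ring
    · fun_prop
  have hw2 : w = W v := by
    have e1' := congrArg (fun A : H →L[ℂ] H => A w) e1
    have e2' := congrArg (fun A : H →L[ℂ] H => A w) e2
    simp only [_root_.sub_apply, _root_.add_apply,
      mul_apply_eq_comp, one_apply_eq_self,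
      _root_.zero_apply, _root_.smul_apply] at e1' e2'
    rw [← hw]
    simp only [W, _root_.add_apply, _root_.smul_apply, map_sub, map_smul]
    have hzz : z = (z.re : ℂ) + z.im * Complex.I := (Complex.re_add_im z).symm
    have r : ∀ (c : ℝ) (h : H), c • h = (c : ℂ) • h := fun c h => (Complex.coe_smul c h).symm
    simp only [r] at e1' e2'
    have hz1 : ∀ h : H, z • h = (z.re : ℂ) • h + Complex.I • (z.im : ℂ) • h := by
      intro h
      conv_lhs => rw [hzz]
      rw [add_smul, mul_comm, mul_smul]
    have hz2 : ∀ h : H, Complex.I • z • h = Complex.I • (z.re : ℂ) • h - (z.im : ℂ) • h := by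
      intro h
      rw [hz1, smul_add, ← mul_smul Complex.I Complex.I, Complex.I_mul_I]
      module
    rw [smul_add, smul_comm z Complex.I, hz1, hz2]
    linear_combination (norm := module) -e1' - Complex.I • e2'
  have hfint : ∀ f : ℝ → ℝ, ContinuousOn f (Icc a b) →
      (inner ℂ v (cfc f T v)).re = ∫ y : Icc a b, f y ∂(RealRMK.rieszMeasure Λ) := by
    intro f hf
    obtain ⟨hf', h⟩ := hΛ f hf
    rw [h, ← RealRMK.integral_rieszMeasure]
    rfl
  have hme : MeasurableEmbedding (Subtype.val : Icc a b → ℝ) :=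
    MeasurableEmbedding.subtype_coe measurableSet_Icc
  rw [hme.integral_map]
  have : ∀ y : Icc a b, (z - ((y : ℝ) : ℂ))⁻¹ = (u y : ℂ) + (q y : ℂ) * Complex.I :=
    fun y => hinv y y.2
  simp_rw [this]
  have hui : Integrable (fun y : Icc a b => u y) (RealRMK.rieszMeasure Λ) := by
    have : Continuous fun y : Icc a b => u y := continuousOn_iff_continuous_domRestrict.1 hu
    exact this.integrable_of_hasCompactSupport (HasCompactSupport.of_compactSpace _)
  have hqi : Integrable (fun y : Icc a b => q y) (RealRMK.rieszMeasure Λ) := by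
    have : Continuous fun y : Icc a b => q y := continuousOn_iff_continuous_domRestrict.1 hq
    exact this.integrable_of_hasCompactSupport (HasCompactSupport.of_compactSpace _)
  rw [integral_add hui.ofReal (hqi.ofReal.mul_const _), integral_mul_const, integral_complex_ofReal,
    integral_complex_ofReal, ← hfint u hu, ← hfint q hq, ← hreal, ← hreal, hw2]
  simp [W]
  ring

/-- A finite positive measure carried by `[a, b]` which is not carried by a finite set. -/
structure Good (μ : Measure ℝ) (a b : ℝ) : Prop where
  fin : IsFiniteMeasure μ
  null : μ (Icc a b)ᶜ = 0
  nf : ∀ Z : Finset ℝ, μ (Z : Set ℝ)ᶜ ≠ 0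

theorem integrable_of_continuousOn_Icc {E : Type*} [NormedAddCommGroup E] {μ : Measure ℝ}
    [IsFiniteMeasure μ] {a b : ℝ} (hμ : μ (Icc a b)ᶜ = 0) {f : ℝ → E}
    (hf : ContinuousOn f (Icc a b)) : Integrable f μ := by
  have h : μ = μ.restrict (Icc a b) := by
    rw [Measure.restrict_eq_self_of_ae_mem]
    exact mem_ae_iff.2 hμ
  rw [h]
  exact hf.integrableOn_compact isCompact_Icc

theorem ae_mem_Icc {μ : Measure ℝ} {a b : ℝ} (hμ : μ (Icc a b)ᶜ = 0) :
    ∀ᵐ x ∂μ, x ∈ Icc a b := mem_ae_iff.2 hμ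

namespace Good

variable {μ : Measure ℝ} {a b : ℝ}

theorem le (h : Good μ a b) : a ≤ b := by
  by_contra hab
  have h1 := h.nf ∅
  have h2 := h.null
  rw [Icc_eq_empty hab] at h2
  simp at h1 h2
  exact h1 h2

theorem integrable {E : Type*} [NormedAddCommGroup E] (h : Good μ a b) {f : ℝ → E}
    (hf : ContinuousOn f (Icc a b)) : Integrable f μ :=
  have := h.fin
  integrable_of_continuousOn_Icc h.null hf

theorem integral_pos (h : Good μ a b) {f : ℝ → ℝ} (hf : ContinuousOn f (Icc a b))
    (h0 : ∀ x ∈ Icc a b, 0 ≤ f x) (Z : Finset ℝ) (hZ : ∀ x ∈ Icc a b, f x = 0 → x ∈ Z) :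
    0 < ∫ x, f x ∂μ := by
  have hae : 0 ≤ᵐ[μ] f := by
    filter_upwards [ae_mem_Icc h.null] with x hx using h0 x hx
  rw [integral_pos_iff_support_of_nonneg_ae hae (h.integrable hf), pos_iff_ne_zero]
  intro hs
  apply h.nf Z
  refine measure_mono_null ?_ (measure_union_null hs h.null)
  intro x hx
  by_cases hxI : x ∈ Icc a b
  · left
    intro h1
    exact hx (hZ x hxI h1)
  · right; exact hxI

theorem mass_pos (h : Good μ a b) : 0 < ∫ _, (1 : ℝ) ∂μ :=
  h.integral_pos continuousOn_const (fun _ _ => zero_le_one) ∅ (fun _ _ h => absurd h one_ne_zero)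

end Good

theorem OffSeg.sub_ne {a b : ℝ} {z : ℂ} (hz : OffSeg a b z) {y : ℝ} (hy : y ∈ Icc a b) :
    z - (y : ℂ) ≠ 0 := sub_ne_zero.2 (hz y hy)

theorem OffSeg.continuousOn_inv {a b : ℝ} {z : ℂ} (hz : OffSeg a b z) :
    ContinuousOn (fun y : ℝ => (z - (y : ℂ))⁻¹) (Icc a b) :=
  ContinuousOn.inv₀ (by fun_prop) fun _ hy => hz.sub_ne hy

theorem offSeg_of_im_ne {a b : ℝ} {z : ℂ} (hz : z.im ≠ 0) : OffSeg a b z := by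
  intro y _ h
  apply hz
  rw [h]; simp

theorem offSeg_ofReal {a b x : ℝ} : OffSeg a b (x : ℂ) ↔ x ∉ Icc a b := by
  constructor
  · intro h hx
    exact h x hx rfl
  · intro h y hy hxy
    rw [Complex.ofReal_inj] at hxy
    exact h (hxy ▸ hy)

theorem Good.cauchy_ne_zero {μ : Measure ℝ} {a b : ℝ} (h : Good μ a b) {z : ℂ}
    (hz : OffSeg a b z) : ∫ y, (z - (y : ℂ))⁻¹ ∂μ ≠ 0 := by
  have key : ∃ θ : ℂ, ∀ y ∈ Icc a b, 0 < (θ * (z - (y : ℂ))⁻¹).re := by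
    have hinv : ∀ y : ℝ, (z - (y : ℂ))⁻¹ = (starRingEnd ℂ) (z - y) * ((Complex.normSq (z - y))⁻¹ : ℝ) :=
      fun y => Complex.inv_def _
    have hns : ∀ y ∈ Icc a b, 0 < (Complex.normSq (z - (y : ℂ)))⁻¹ := fun y hy =>
      inv_pos.2 (Complex.normSq_pos.2 (hz.sub_ne hy))
    by_cases him : z.im = 0
    · obtain ⟨x, rfl⟩ : ∃ x : ℝ, z = x := ⟨z.re, Complex.ext (by simp) (by simp [him])⟩
      rw [offSeg_ofReal] at hz
      rcases lt_or_ge x a with hx | hx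
      · refine ⟨-1, fun y hy => ?_⟩
        rw [hinv]
        have := hns y hy
        have h2 : 0 < y - x := by linarith [hy.1]
        have h3 := mul_pos this h2
        simp only [map_sub, Complex.conj_ofReal, Complex.neg_re, neg_mul, one_mul,
          Complex.re_mul_ofReal, Complex.sub_re, Complex.ofReal_re]
        linarith
      · have hx' : b < x := not_le.1 fun h => hz ⟨hx, h⟩
        refine ⟨1, fun y hy => ?_⟩
        rw [hinv]
        have := hns y hy
        have h2 : 0 < x - y := by linarith [hy.2]
        have h3 := mul_pos h2 this
        simpa using h3
    · refine ⟨Complex.I * z.im, fun y hy => ?_⟩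
      rw [hinv]
      have h3 := mul_pos (pow_pos (abs_pos.2 him) 2) (hns y hy)
      rw [sq_abs] at h3
      rw [← mul_assoc, Complex.re_mul_ofReal]
      have : (Complex.I * z.im * (starRingEnd ℂ) (z - y)).re = z.im ^ 2 := by
        simp; ring
      rwa [this]
  obtain ⟨θ, hθ⟩ := key
  intro h0
  have hI := h.integrable hz.continuousOn_inv
  have hc : ContinuousOn (fun y : ℝ => (θ * (z - (y : ℂ))⁻¹).re) (Icc a b) :=
    Complex.continuous_re.comp_continuousOn (continuousOn_const.mul hz.continuousOn_inv)
  have h1 := h.integral_pos hc (fun y hy => (hθ y hy).le) ∅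
    (fun y hy h => absurd h (hθ y hy).ne')
  have h2 : ∫ y, (θ * (z - (y : ℂ))⁻¹).re ∂μ = (∫ y, θ * (z - (y : ℂ))⁻¹ ∂μ).re :=
    integral_re (hI.const_mul θ)
  rw [h2, integral_const_mul, h0] at h1
  simp at h1

/-- If `∫ h(x)/(t-x) dμ(x)` is a polynomial up to `O(t^{-N-1})`, then the first `N` moments of
`h dμ` vanish. -/
theorem moments_eq_zero {μ : Measure ℝ} [IsFiniteMeasure μ] {a b : ℝ} (hμ : μ (Icc a b)ᶜ = 0)
    {h : ℝ → ℝ} (hh : ContinuousOn h (Icc a b)) (p : ℝ[X]) (N : ℕ) (C : ℝ)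
    (hb : ∀ᶠ t : ℝ in atTop, |∫ x, h x * (t - x)⁻¹ ∂μ - p.eval t| ≤ C / t ^ (N + 1)) :
    ∀ ν < N, ∫ x, x ^ ν * h x ∂μ = 0 := by
  set m : ℕ → ℝ := fun ν => ∫ x, x ^ ν * h x ∂μ with hm
  have hfint : ∀ ν, Integrable (fun x => x ^ ν * h x) μ := fun ν =>
    integrable_of_continuousOn_Icc hμ (by fun_prop)
  set Q : ℝ[X] := p * X ^ N - ∑ j ∈ Finset.range N, Polynomial.C (m j) * X ^ (N - 1 - j) with hQ
  set D : ℝ := ∫ x, |x ^ N * h x| ∂μ with hD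
  have hbound : ∀ᶠ t : ℝ in atTop, |Q.eval t| ≤ (C + 2 * D) / t := by
    filter_upwards [hb, eventually_ge_atTop (2 * |b| + 1)] with t ht ht1
    have hbn := abs_nonneg b
    have htpos : 0 < t := by linarith
    have hsub : ∀ x ∈ Icc a b, t / 2 ≤ t - x := by
      intro x hx
      have := le_abs_self b
      linarith [hx.2]
    have hexp : ∀ x ∈ Icc a b, t ^ N * (h x * (t - x)⁻¹) =
        ∑ j ∈ Finset.range N, t ^ (N - 1 - j) * (x ^ j * h x) + x ^ N * h x * (t - x)⁻¹ := by
      intro x hx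
      have hne : t - x ≠ 0 := by linarith [hsub x hx]
      have hg := Commute.geom_sum₂_mul (Commute.all x t) N
      have : t ^ N = (∑ j ∈ Finset.range N, x ^ j * t ^ (N - 1 - j)) * (t - x) + x ^ N := by
        linear_combination hg
      have hS : ∑ j ∈ Finset.range N, t ^ (N - 1 - j) * (x ^ j * h x) =
          (∑ j ∈ Finset.range N, x ^ j * t ^ (N - 1 - j)) * h x := by
        rw [Finset.sum_mul]
        exact Finset.sum_congr rfl fun _ _ => by ring
      rw [this, hS]
      generalize ∑ j ∈ Finset.range N, x ^ j * t ^ (N - 1 - j) = S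
      field_simp
    have hI2 : Integrable (fun x => x ^ N * h x * (t - x)⁻¹) μ := by
      apply integrable_of_continuousOn_Icc hμ
      apply ContinuousOn.mul (by fun_prop)
      apply ContinuousOn.inv₀ (by fun_prop)
      intro x hx; linarith [hsub x hx]
    have h1 : t ^ N * ∫ x, h x * (t - x)⁻¹ ∂μ =
        ∑ j ∈ Finset.range N, t ^ (N - 1 - j) * m j + ∫ x, x ^ N * h x * (t - x)⁻¹ ∂μ := by
      rw [← integral_const_mul]
      rw [integral_congr_ae ((ae_mem_Icc hμ).mono hexp), integral_add _ hI2,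
        integral_finsetSum]
      · simp_rw [integral_const_mul]
        rfl
      · intro j _; exact (hfint j).const_mul _
      · exact integrable_finsetSum _ fun j _ => (hfint j).const_mul _
    have h2 : |∫ x, x ^ N * h x * (t - x)⁻¹ ∂μ| ≤ D * (2 / t) := by
      refine (abs_integral_le_integral_abs).trans ?_
      rw [hD, ← integral_mul_const]
      apply integral_mono_ae hI2.abs ((hfint N).abs.mul_const _)
      filter_upwards [ae_mem_Icc hμ] with x hx
      have := hsub x hx
      rw [abs_mul]
      apply mul_le_mul_of_nonneg_left _ (abs_nonneg _)
      rw [abs_of_pos (inv_pos.2 (by linarith)), inv_le_comm₀ (by linarith) (by positivity)]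
      rw [inv_div]; exact this
    have h3 : Q.eval t = (∫ x, x ^ N * h x * (t - x)⁻¹ ∂μ) -
        t ^ N * (∫ x, h x * (t - x)⁻¹ ∂μ - p.eval t) := by
      rw [mul_sub, h1, hQ]
      simp only [eval_sub, eval_mul, eval_pow, eval_X, eval_finsetSum, eval_C]
      have : ∀ j, t ^ (N - 1 - j) * m j = m j * t ^ (N - 1 - j) := fun j => mul_comm _ _
      simp_rw [this]
      ring
    rw [h3]
    refine (abs_sub _ _).trans ?_
    have h4 : |t ^ N * (∫ x, h x * (t - x)⁻¹ ∂μ - p.eval t)| ≤ C / t := by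
      rw [abs_mul, abs_of_pos (pow_pos htpos N)]
      calc _ ≤ t ^ N * (C / t ^ (N + 1)) := by gcongr
        _ = C / t := by field_simp; ring
    calc _ ≤ D * (2 / t) + C / t := add_le_add h2 h4
      _ = _ := by ring
  have hlim : Tendsto (fun t => Q.eval t) atTop (nhds 0) := by
    apply squeeze_zero_norm' hbound
    exact tendsto_const_nhds.div_atTop tendsto_id
  have hQ0 : Q = 0 := by
    have := (Polynomial.tendsto_nhds_iff Q).1 hlim
    exact leadingCoeff_eq_zero.1 this.1
  intro ν hν
  have hc : Q.coeff (N - 1 - ν) = 0 := by rw [hQ0]; simp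
  rw [hQ, coeff_sub, coeff_mul_X_pow', if_neg (by omega), finsetSum_coeff] at hc
  simp only [coeff_C_mul, coeff_X_pow] at hc
  rw [Finset.sum_eq_single ν] at hc
  · simpa using hc
  · intro j hj hjν
    have := Finset.mem_range.1 hj
    rw [if_neg (by omega), mul_zero]
  · intro h; exact absurd (Finset.mem_range.2 hν) h

set_option maxHeartbeats 1000000 in
theorem exists_inverse_measure {μ : Measure ℝ} {a b : ℝ} (h : Good μ a b) :
    ∃ τ : Measure ℝ, IsFiniteMeasure τ ∧ τ (Icc a b)ᶜ = 0 ∧ ∃ A B : ℝ, ∀ z : ℂ, OffSeg a b z →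
      (∫ y, (z - (y : ℂ))⁻¹ ∂μ)⁻¹ = A * z + B - ∫ y, (z - (y : ℂ))⁻¹ ∂τ := by
  have := h.fin
  have hx : MemLp (fun x : ℝ => (x : ℂ)) ⊤ μ := by
    apply memLp_top_of_bound (C := |a| + |b|)
    · exact Complex.continuous_ofReal.aestronglyMeasurable
    · filter_upwards [ae_mem_Icc h.null] with x hx
      rw [Complex.norm_real, Real.norm_eq_abs, abs_le]
      have := neg_abs_le a; have := le_abs_self b; have := abs_nonneg a; have := abs_nonneg b
      constructor <;> linarith [hx.1, hx.2]
  let M : Lp ℂ 2 μ →L[ℂ] Lp ℂ 2 μ :=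
    (ContinuousLinearMap.mul ℂ ℂ).holderL μ ⊤ 2 2 hx.toLp
  have hM : ∀ f : Lp ℂ 2 μ, M f =ᵐ[μ] fun x => (x : ℂ) * f x := by
    intro f
    have h1 := (ContinuousLinearMap.mul ℂ ℂ).coeFn_holder (r := 2) hx.toLp f
    refine h1.trans ?_
    filter_upwards [hx.coeFn_toLp] with x hx'
    simp [hx']
  have hin : ∀ f g : Lp ℂ 2 μ, inner ℂ f g = ∫ x, (starRingEnd ℂ) (f x) * g x ∂μ := by
    intro f g
    rw [L2.inner_def]
    congr 1; ext x; simp [mul_comm]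
  have hfint : ∀ (f : Lp ℂ 2 μ) (c : ℝ), ∫ x, (starRingEnd ℂ) ((x : ℂ) * f x - c * f x) * f x ∂μ =
      ((∫ x, (x - c) * ‖f x‖ ^ 2 ∂μ : ℝ) : ℂ) := by
    intro f c
    rw [← integral_complex_ofReal]
    congr 1; ext x
    simp only [map_sub, map_mul, Complex.conj_ofReal]
    rw [← sub_mul, mul_assoc, ← Complex.normSq_eq_conj_mul_self, Complex.normSq_eq_norm_sq]
    push_cast; ring
  have hsub : ∀ (f : Lp ℂ 2 μ) (c : ℝ), inner ℂ (M f - (c : ℂ) • f) f =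
      ((∫ x, (x - c) * ‖f x‖ ^ 2 ∂μ : ℝ) : ℂ) := by
    intro f c
    rw [← hfint, hin]
    apply integral_congr_ae
    filter_upwards [Lp.coeFn_sub (M f) ((c : ℂ) • f), Lp.coeFn_smul (c : ℂ) f, hM f] with x h1 h2 h3
    rw [h1, Pi.sub_apply, h2, h3]; simp
  have hposa : (M - algebraMap ℝ _ a).IsPositive := by
    rw [ContinuousLinearMap.isPositive_iff_complex]
    intro f
    have : (M - algebraMap ℝ _ a) f = M f - (a : ℂ) • f := rfl
    rw [this, hsub]
    refine ⟨by simp, ?_⟩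
    simp only [RCLike.re_to_complex, Complex.ofReal_re]
    apply integral_nonneg_of_ae
    filter_upwards [ae_mem_Icc h.null] with x hx
    exact mul_nonneg (by linarith [hx.1]) (by positivity)
  have hposb : (algebraMap ℝ _ b - M).IsPositive := by
    rw [ContinuousLinearMap.isPositive_iff_complex]
    intro f
    have : (algebraMap ℝ _ b - M) f = -(M f - (b : ℂ) • f) := by
      rw [neg_sub]; rfl
    rw [this, inner_neg_left, hsub, ← Complex.ofReal_neg, ← integral_neg]
    refine ⟨by simp, ?_⟩
    simp only [RCLike.re_to_complex, Complex.ofReal_re]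
    apply integral_nonneg_of_ae
    filter_upwards [ae_mem_Icc h.null] with x hx
    have : 0 ≤ (b - x) * ‖f x‖ ^ 2 := mul_nonneg (by linarith [hx.2]) (by positivity)
    simp only [Pi.zero_apply]
    linarith
  let e : Lp ℂ 2 μ := (memLp_const (1 : ℂ)).toLp
  have he : e =ᵐ[μ] fun _ => (1 : ℂ) := MemLp.coeFn_toLp _
  let K : Submodule ℂ (Lp ℂ 2 μ) := (Submodule.span ℂ {e})ᗮ
  let P := K.orthogonalProjectionOnto
  let T : K →L[ℂ] K := P ∘L M ∘L K.subtypeL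
  have hTM : ∀ x : K, T x = P (M x) := fun x => rfl
  have hPid : ∀ x : K, P (x : Lp ℂ 2 μ) = x := fun x => K.orthogonalProjectionOnto_mem_subspace_eq_self x
  have hTa : algebraMap ℝ (K →L[ℂ] K) a ≤ T := by
    rw [ContinuousLinearMap.le_def]
    convert hposa.orthogonalProjectionOnto_comp K using 1
    ext1 x
    simp [Algebra.algebraMap_eq_smul_one, hTM, hPid, P]
  have hTb : T ≤ algebraMap ℝ (K →L[ℂ] K) b := by
    rw [ContinuousLinearMap.le_def]
    convert hposb.orthogonalProjectionOnto_comp K using 1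
    ext1 x
    simp [Algebra.algebraMap_eq_smul_one, hTM, hPid, P]
  have hTs : IsSelfAdjoint T := by
    have h1 := (ContinuousLinearMap.le_def _ _).1 hTa
    have h2 := h1.isSelfAdjoint
    have h3 : IsSelfAdjoint (algebraMap ℝ (K →L[ℂ] K) a) := by
      rw [ContinuousLinearMap.isSelfAdjoint_iff_isSymmetric]
      intro x y
      change inner ℂ ((a : ℂ) • x) y = inner ℂ x ((a : ℂ) • y)
      rw [inner_smul_left, inner_smul_right, Complex.conj_ofReal]
    simpa using h2.add h3
  obtain ⟨τ, hτ1, hτ2, hτ3⟩ := exists_spectral_measure T hTs h.le hTa hTb (P (M e))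
  set m0 : ℝ := ∫ _, (1 : ℝ) ∂μ with hm0
  set m1 : ℝ := ∫ x, x ∂μ with hm1
  have hm0pos : 0 < m0 := h.mass_pos
  refine ⟨(ENNReal.ofReal (m0 ^ 2)⁻¹) • τ, Measure.smul_finite _ ENNReal.ofReal_ne_top, by simp [hτ2],
    m0⁻¹, - m1 / m0 ^ 2, ?_⟩
  intro z hz
  have hs0 := h.cauchy_ne_zero hz
  have hI1 := h.integrable hz.continuousOn_inv
  set s : ℂ := ∫ y, (z - (y : ℂ))⁻¹ ∂μ with hs
  set c : ℂ := m0 / s with hc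
  have hwmem : MemLp (fun x : ℝ => c * (z - (x : ℂ))⁻¹ - 1) 2 μ := by
    apply MemLp.sub _ (memLp_const _)
    apply MemLp.const_mul
    have h1 : MemLp (fun x : ℝ => (z - (x : ℂ))⁻¹) ⊤ μ := by
      obtain ⟨D, hD⟩ := isCompact_Icc.exists_bound_of_continuousOn hz.continuousOn_inv
      apply memLp_top_of_bound (C := D) hI1.1
      filter_upwards [ae_mem_Icc h.null] with x hx using hD x hx
    exact h1.mono_exponent le_top
  let w : Lp ℂ 2 μ := hwmem.toLp
  have hw : w =ᵐ[μ] fun x : ℝ => c * (z - (x : ℂ))⁻¹ - 1 := hwmem.coeFn_toLp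
  have hI0 : Integrable (fun _ : ℝ => (1 : ℂ)) μ := integrable_const _
  have hm0c : ∫ _, (1 : ℂ) ∂μ = m0 := by
    rw [hm0, ← integral_complex_ofReal]; simp
  have hm1c : ∫ x, (x : ℂ) ∂μ = m1 := by
    rw [hm1, ← integral_complex_ofReal]
  have hIx : Integrable (fun x : ℝ => (x : ℂ)) μ := h.integrable (by fun_prop)
  have hwK : w ∈ K := by
    rw [Submodule.mem_orthogonal_singleton_iff_inner_right, hin]
    have : (fun x => (starRingEnd ℂ) (e x) * w x) =ᵐ[μ] fun x : ℝ => c * (z - (x : ℂ))⁻¹ - 1 := by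
      filter_upwards [he, hw] with x h1 h2
      rw [h1, h2]; simp
    rw [integral_congr_ae this, integral_sub (hI1.const_mul c) hI0, integral_const_mul, ← hs, hm0c,
      hc, div_mul_cancel₀ _ hs0, sub_self]
  have hPe : P e = 0 := by
    apply Submodule.orthogonalProjectionOnto_apply_of_mem_orthogonal
    rw [Submodule.mem_orthogonal]
    intro u hu
    have := (Submodule.mem_orthogonal_singleton_iff_inner_left).1 hu
    exact this
  have heq : z • w - M w = M e + (c - z) • e := by
    apply Lp.ext
    filter_upwards [Lp.coeFn_sub (z • w) (M w), Lp.coeFn_smul z w, hM w, hM e, he, hw,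
      Lp.coeFn_add (M e) ((c - z) • e), Lp.coeFn_smul (c - z) e, ae_mem_Icc h.null]
      with x h1 h2 h3 h4 h5 h6 h7 h8 h9
    rw [h1, h7, Pi.sub_apply, Pi.add_apply, h2, h3, h4, h8, Pi.smul_apply, Pi.smul_apply, h5, h6]
    have := hz.sub_ne h9
    simp only [smul_eq_mul]
    field_simp
    ring
  have hTw : z • (⟨w, hwK⟩ : K) - T ⟨w, hwK⟩ = P (M e) := by
    have h1 : P (z • w - M w) = P (M e) := by
      rw [heq, map_add, map_smul, hPe, smul_zero, add_zero]
    rw [← h1, map_sub, map_smul]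
    exact congrArg₂ (· - ·) (congrArg (z • ·) (hPid ⟨w, hwK⟩).symm) rfl
  clear_value T
  have hmain := hτ3 z hz ⟨w, hwK⟩ hTw
  have hinner : inner ℂ (P (M e)) (⟨w, hwK⟩ : K) = z * m0 - c * m0 - m1 := by
    have h1 : inner ℂ (P (M e)) (⟨w, hwK⟩ : K) = inner ℂ (M e) w := by
      have := K.inner_orthogonalProjectionOnto_eq_of_mem_left ⟨w, hwK⟩ (M e)
      rw [← inner_conj_symm]
      exact (congrArg (starRingEnd ℂ) this).trans (inner_conj_symm _ _)
    rw [h1, hin]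
    have : (fun x => (starRingEnd ℂ) (M e x) * w x) =ᵐ[μ]
        fun x : ℝ => (c * z) * (z - (x : ℂ))⁻¹ - c * 1 - (x : ℂ) := by
      filter_upwards [he, hw, hM e, ae_mem_Icc h.null] with x h1 h2 h3 h4
      rw [h3, h1, h2]
      have := hz.sub_ne h4
      simp
      field_simp
      ring
    rw [integral_congr_ae this, integral_sub _ hIx, integral_sub (hI1.const_mul _)
      (hI0.const_mul c), integral_const_mul, integral_const_mul, ← hs, hm0c, hm1c, hc]
    · field_simp
    · exact (hI1.const_mul _).sub (hI0.const_mul c)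
  rw [hinner] at hmain
  rw [integral_smul_measure, ENNReal.toReal_ofReal (by positivity), ← hmain, hc]
  have : (m0 : ℂ) ≠ 0 := by exact_mod_cast hm0pos.ne'
  rw [Complex.real_smul]
  push_cast
  field_simp
  ring

theorem cauchy_ofReal (μ : Measure ℝ) (x : ℝ) :
    ∫ y, ((x : ℂ) - (y : ℂ))⁻¹ ∂μ = ((∫ y, (x - y)⁻¹ ∂μ : ℝ) : ℂ) := by
  rw [← integral_complex_ofReal]
  congr 1; ext y; push_cast; rfl

/-- Integrating a divided difference of a polynomial gives a polynomial. -/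
theorem exists_poly_divided_difference {𝕜 : Type*} [RCLike 𝕜] {μ : Measure ℝ} [IsFiniteMeasure μ]
    {a b : ℝ} (hμ : μ (Icc a b)ᶜ = 0) {φ : ℝ → 𝕜} (hφ : ContinuousOn φ (Icc a b)) (Q : 𝕜[X]) :
    ∃ P : 𝕜[X], ∀ z : 𝕜, (∀ y ∈ Icc a b, z ≠ (y : 𝕜)) →
      Q.eval z * ∫ x, φ x * (z - (x : 𝕜))⁻¹ ∂μ =
        P.eval z + ∫ x, Q.eval (x : 𝕜) * φ x * (z - (x : 𝕜))⁻¹ ∂μ := by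
  have hc : ∀ z : 𝕜, (∀ y ∈ Icc a b, z ≠ (y : 𝕜)) →
      ContinuousOn (fun x : ℝ => (z - (x : 𝕜))⁻¹) (Icc a b) := fun z hz =>
    ContinuousOn.inv₀ (by fun_prop) fun y hy => sub_ne_zero.2 (hz y hy)
  have hQc : ∀ Q : 𝕜[X], Continuous fun x : ℝ => Q.eval (x : 𝕜) := fun Q =>
    Q.continuous.comp RCLike.continuous_ofReal
  have hI : ∀ (Q : 𝕜[X]) (z : 𝕜), (∀ y ∈ Icc a b, z ≠ (y : 𝕜)) →
      Integrable (fun x : ℝ => Q.eval (x : 𝕜) * φ x * (z - (x : 𝕜))⁻¹) μ := fun Q z hz =>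
    integrable_of_continuousOn_Icc hμ (((hQc Q).continuousOn.mul hφ).mul (hc z hz))
  induction Q using Polynomial.induction_on' with
  | add p q hp hq =>
    obtain ⟨P1, h1⟩ := hp
    obtain ⟨P2, h2⟩ := hq
    refine ⟨P1 + P2, fun z hz => ?_⟩
    simp only [eval_add, add_mul]
    rw [h1 z hz, h2 z hz, integral_add (hI p z hz) (hI q z hz)]
    ring
  | monomial n c =>
    refine ⟨∑ i ∈ Finset.range n, Polynomial.C (c * ∫ x, (x : 𝕜) ^ (n - 1 - i) * φ x ∂μ) * X ^ i,
      fun z hz => ?_⟩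
    have h0 : Integrable (fun x : ℝ => φ x * (z - (x : 𝕜))⁻¹) μ :=
      integrable_of_continuousOn_Icc hμ (hφ.mul (hc z hz))
    rw [← sub_eq_iff_eq_add, ← integral_const_mul, ← integral_sub (h0.const_mul _) (hI _ z hz)]
    have : ∀ x ∈ Icc a b, (eval z (monomial n c) * (φ x * (z - (x : 𝕜))⁻¹) -
        eval (x : 𝕜) (monomial n c) * φ x * (z - (x : 𝕜))⁻¹) =
        ∑ i ∈ Finset.range n, c * z ^ i * ((x : 𝕜) ^ (n - 1 - i) * φ x) := by
      intro x hx
      have hne : z - x ≠ 0 := sub_ne_zero.2 (hz x hx)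
      have hg := Commute.geom_sum₂_mul (Commute.all z (x : 𝕜)) n
      simp only [eval_monomial]
      have hS : ∑ i ∈ Finset.range n, c * z ^ i * ((x : 𝕜) ^ (n - 1 - i) * φ x) =
          c * (∑ i ∈ Finset.range n, z ^ i * (x : 𝕜) ^ (n - 1 - i)) * φ x := by
        rw [Finset.mul_sum, Finset.sum_mul]
        exact Finset.sum_congr rfl fun _ _ => by ring
      rw [hS]
      field_simp
      linear_combination -c * φ x * hg
    rw [integral_congr_ae ((ae_mem_Icc hμ).mono this), integral_finsetSum]
    · rw [eval_finsetSum]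
      apply Finset.sum_congr rfl
      intro i _
      rw [integral_const_mul]
      simp only [eval_mul, eval_C, eval_pow, eval_X]
      ring
    · intro i _
      apply Integrable.const_mul
      exact integrable_of_continuousOn_Icc hμ
        ((RCLike.continuous_ofReal.pow _).continuousOn.mul hφ)

theorem Good.inverse {μ : Measure ℝ} {a b : ℝ} (h : Good μ a b) :
    ∃ τ : Measure ℝ, Good τ a b ∧ ∃ A B : ℝ, ∀ z : ℂ, OffSeg a b z →
      (∫ y, (z - (y : ℂ))⁻¹ ∂μ)⁻¹ = A * z + B - ∫ y, (z - (y : ℂ))⁻¹ ∂τ := by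
  obtain ⟨τ, hfin, hnull, A, B, hAB⟩ := exists_inverse_measure h
  have := h.fin
  refine ⟨τ, ⟨hfin, hnull, ?_⟩, A, B, hAB⟩
  intro Z hZ
  set R : ℝ[X] := ∏ y ∈ Z, (X - Polynomial.C y) with hR
  set Q : ℝ[X] := (Polynomial.C A * X + Polynomial.C B) * R -
    ∑ y ∈ Z, Polynomial.C (τ.real {y}) * ∏ x ∈ Z.erase y, (X - Polynomial.C x) with hQ
  have hτint : ∀ f : ℝ → ℝ, ∫ y, f y ∂τ = ∑ y ∈ Z, τ.real {y} * f y := by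
    intro f
    have hr : τ = τ.restrict Z := by
      rw [Measure.restrict_eq_self_of_ae_mem]
      exact mem_ae_iff.2 hZ
    conv_lhs => rw [hr]
    rw [setIntegral_finset]
    · rfl
    · apply IntegrableOn.finset
  have hlarge : ∀ᶠ t : ℝ in atTop, b < t ∧ ∀ y ∈ Z, y < t :=
    (eventually_gt_atTop b).and ((Finset.eventually_all Z).2 fun y _ => eventually_gt_atTop y)
  have hkey : ∀ t : ℝ, (b < t ∧ ∀ y ∈ Z, y < t) →
      R.eval t = Q.eval t * ∫ y, (t - y)⁻¹ ∂μ ∧ R.eval t ≠ 0 := by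
    rintro t ⟨htb, htZ⟩
    have hoff : OffSeg a b (t : ℂ) := offSeg_ofReal.2 fun hh => absurd hh.2 (not_le.2 htb)
    have h1 := hAB t hoff
    have h0 := h.cauchy_ne_zero hoff
    rw [cauchy_ofReal] at h0
    rw [cauchy_ofReal, cauchy_ofReal] at h1
    have h2 : (∫ y, (t - y)⁻¹ ∂μ)⁻¹ = A * t + B - ∫ y, (t - y)⁻¹ ∂τ := by exact_mod_cast h1
    have h3 : (∫ y, (t - y)⁻¹ ∂μ) ≠ 0 := by exact_mod_cast h0
    have hRt : R.eval t = ∏ y ∈ Z, (t - y) := by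
      rw [hR, eval_prod]; simp
    constructor
    · rw [← div_eq_iff h3, div_eq_mul_inv, h2, hτint, hQ]
      simp only [eval_sub, eval_mul, eval_add, eval_C, eval_X, eval_finsetSum, eval_prod]
      rw [mul_sub, mul_comm, Finset.mul_sum]
      congr 1
      apply Finset.sum_congr rfl
      intro y hy
      rw [hRt, ← Finset.mul_prod_erase Z _ hy]
      have : t - y ≠ 0 := by linarith [htZ y hy]
      field_simp
    · rw [hRt, Finset.prod_ne_zero_iff]
      intro y hy; linarith [htZ y hy]
  have hQ0 : Q ≠ 0 := by
    intro h0
    obtain ⟨t, ht⟩ := hlarge.exists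
    obtain ⟨h1, h2⟩ := hkey t ht
    rw [h0] at h1
    simp at h1
    exact h2 h1
  obtain ⟨P, hP⟩ := exists_poly_divided_difference h.null
    (φ := fun _ => (1 : ℝ)) continuousOn_const Q
  have hmom : ∀ ν, ∫ x, x ^ ν * Q.eval x ∂μ = 0 := by
    intro ν
    refine moments_eq_zero h.null Q.continuous.continuousOn (R - P) (ν + 1) 0 ?_ ν (Nat.lt_succ_self ν)
    filter_upwards [hlarge] with t ht
    have h1 := hP t (fun y hy => by
      have := lt_of_le_of_lt hy.2 ht.1
      exact this.ne')
    have h2 := (hkey t ht).1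
    simp only [RCLike.ofReal_real_eq_id, id, mul_one, one_mul] at h1
    rw [eval_sub, h2, h1]
    simp
  have hsq : ∫ x, Q.eval x * Q.eval x ∂μ = 0 := by
    have : ∀ x, Q.eval x * Q.eval x =
        ∑ i ∈ Finset.range (Q.natDegree + 1), Q.coeff i * (x ^ i * Q.eval x) := by
      intro x
      conv_lhs => lhs; rw [eval_eq_sum_range]
      rw [Finset.sum_mul]
      exact Finset.sum_congr rfl fun _ _ => by ring
    simp_rw [this]
    rw [integral_finsetSum]
    · simp_rw [integral_const_mul, hmom]; simp
    · intro i _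
      apply Integrable.const_mul
      exact h.integrable ((continuous_id.pow i).mul Q.continuous).continuousOn
  have := h.integral_pos (f := fun x => Q.eval x * Q.eval x)
    (Q.continuous.mul Q.continuous).continuousOn (fun x _ => mul_self_nonneg _)
    Q.roots.toFinset (fun x _ hx => by
      rw [Multiset.mem_toFinset, mem_roots hQ0]
      exact mul_self_eq_zero.1 hx)
  linarith

namespace Good

variable {μ : Measure ℝ} {a b : ℝ}

theorem withDensity (h : Good μ a b) {f : ℝ → ℝ} (hf : Continuous f) (hpos : ∀ x, 0 < f x) :
    Good (μ.withDensity fun x => ENNReal.ofReal (f x)) a b where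
  fin := isFiniteMeasure_withDensity_ofReal (h.integrable hf.continuousOn).2
  null := withDensity_absolutelyContinuous _ _ h.null
  nf Z hZ := by
    refine h.nf Z (withDensity_absolutelyContinuous' ?_ ?_ hZ)
    · fun_prop
    · exact ae_of_all _ fun x => by simp [hpos x]

theorem integral_withDensity {f : ℝ → ℝ} (hf : Continuous f) (hpos : ∀ x, 0 < f x)
    (g : ℝ → ℂ) :
    ∫ x, g x ∂(μ.withDensity fun x => ENNReal.ofReal (f x)) = ∫ x, (f x : ℂ) * g x ∂μ := by
  rw [integral_withDensity_eq_integral_toReal_smul (by fun_prop)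
    (ae_of_all _ fun x => ENNReal.ofReal_lt_top)]
  congr 1; ext x
  rw [ENNReal.toReal_ofReal (hpos x).le, Complex.real_smul]

theorem inverse_density_of_pos (h : Good μ a b) {ψ : ℝ → ℝ} (hψ : ContinuousOn ψ (Icc a b))
    (hpos : ∀ x ∈ Icc a b, 0 < ψ x) :
    ∃ τ : Measure ℝ, Good τ a b ∧ ∃ A B : ℝ, ∀ z : ℂ, OffSeg a b z →
      ∫ y, (ψ y : ℂ) * (z - (y : ℂ))⁻¹ ∂μ ≠ 0 ∧
      (∫ y, (ψ y : ℂ) * (z - (y : ℂ))⁻¹ ∂μ)⁻¹ =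
        A * z + B - ∫ y, (ψ y : ℂ) * (z - (y : ℂ))⁻¹ ∂τ := by
  set f : ℝ → ℝ := IccExtend h.le (fun x : Icc a b => ψ x) with hf
  have hfc : Continuous f := (continuousOn_iff_continuous_domRestrict.1 hψ).Icc_extend'
  have hfpos : ∀ x, 0 < f x := fun x => hpos _ (projIcc a b h.le x).2
  have hfψ : ∀ x ∈ Icc a b, f x = ψ x := fun x hx => IccExtend_of_mem h.le (fun x : Icc a b => ψ x) hx
  obtain ⟨τ, hτ, A, B, hAB⟩ := (h.withDensity hfc hfpos).inverse
  have hgc : Continuous fun x => (f x)⁻¹ := hfc.inv₀ fun x => (hfpos x).ne'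
  have hgpos : ∀ x, 0 < (f x)⁻¹ := fun x => inv_pos.2 (hfpos x)
  refine ⟨_, hτ.withDensity hgc hgpos, A, B, fun z hz => ?_⟩
  have h1 : ∫ y, (ψ y : ℂ) * (z - (y : ℂ))⁻¹ ∂μ =
      ∫ y, (z - (y : ℂ))⁻¹ ∂(μ.withDensity fun x => ENNReal.ofReal (f x)) := by
    rw [integral_withDensity hfc hfpos]
    apply integral_congr_ae
    filter_upwards [ae_mem_Icc h.null] with x hx
    rw [hfψ x hx]
  rw [h1, hAB z hz, integral_withDensity hgc hgpos]
  refine ⟨(h.withDensity hfc hfpos).cauchy_ne_zero hz, ?_⟩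
  congr 1
  apply integral_congr_ae
  filter_upwards [ae_mem_Icc hτ.null] with x hx
  rw [← hfψ x hx]
  have : (f x : ℂ) ≠ 0 := by exact_mod_cast (hfpos x).ne'
  push_cast
  field_simp

theorem inverse_density (h : Good μ a b) {ψ : ℝ → ℝ} (hψ : ContinuousOn ψ (Icc a b))
    (hne : ∀ x ∈ Icc a b, ψ x ≠ 0) :
    ∃ τ : Measure ℝ, Good τ a b ∧ ∃ A B : ℝ, ∀ z : ℂ, OffSeg a b z →
      ∫ y, (ψ y : ℂ) * (z - (y : ℂ))⁻¹ ∂μ ≠ 0 ∧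
      (∫ y, (ψ y : ℂ) * (z - (y : ℂ))⁻¹ ∂μ)⁻¹ =
        A * z + B - ∫ y, (ψ y : ℂ) * (z - (y : ℂ))⁻¹ ∂τ := by
  have hsign : (∀ x ∈ Icc a b, 0 < ψ x) ∨ (∀ x ∈ Icc a b, 0 < -ψ x) := by
    by_contra hcon
    push Not at hcon
    obtain ⟨⟨x, hx, hx0⟩, ⟨y, hy, hy0⟩⟩ := hcon
    have := isPreconnected_Icc.intermediate_value hx hy hψ
    obtain ⟨w, hw, hw0⟩ := this ⟨hx0, by linarith⟩
    exact hne w hw hw0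
  rcases hsign with hs | hs
  · exact h.inverse_density_of_pos hψ hs
  · obtain ⟨τ, hτ, A, B, hAB⟩ := h.inverse_density_of_pos hψ.neg hs
    refine ⟨τ, hτ, -A, -B, fun z hz => ?_⟩
    have h1 := hAB z hz
    simp only [Complex.ofReal_neg, Pi.neg_apply, neg_mul, integral_neg, inv_neg, neg_ne_zero] at h1
    refine ⟨h1.1, ?_⟩
    have := h1.2
    push_cast
    linear_combination -this

end Good

theorem isOpen_offSeg (a b : ℝ) : IsOpen {z : ℂ | OffSeg a b z} := by
  have : {z : ℂ | OffSeg a b z} = ((fun x : ℝ => (x : ℂ)) '' Icc a b)ᶜ := by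
    ext z
    simp only [OffSeg, mem_ofPred_eq, mem_compl_iff, mem_image, not_exists, not_and]
    exact forall₂_congr fun y _ => ⟨fun h h' => h h'.symm, fun h h' => h h'.symm⟩
  rw [this]
  exact (isCompact_Icc.image Complex.continuous_ofReal).isClosed.isOpen_compl

theorem continuousOn_cauchy {μ : Measure ℝ} [IsFiniteMeasure μ] {a b : ℝ}
    (hμ : μ (Icc a b)ᶜ = 0) {φ : ℝ → ℂ} (hφ : ContinuousOn φ (Icc a b)) :
    ContinuousOn (fun z : ℂ => ∫ y, φ y * (z - (y : ℂ))⁻¹ ∂μ) {z | OffSeg a b z} := by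
  intro z0 hz0
  apply ContinuousAt.continuousWithinAt
  obtain ⟨r, hr, hball⟩ := Metric.isOpen_iff.1 (isOpen_offSeg a b) z0 hz0
  have hdist : ∀ y ∈ Icc a b, r ≤ ‖z0 - (y : ℂ)‖ := by
    intro y hy
    by_contra hlt
    have : (y : ℂ) ∈ Metric.ball z0 r := by
      rw [Metric.mem_ball, dist_comm, dist_eq_norm]; exact not_le.1 hlt
    exact hball this y hy rfl
  have hI : Integrable φ μ := integrable_of_continuousOn_Icc hμ hφ
  apply continuousAt_of_dominated (bound := fun y => ‖φ y‖ * (2 / r))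
  · filter_upwards [(isOpen_offSeg a b).mem_nhds hz0] with z hz
    exact (integrable_of_continuousOn_Icc hμ (hφ.mul (OffSeg.continuousOn_inv hz))).1
  · filter_upwards [Metric.ball_mem_nhds z0 (half_pos hr)] with z hz
    filter_upwards [ae_mem_Icc hμ] with y hy
    rw [norm_mul, norm_inv]
    gcongr
    rw [inv_le_comm₀ _ (by positivity), inv_div]
    · have h1 := hdist y hy
      have h2 : ‖z0 - (y : ℂ)‖ ≤ ‖z0 - z‖ + ‖z - y‖ := by
        have := norm_add_le (z0 - z) (z - y); simpa using this
      rw [Metric.mem_ball, dist_comm, dist_eq_norm] at hz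
      linarith
    · have h1 := hdist y hy
      have h2 : ‖z0 - (y : ℂ)‖ ≤ ‖z0 - z‖ + ‖z - y‖ := by
        have := norm_add_le (z0 - z) (z - y); simpa using this
      rw [Metric.mem_ball, dist_comm, dist_eq_norm] at hz
      linarith
  · exact hI.norm.mul_const _
  · filter_upwards [ae_mem_Icc hμ] with y hy
    have := OffSeg.sub_ne hz0 hy
    fun_prop (disch := assumption)

theorem tendsto_mul_cauchy {μ : Measure ℝ} [IsFiniteMeasure μ] {a b : ℝ}
    (hμ : μ (Icc a b)ᶜ = 0) {φ : ℝ → ℂ} (hφ : ContinuousOn φ (Icc a b)) :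
    Tendsto (fun t : ℝ => (t * Complex.I) * ∫ y, φ y * (t * Complex.I - (y : ℂ))⁻¹ ∂μ) atTop
      (nhds (∫ y, φ y ∂μ)) := by
  simp_rw [← integral_const_mul]
  have hnorm : ∀ t y : ℝ, |t| ≤ ‖(t * Complex.I - (y : ℂ))‖ := by
    intro t y
    have := Complex.abs_im_le_norm (t * Complex.I - (y : ℂ))
    simpa using this
  apply tendsto_integral_filter_of_dominated_convergence (fun y => ‖φ y‖)
  · filter_upwards [eventually_gt_atTop 0] with t ht
    have : OffSeg a b (t * Complex.I) := offSeg_of_im_ne (by simp [ht.ne'])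
    exact ((integrable_of_continuousOn_Icc hμ (hφ.mul this.continuousOn_inv)).const_mul _).1
  · filter_upwards [eventually_gt_atTop 0] with t ht
    filter_upwards with y
    rw [norm_mul (_ * Complex.I), norm_mul (φ y), norm_inv]
    have h1 := hnorm t y
    have h2 : 0 < |t| := abs_pos.2 ht.ne'
    have h3 : ‖(t : ℂ) * Complex.I‖ = |t| := by simp
    rw [h3, mul_left_comm]
    apply mul_le_of_le_one_right (norm_nonneg _)
    rw [← div_eq_mul_inv, div_le_one (by linarith)]
    exact h1
  · exact (integrable_of_continuousOn_Icc hμ hφ).norm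
  · filter_upwards with y
    have h1 : Tendsto (fun t : ℝ => (y : ℂ) * (t * Complex.I - (y : ℂ))⁻¹) atTop (nhds 0) := by
      rw [← mul_zero (y : ℂ)]
      apply Tendsto.const_mul
      rw [tendsto_zero_iff_norm_tendsto_zero]
      simp_rw [norm_inv]
      apply Tendsto.inv_tendsto_atTop
      exact tendsto_atTop_mono (fun t => hnorm t y) tendsto_abs_atTop_atTop
    have h2 := (h1.const_add 1).const_mul (φ y)
    rw [add_zero, mul_one] at h2
    refine h2.congr' ?_
    filter_upwards [eventually_gt_atTop 0] with t ht
    have : (t * Complex.I - (y : ℂ)) ≠ 0 := by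
      intro h0
      have := hnorm t y
      rw [h0, norm_zero] at this
      have := abs_pos.2 ht.ne'
      linarith
    field_simp
    ring

theorem integral_swap_Icc {μ ν : Measure ℝ} [IsFiniteMeasure μ] [IsFiniteMeasure ν] {a b c d : ℝ}
    (hμ : μ (Icc a b)ᶜ = 0) (hν : ν (Icc c d)ᶜ = 0) {f : ℝ → ℝ → ℂ}
    (hf : ContinuousOn (Function.uncurry f) (Icc a b ×ˢ Icc c d)) :
    ∫ x, ∫ y, f x y ∂ν ∂μ = ∫ y, ∫ x, f x y ∂μ ∂ν := by
  apply integral_integral_swap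
  have h : μ.prod ν = (μ.prod ν).restrict (Icc a b ×ˢ Icc c d) := by
    rw [← Measure.prod_restrict, Measure.restrict_eq_self_of_ae_mem (ae_mem_Icc hμ),
      Measure.restrict_eq_self_of_ae_mem (ae_mem_Icc hν)]
  rw [h]
  exact hf.integrableOn_compact (isCompact_Icc.prod isCompact_Icc)

theorem integrable_cauchy {μ : Measure ℝ} [IsFiniteMeasure μ] {a b : ℝ}
    (hμ : μ (Icc a b)ᶜ = 0) {φ : ℝ → ℂ} (hφ : ContinuousOn φ (Icc a b)) {z : ℂ}
    (hz : OffSeg a b z) : Integrable (fun y : ℝ => φ y * (z - (y : ℂ))⁻¹) μ :=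
  integrable_of_continuousOn_Icc hμ (hφ.mul hz.continuousOn_inv)

theorem continuousOn_cauchy_ofReal {μ : Measure ℝ} [IsFiniteMeasure μ] {a b c d : ℝ}
    (hμ : μ (Icc a b)ᶜ = 0) {φ : ℝ → ℂ} (hφ : ContinuousOn φ (Icc a b))
    (hd : Disjoint (Icc c d) (Icc a b)) :
    ContinuousOn (fun x : ℝ => ∫ y, φ y * ((x : ℂ) - (y : ℂ))⁻¹ ∂μ) (Icc c d) :=
  (continuousOn_cauchy hμ hφ).comp Complex.continuous_ofReal.continuousOn
    fun _ hx => offSeg_ofReal.2 fun h => Set.disjoint_left.1 hd hx h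

/-- The product of two Cauchy transforms supported on disjoint intervals, split by partial
fractions. -/
theorem cauchy_mul_cauchy {τ ρ : Measure ℝ} [IsFiniteMeasure τ] [IsFiniteMeasure ρ]
    {a b c d : ℝ} (hτ : τ (Icc a b)ᶜ = 0) (hρ : ρ (Icc c d)ᶜ = 0)
    (hd : Disjoint (Icc a b) (Icc c d)) {ψ φ : ℝ → ℂ} (hψ : ContinuousOn ψ (Icc a b))
    (hφ : ContinuousOn φ (Icc c d)) {z : ℂ} (hz : OffSeg a b z) (hz' : OffSeg c d z) :
    (∫ ξ, φ ξ * (z - (ξ : ℂ))⁻¹ ∂ρ) * (∫ y, ψ y * (z - (y : ℂ))⁻¹ ∂τ)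
      - ∫ y, (∫ ξ, φ ξ * ((y : ℂ) - (ξ : ℂ))⁻¹ ∂ρ) * ψ y * (z - (y : ℂ))⁻¹ ∂τ
      = ∫ ξ, φ ξ * (∫ y, ψ y * ((ξ : ℂ) - (y : ℂ))⁻¹ ∂τ) * (z - (ξ : ℂ))⁻¹ ∂ρ := by
  have hne : ∀ y ∈ Icc a b, ∀ ξ ∈ Icc c d, (y : ℂ) - (ξ : ℂ) ≠ 0 := by
    intro y hy ξ hξ h
    rw [sub_eq_zero, Complex.ofReal_inj] at h
    exact Set.disjoint_left.1 hd hy (h ▸ hξ)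
  have h1 : ContinuousOn (fun y : ℝ => (∫ ξ, φ ξ * ((y : ℂ) - (ξ : ℂ))⁻¹ ∂ρ) * ψ y
      * (z - (y : ℂ))⁻¹) (Icc a b) :=
    ((continuousOn_cauchy_ofReal hρ hφ hd).mul hψ).mul hz.continuousOn_inv
  rw [← integral_const_mul, ← integral_sub
    ((integrable_cauchy hτ hψ hz).const_mul _)
    (integrable_of_continuousOn_Icc hτ h1)]
  have h2 : ∀ y ∈ Icc a b, (∫ ξ, φ ξ * (z - (ξ : ℂ))⁻¹ ∂ρ) * (ψ y * (z - (y : ℂ))⁻¹)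
      - (∫ ξ, φ ξ * ((y : ℂ) - (ξ : ℂ))⁻¹ ∂ρ) * ψ y * (z - (y : ℂ))⁻¹
      = ∫ ξ, φ ξ * (ψ y * ((ξ : ℂ) - (y : ℂ))⁻¹) * (z - (ξ : ℂ))⁻¹ ∂ρ := by
    intro y hy
    have hy' : OffSeg c d (y : ℂ) := offSeg_ofReal.2 fun h => Set.disjoint_left.1 hd hy h
    rw [mul_assoc, ← sub_mul, ← integral_sub
      (integrable_cauchy hρ hφ hz')
      (integrable_cauchy hρ hφ hy'), ← integral_mul_const]
    apply integral_congr_ae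
    filter_upwards [ae_mem_Icc hρ] with ξ hξ
    have e1 := hne y hy ξ hξ
    have e2 := hz.sub_ne hy
    have e3 := hz'.sub_ne hξ
    have e4 : (ξ : ℂ) - (y : ℂ) ≠ 0 := by rw [← neg_sub]; exact neg_ne_zero.2 e1
    rw [← neg_sub (y : ℂ) (ξ : ℂ), inv_neg]
    field_simp
    ring
  rw [integral_congr_ae ((ae_mem_Icc hτ).mono h2), integral_swap_Icc hτ hρ]
  · apply integral_congr_ae
    filter_upwards with ξ
    rw [integral_mul_const, integral_const_mul]
  · apply ContinuousOn.mul
    · apply ContinuousOn.mul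
      · exact hφ.comp continuousOn_snd fun p hp => hp.2
      · apply ContinuousOn.mul
        · exact hψ.comp continuousOn_fst fun p hp => hp.1
        · apply ContinuousOn.inv₀ (by fun_prop)
          intro p hp
          rw [← neg_sub]; exact neg_ne_zero.2 (hne _ hp.1 _ hp.2)
    · exact hz'.continuousOn_inv.comp continuousOn_snd fun p hp => hp.2

theorem poly_add_cauchy_mul {τ ρ : Measure ℝ} [IsFiniteMeasure τ] [IsFiniteMeasure ρ]
    {a b c d : ℝ} (hτ : τ (Icc a b)ᶜ = 0) (hρ : ρ (Icc c d)ᶜ = 0)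
    (hd : Disjoint (Icc a b) (Icc c d)) {ψ φ : ℝ → ℂ} (hψ : ContinuousOn ψ (Icc a b))
    (hφ : ContinuousOn φ (Icc c d)) (p q : ℂ[X]) :
    ∃ P : ℂ[X], ∀ z, OffSeg a b z → OffSeg c d z →
      (q.eval z + ∫ ξ, φ ξ * (z - (ξ : ℂ))⁻¹ ∂ρ) * (p.eval z + ∫ y, ψ y * (z - (y : ℂ))⁻¹ ∂τ)
      - ∫ y, (q.eval (y : ℂ) + ∫ ξ, φ ξ * ((y : ℂ) - (ξ : ℂ))⁻¹ ∂ρ) * ψ y * (z - (y : ℂ))⁻¹ ∂τ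
      = P.eval z + ∫ ξ, φ ξ * (p.eval (ξ : ℂ) + ∫ y, ψ y * ((ξ : ℂ) - (y : ℂ))⁻¹ ∂τ)
          * (z - (ξ : ℂ))⁻¹ ∂ρ := by
  obtain ⟨P1, h1⟩ := exists_poly_divided_difference hτ hψ q
  obtain ⟨P2, h2⟩ := exists_poly_divided_difference hρ hφ p
  refine ⟨q * p + P1 + P2, fun z hz hz' => ?_⟩
  have h1 := h1 z hz
  have h2 := h2 z hz'
  have h3 := cauchy_mul_cauchy hτ hρ hd hψ hφ hz hz'
  have hqc : ∀ (r : ℂ[X]) (s : Set ℝ), ContinuousOn (fun x : ℝ => r.eval (x : ℂ)) s :=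
    fun r s => (r.continuous.comp Complex.continuous_ofReal).continuousOn
  have e1 : ∫ y, (q.eval (y : ℂ) + ∫ ξ, φ ξ * ((y : ℂ) - (ξ : ℂ))⁻¹ ∂ρ) * ψ y
        * (z - (y : ℂ))⁻¹ ∂τ
      = (∫ y, q.eval (y : ℂ) * ψ y * (z - (y : ℂ))⁻¹ ∂τ)
        + ∫ y, (∫ ξ, φ ξ * ((y : ℂ) - (ξ : ℂ))⁻¹ ∂ρ) * ψ y * (z - (y : ℂ))⁻¹ ∂τ := by
    rw [← integral_add]
    · simp only [add_mul]
    · exact integrable_cauchy hτ ((hqc q _).mul hψ) hz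
    · exact integrable_cauchy hτ ((continuousOn_cauchy_ofReal hρ hφ hd).mul hψ) hz
  have e2 : ∫ ξ, φ ξ * (p.eval (ξ : ℂ) + ∫ y, ψ y * ((ξ : ℂ) - (y : ℂ))⁻¹ ∂τ)
        * (z - (ξ : ℂ))⁻¹ ∂ρ
      = (∫ ξ, p.eval (ξ : ℂ) * φ ξ * (z - (ξ : ℂ))⁻¹ ∂ρ)
        + ∫ ξ, φ ξ * (∫ y, ψ y * ((ξ : ℂ) - (y : ℂ))⁻¹ ∂τ) * (z - (ξ : ℂ))⁻¹ ∂ρ := by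
    rw [← integral_add]
    · simp only [mul_add, mul_comm]
    · exact integrable_cauchy hρ ((hqc p _).mul hφ) hz'
    · exact integrable_cauchy hρ (hφ.mul (continuousOn_cauchy_ofReal hτ hψ hd.symm)) hz'
  rw [e1, e2, ← h3]
  simp only [eval_add, eval_mul]
  linear_combination h1 + h2

theorem tendsto_norm_mul_I : Tendsto (fun t : ℝ => ‖(t : ℂ) * Complex.I‖) atTop atTop := by
  simpa using tendsto_abs_atTop_atTop

/-- A polynomial that is `O(t ^ d)` along the imaginary axis has degree at most `d`. -/
theorem natDegree_le_of_tendsto {q : ℂ[X]} {d : ℕ} {c : ℂ}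
    (h : Tendsto (fun t : ℝ => q.eval (t * Complex.I) / (t * Complex.I) ^ d) atTop (nhds c)) :
    q.natDegree ≤ d := by
  by_contra! hlt
  have hinv : Tendsto (fun t : ℝ => ((t : ℂ) * Complex.I)⁻¹) atTop (nhds 0) :=
    tendsto_inv₀_cobounded.comp (tendsto_norm_atTop_iff_cobounded.1 tendsto_norm_mul_I)
  have h1 : Tendsto (fun t : ℝ => q.reverse.eval ((t : ℂ) * Complex.I)⁻¹) atTop
      (nhds (q.reverse.eval 0)) := (q.reverse.continuous.tendsto 0).comp hinv
  have h2 : Tendsto (fun t : ℝ => q.reverse.eval ((t : ℂ) * Complex.I)⁻¹) atTop (nhds 0) := by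
    have h3 := h.mul (hinv.pow (q.natDegree - d))
    rw [zero_pow (by omega), mul_zero] at h3
    refine h3.congr' ?_
    filter_upwards [eventually_gt_atTop 0] with t ht
    have hz : (t : ℂ) * Complex.I ≠ 0 := by simp [ht.ne']
    generalize (t : ℂ) * Complex.I = z at hz
    have := invertibleOfNonzero hz
    have h4 := eval₂_reverse_mul_pow (RingHom.id ℂ) z q
    simp only [invOf_eq_inv] at h4
    change eval z⁻¹ q.reverse * z ^ q.natDegree = eval z q at h4
    rw [← h4]
    obtain ⟨e, he⟩ := Nat.exists_eq_add_of_lt hlt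
    rw [he, show d + e + 1 - d = e + 1 by omega, inv_pow, add_assoc, pow_add]
    generalize q.reverse.eval z⁻¹ = w
    have : z ^ (e + 1) ≠ 0 := pow_ne_zero _ hz
    field_simp
  have h5 := tendsto_nhds_unique h1 h2
  rw [← coeff_zero_eq_eval_zero, coeff_zero_reverse, leadingCoeff_eq_zero] at h5
  simp [h5] at hlt

theorem eq_zero_of_tendsto_zero {q : ℂ[X]}
    (h : Tendsto (fun t : ℝ => q.eval (t * Complex.I)) atTop (nhds 0)) : q = 0 := by
  have h1 := natDegree_le_of_tendsto (q := q) (d := 0) (c := 0) (by simpa using h)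
  rw [eq_C_of_natDegree_le_zero h1] at h ⊢
  simp only [eval_C, tendsto_const_nhds_iff] at h
  rw [h, map_zero]

section MinorDet

variable {R : Type*} [CommRing R] (s : ℕ → ℕ → R)

/-- The minor on the first `n` rows and the columns `c` of the infinite matrix `s`. -/
def minorDet {n : ℕ} (c : Fin n → ℕ) : R := (Matrix.of fun a b : Fin n => s a (c b)).det

theorem minorDet_perm {n : ℕ} (c : Fin n → ℕ) (π : Equiv.Perm (Fin n)) :
    minorDet s (c ∘ π) = (Equiv.Perm.sign π : ℤ) * minorDet s c := by
  have := Matrix.det_permute' π (Matrix.of fun a b : Fin n => s a (c b))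
  exact this

/-- The permutation of `Fin (n + 1)` fixing the last element and extending `π`. -/
def permSnoc {n : ℕ} (π : Equiv.Perm (Fin n)) : Equiv.Perm (Fin (n + 1)) :=
  finSuccEquivLast.symm.permCongr (Equiv.optionCongr π)

theorem sign_permSnoc {n : ℕ} (π : Equiv.Perm (Fin n)) :
    Equiv.Perm.sign (permSnoc π) = Equiv.Perm.sign π := by
  rw [permSnoc, Equiv.Perm.sign_permCongr, Equiv.optionCongr_sign]

theorem snoc_comp_perm {n : ℕ} (c : Fin n → ℕ) (π : Equiv.Perm (Fin n)) (k : ℕ) :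
    (Fin.snoc (c ∘ π) k : Fin (n + 1) → ℕ) = (Fin.snoc c k : Fin (n + 1) → ℕ) ∘ permSnoc π := by
  funext x
  refine Fin.lastCases ?_ (fun x => ?_) x
  · simp [permSnoc]
  · simp [permSnoc]

theorem exists_perm_swap {n : ℕ} (c : Fin n → ℕ) (a b : ℕ) :
    ∃ π : Equiv.Perm (Fin (n + 2)), Equiv.Perm.sign π = -1 ∧
      (Fin.snoc (Fin.snoc c b : Fin (n + 1) → ℕ) a : Fin (n + 2) → ℕ)
        = (Fin.snoc (Fin.snoc c a : Fin (n + 1) → ℕ) b : Fin (n + 2) → ℕ) ∘ π := by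
  refine ⟨Equiv.swap (Fin.last n).castSucc (Fin.last (n + 1)), ?_, ?_⟩
  · apply Equiv.Perm.sign_swap
    exact (Fin.castSucc_lt_last _).ne
  · funext x
    refine Fin.lastCases ?_ (fun x => ?_) x
    · simp
    · refine Fin.lastCases ?_ (fun x => ?_) x
      · simp
      · rw [Function.comp_apply, Equiv.swap_apply_of_ne_of_ne]
        · simp
        · exact fun h => (Fin.castSucc_lt_last x).ne (Fin.castSucc_injective _ h)
        · exact (Fin.castSucc_lt_last _).ne

theorem minorDet_snoc_eq_cramer {n : ℕ} (J : Fin n → ℕ) (a k : ℕ) :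
    minorDet s (Fin.snoc J k : Fin (n + 1) → ℕ)
      = (Matrix.of fun x y : Fin (n + 1) => s x ((Fin.snoc J a : Fin (n + 1) → ℕ) y)).cramer
        (fun x => s x k) (Fin.last n) := by
  rw [Matrix.cramer_apply, minorDet]
  congr 1
  ext x y
  refine Fin.lastCases ?_ (fun y => ?_) y
  · simp
  · rw [Matrix.updateCol_ne (Fin.castSucc_lt_last _).ne]
    simp

/-- The three-term Plücker relation. -/
theorem minorDet_plucker {n : ℕ} (J : Fin n → ℕ) (a b k : ℕ) :
    minorDet s (Fin.snoc (Fin.snoc J a : Fin (n + 1) → ℕ) b : Fin (n + 2) → ℕ)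
        * minorDet s (Fin.snoc J k : Fin (n + 1) → ℕ)
      = minorDet s (Fin.snoc (Fin.snoc J a : Fin (n + 1) → ℕ) k : Fin (n + 2) → ℕ)
          * minorDet s (Fin.snoc J b : Fin (n + 1) → ℕ)
        + minorDet s (Fin.snoc (Fin.snoc J k : Fin (n + 1) → ℕ) b : Fin (n + 2) → ℕ)
          * minorDet s (Fin.snoc J a : Fin (n + 1) → ℕ) := by
  set c : Fin (n + 2) → ℕ := Fin.snoc (Fin.snoc J a : Fin (n + 1) → ℕ) b with hc
  set N : Matrix (Fin (n + 2)) (Fin (n + 2)) R := Matrix.of fun x y => s x (c y) with hN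
  set X := N.cramer (fun x => s x k) with hX
  have h1 := Matrix.mulVec_cramer N (fun x => s x k)
  rw [← hX] at h1
  set L := fun w : Fin (n + 1) → R =>
    (Matrix.of fun x y : Fin (n + 1) => s x ((Fin.snoc J a : Fin (n + 1) → ℕ) y)).cramer w
      (Fin.last n) with hL
  have hLk : ∀ k, minorDet s (Fin.snoc J k : Fin (n + 1) → ℕ) = L (fun x => s x k) :=
    fun k => minorDet_snoc_eq_cramer s J a k
  have h2 : (N.det • fun x : Fin (n + 1) => s x k)
      = ∑ y, X y • fun x : Fin (n + 1) => s x (c y) := by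
    funext x
    have := congrFun h1 x.castSucc
    simp only [Matrix.mulVec, dotProduct, Pi.smul_apply, smul_eq_mul, hN, Matrix.of_apply,
      Fin.val_castSucc] at this
    simp only [Finset.sum_apply, Pi.smul_apply, smul_eq_mul]
    rw [hN, ← this]
    exact Finset.sum_congr rfl fun y _ => mul_comm _ _
  have h3 : N.det * L (fun x => s x k) = ∑ y, X y * L (fun x => s x (c y)) := by
    have h4 := congrArg L h2
    simp only [hL, map_smul, map_sum, Finset.sum_apply, Pi.smul_apply, smul_eq_mul] at h4
    exact h4
  have h5 : ∀ y : Fin n, L (fun x => s x (J y)) = 0 := by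
    intro y
    rw [← hLk, minorDet]
    apply Matrix.det_zero_of_column_eq (i := y.castSucc) (j := Fin.last n)
      (Fin.castSucc_lt_last _).ne
    intro x
    simp
  have hXb : X (Fin.last (n + 1))
      = minorDet s (Fin.snoc (Fin.snoc J a : Fin (n + 1) → ℕ) k : Fin (n + 2) → ℕ) := by
    rw [minorDet_snoc_eq_cramer s _ b]
  have hXa : X (Fin.last n).castSucc
      = minorDet s (Fin.snoc (Fin.snoc J k : Fin (n + 1) → ℕ) b : Fin (n + 2) → ℕ) := by
    rw [hX, Matrix.cramer_apply, minorDet]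
    congr 1
    ext x y
    by_cases hy : y = (Fin.last n).castSucc
    · subst hy; simp
    · rw [Matrix.updateCol_ne hy]
      revert hy
      refine Fin.lastCases ?_ (fun y => ?_) y
      · simp [hN, hc]
      · refine Fin.lastCases ?_ (fun y => ?_) y
        · simp
        · simp [hN, hc]
  rw [hLk, hLk, hLk, ← hXb, ← hXa]
  change N.det * _ = _
  rw [h3, Fin.sum_univ_castSucc, Fin.sum_univ_castSucc]
  simp only [hc, Fin.snoc_castSucc, Fin.snoc_last, h5, mul_zero, Finset.sum_const_zero, zero_add]
  ring

end MinorDet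

section Extension

/-- The extension of `f` from the non-real points by taking limits. -/
def extReal (f : ℂ → ℂ) (z : ℂ) : ℂ := limUnder (nhdsWithin z {w | w.im ≠ 0}) f

theorem nhdsWithin_im_ne_neBot (z : ℂ) : (nhdsWithin z {w : ℂ | w.im ≠ 0}).NeBot := by
  rw [← mem_closure_iff_nhdsWithin_neBot, mem_closure_iff_seq_limit]
  by_cases h : z.im = 0
  · refine ⟨fun n => z + ((1 / ((n : ℝ) + 1) : ℝ) : ℂ) * Complex.I, fun n => ?_, ?_⟩
    · simp only [mem_ofPred_eq, Complex.add_im, h, Complex.mul_im, Complex.ofReal_re,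
        Complex.I_im, mul_one, Complex.ofReal_im, Complex.I_re, mul_zero, add_zero, zero_add]
      positivity
    · have h1 := tendsto_one_div_add_atTop_nhds_zero_nat (𝕜 := ℝ)
      have h2 := ((Complex.continuous_ofReal.tendsto _).comp h1).mul_const Complex.I
      have h3 := h2.const_add z
      simpa using h3
  · exact ⟨fun _ => z, fun _ => h, tendsto_const_nhds⟩

theorem extReal_eq {f g : ℂ → ℂ} {z : ℂ} (hg : ContinuousAt g z)
    (h : ∀ᶠ w in nhdsWithin z {w : ℂ | w.im ≠ 0}, f w = g w) : extReal f z = g z := by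
  have := nhdsWithin_im_ne_neBot z
  exact ((hg.tendsto.mono_left nhdsWithin_le_nhds).congr' (h.mono fun w hw => hw.symm)).limUnder_eq

theorem isOpen_im_ne : IsOpen {w : ℂ | w.im ≠ 0} :=
  isOpen_ne_fun Complex.continuous_im continuous_const

theorem extReal_eq_self {f : ℂ → ℂ} (hf : ContinuousOn f {w : ℂ | w.im ≠ 0}) {z : ℂ}
    (hz : z.im ≠ 0) : extReal f z = f z :=
  extReal_eq (hf.continuousAt (isOpen_im_ne.mem_nhds hz)) (Eventually.of_forall fun _ => rfl)

/-- Two functions continuous on an open set that agree off the real line agree on that set. -/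
theorem eqOn_of_eq_im_ne {f g : ℂ → ℂ} {U : Set ℂ} (hU : IsOpen U) (hf : ContinuousOn f U)
    (hg : ContinuousOn g U) (h : ∀ z ∈ U, z.im ≠ 0 → f z = g z) : ∀ z ∈ U, f z = g z := by
  intro z hz
  have := nhdsWithin_im_ne_neBot z
  refine tendsto_nhds_unique_of_eventuallyEq
    ((hf.continuousAt (hU.mem_nhds hz)).tendsto.mono_left
      (nhdsWithin_le_nhds (s := {w : ℂ | w.im ≠ 0})))
    ((hg.continuousAt (hU.mem_nhds hz)).tendsto.mono_left nhdsWithin_le_nhds) ?_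
  filter_upwards [self_mem_nhdsWithin, nhdsWithin_le_nhds (hU.mem_nhds hz)] with w h1 h2
  exact h w h2 h1

theorem extReal_eqOn {f g : ℂ → ℂ} {U : Set ℂ} (hU : IsOpen U) (hg : ContinuousOn g U)
    (h : ∀ z ∈ U, z.im ≠ 0 → f z = g z) : ∀ z ∈ U, extReal f z = g z := by
  intro z hz
  refine extReal_eq (hg.continuousAt (hU.mem_nhds hz)) ?_
  filter_upwards [self_mem_nhdsWithin, nhdsWithin_le_nhds (hU.mem_nhds hz)] with w h1 h2
  exact h w h2 h1

end Extension

/-- Generating measures of a Nikishin system, `μ j` living on `[A j, B j]`; the measures with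
`1 ≤ j ≤ m` have infinite support. -/
structure NikGen (μ : ℕ → Measure ℝ) (A B : ℕ → ℝ) (m : ℕ) : Prop where
  fin : ∀ j, IsFiniteMeasure (μ j)
  null : ∀ j, μ j (Icc (A j) (B j))ᶜ = 0
  good : ∀ j, 1 ≤ j → j ≤ m → Good (μ j) (A j) (B j)
  disj : ∀ j, Disjoint (Icc (A j) (B j)) (Icc (A (j + 1)) (B (j + 1)))

/-- The iterated Cauchy transform of `d` consecutive measures starting from `μ (q + 1)`. -/
def cauchyIter (μ : ℕ → Measure ℝ) : ℕ → ℕ → ℂ → ℂ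
  | 0, _, _ => 1
  | d + 1, q, z => ∫ y, cauchyIter μ d (q + 1) (y : ℂ) * (z - (y : ℂ))⁻¹ ∂μ (q + 1)

/-- The unipotent upper triangular matrix of iterated Cauchy transforms. -/
def cauchyMat (μ : ℕ → Measure ℝ) (q k : ℕ) (z : ℂ) : ℂ :=
  if k < q then 0 else cauchyIter μ (k - q) q z

/-- The minors of `cauchyMat` on the first rows. -/
def cauchyMinor (μ : ℕ → Measure ℝ) {n : ℕ} (c : Fin n → ℕ) (z : ℂ) : ℂ :=
  minorDet (fun q k => cauchyMat μ q k z) c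

/-- The continuous extension of `cauchyMinor`. -/
def extMinor (μ : ℕ → Measure ℝ) {n : ℕ} (c : Fin n → ℕ) : ℂ → ℂ := extReal (cauchyMinor μ c)

/-- The number of entries of `c` that are at least `N`. -/
def countGE (N : ℕ) {n : ℕ} (c : Fin n → ℕ) : ℕ := ∑ b, if N ≤ c b then 1 else 0

theorem countGE_snoc (N : ℕ) {n : ℕ} (c : Fin n → ℕ) (k : ℕ) :
    countGE N (Fin.snoc c k : Fin (n + 1) → ℕ) = countGE N c + if N ≤ k then 1 else 0 := by
  simp only [countGE, Fin.sum_univ_castSucc, Fin.snoc_castSucc, Fin.snoc_last]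

theorem countGE_perm (N : ℕ) {n : ℕ} (c : Fin n → ℕ) (π : Equiv.Perm (Fin n)) :
    countGE N (c ∘ π) = countGE N c :=
  Equiv.sum_comp π fun b => if N ≤ c b then 1 else 0

namespace NikGen

variable {μ : ℕ → Measure ℝ} {A B : ℕ → ℝ} {m : ℕ}

theorem offSeg_succ (h : NikGen μ A B m) {j : ℕ} {x : ℝ} (hx : x ∈ Icc (A j) (B j)) :
    OffSeg (A (j + 1)) (B (j + 1)) (x : ℂ) :=
  offSeg_ofReal.2 fun h' => Set.disjoint_left.1 (h.disj j) hx h'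

theorem offSeg_pred (h : NikGen μ A B m) {j : ℕ} {x : ℝ}
    (hx : x ∈ Icc (A (j + 1)) (B (j + 1))) : OffSeg (A j) (B j) (x : ℂ) :=
  offSeg_ofReal.2 fun h' => Set.disjoint_left.1 (h.disj j) h' hx

theorem continuousOn_cauchyIter (h : NikGen μ A B m) (d q : ℕ) :
    ContinuousOn (cauchyIter μ d q) {z | OffSeg (A (q + 1)) (B (q + 1)) z} := by
  induction d generalizing q with
  | zero => exact continuousOn_const
  | succ d ih =>
    have := h.fin (q + 1)
    exact continuousOn_cauchy (h.null (q + 1)) ((ih (q + 1)).comp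
      Complex.continuous_ofReal.continuousOn fun x hx => h.offSeg_succ hx)

theorem continuousOn_cauchyIter_Icc (h : NikGen μ A B m) (d q : ℕ) :
    ContinuousOn (fun y : ℝ => cauchyIter μ d q (y : ℂ)) (Icc (A q) (B q)) :=
  (h.continuousOn_cauchyIter d q).comp
    Complex.continuous_ofReal.continuousOn fun _ hx => h.offSeg_succ hx

theorem cauchyIter_conj (μ : ℕ → Measure ℝ) (d q : ℕ) (z : ℂ) :
    cauchyIter μ d q (starRingEnd ℂ z) = starRingEnd ℂ (cauchyIter μ d q z) := by
  induction d generalizing q z with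
  | zero => simp [cauchyIter]
  | succ d ih =>
    rw [cauchyIter, cauchyIter, ← integral_conj]
    congr 1
    ext y
    have h1 := ih (q + 1) (y : ℂ)
    rw [Complex.conj_ofReal] at h1
    rw [map_mul, ← h1, map_inv₀, map_sub, Complex.conj_ofReal]

theorem tendsto_cauchyIter (h : NikGen μ A B m) (d q : ℕ) :
    ∃ c : ℂ, Tendsto (fun t : ℝ => ((t : ℂ) * Complex.I) ^ (if d = 0 then 0 else 1)
      * cauchyIter μ d q (t * Complex.I)) atTop (nhds c) := by
  rcases d with _ | d
  · exact ⟨1, by simp [cauchyIter]⟩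
  · have := h.fin (q + 1)
    have h1 := tendsto_mul_cauchy (h.null (q + 1)) (h.continuousOn_cauchyIter_Icc d (q + 1))
    exact ⟨_, by simpa [cauchyIter] using h1⟩

theorem tendsto_inv_mul_I : Tendsto (fun t : ℝ => ((t : ℂ) * Complex.I)⁻¹) atTop (nhds 0) :=
  tendsto_inv₀_cobounded.comp (tendsto_norm_atTop_iff_cobounded.1 tendsto_norm_mul_I)

theorem tendsto_cauchyMat (h : NikGen μ A B m) {n : ℕ} (q : Fin n) (k : ℕ) :
    ∃ c : ℂ, Tendsto (fun t : ℝ => ((t : ℂ) * Complex.I) ^ (if n ≤ k then 1 else 0)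
      * cauchyMat μ q k (t * Complex.I)) atTop (nhds c) := by
  by_cases hk : k < q
  · exact ⟨0, by simp [cauchyMat, hk]⟩
  · obtain ⟨c, hc⟩ := h.tendsto_cauchyIter (k - q) q
    have hq := q.2
    by_cases hn : n ≤ k
    · refine ⟨c, ?_⟩
      simpa [cauchyMat, hk, hn, show k - (q : ℕ) ≠ 0 by omega] using hc
    · by_cases h0 : k - (q : ℕ) = 0
      · refine ⟨c, ?_⟩
        simpa [cauchyMat, hk, hn, h0] using hc
      · refine ⟨0 * c, (tendsto_inv_mul_I.mul hc).congr' ?_⟩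
        filter_upwards [eventually_gt_atTop 0] with t ht
        have hz : (t : ℂ) * Complex.I ≠ 0 := by simp [ht.ne']
        simp only [h0, if_false, pow_one, cauchyMat, hk, hn, pow_zero, one_mul]
        rw [inv_mul_cancel_left₀ hz]

theorem tendsto_cauchyMinor (h : NikGen μ A B m) {n : ℕ} (c : Fin n → ℕ) :
    ∃ C : ℂ, Tendsto (fun t : ℝ => ((t : ℂ) * Complex.I) ^ countGE n c
      * cauchyMinor μ c (t * Complex.I)) atTop (nhds C) := by
  choose L hL using fun (a b : Fin n) => h.tendsto_cauchyMat a (c b)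
  refine ⟨(Matrix.of fun a b => L a b).det, ?_⟩
  have h1 : Tendsto (fun t : ℝ => (Matrix.of fun a b : Fin n =>
      ((t : ℂ) * Complex.I) ^ (if n ≤ c b then 1 else 0)
        * cauchyMat μ a (c b) (t * Complex.I))) atTop (nhds (Matrix.of fun a b => L a b)) := by
    refine tendsto_pi_nhds.2 fun a => tendsto_pi_nhds.2 fun b => hL a b
  have h2 := ((continuous_id.matrix_det).tendsto (Matrix.of fun a b => L a b)).comp h1
  refine h2.congr fun t => ?_
  have h3 := Matrix.det_mul_row
    (fun b : Fin n => ((t : ℂ) * Complex.I) ^ (if n ≤ c b then 1 else 0))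
    (Matrix.of fun a b : Fin n => cauchyMat μ a (c b) (t * Complex.I))
  rw [Finset.prod_pow_eq_pow_sum] at h3
  exact h3

theorem continuousOn_cauchyMinor (h : NikGen μ A B m) {n : ℕ} (c : Fin n → ℕ) :
    ContinuousOn (cauchyMinor μ c) {z | z.im ≠ 0} := by
  refine (continuous_id.matrix_det).comp_continuousOn (continuousOn_pi.2 fun a =>
    continuousOn_pi.2 fun b => ?_)
  change ContinuousOn (fun z => cauchyMat μ a (c b) z) _
  by_cases hk : c b < a
  · simp only [cauchyMat, hk, if_true]; exact continuousOn_const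
  · simp only [cauchyMat, hk, if_false]
    exact (h.continuousOn_cauchyIter _ _).mono fun z hz => offSeg_of_im_ne hz

theorem cauchyMinor_conj (μ : ℕ → Measure ℝ) {n : ℕ} (c : Fin n → ℕ) (z : ℂ) :
    cauchyMinor μ c (starRingEnd ℂ z) = starRingEnd ℂ (cauchyMinor μ c z) := by
  rw [cauchyMinor, cauchyMinor, minorDet, minorDet, RingHom.map_det]
  congr 1
  ext a b
  by_cases hk : c b < a
  · simp [cauchyMat, hk]
  · simp [cauchyMat, hk, cauchyIter_conj]

theorem extMinor_eq (h : NikGen μ A B m) {n : ℕ} (c : Fin n → ℕ) {z : ℂ} (hz : z.im ≠ 0) :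
    extMinor μ c z = cauchyMinor μ c z :=
  extReal_eq_self (h.continuousOn_cauchyMinor c) hz

theorem cauchyMinor_perm (μ : ℕ → Measure ℝ) {n : ℕ} (c : Fin n → ℕ)
    (π : Equiv.Perm (Fin n)) (z : ℂ) :
    cauchyMinor μ (c ∘ π) z = (Equiv.Perm.sign π : ℤ) * cauchyMinor μ c z :=
  minorDet_perm _ c π

end NikGen

/-- Regularity of a minor: its extension is continuous and zero-free off the corresponding
interval and has the expected order at infinity. -/
structure RegMinor (μ : ℕ → Measure ℝ) (A B : ℕ → ℝ) {n : ℕ} (c : Fin n → ℕ) : Prop where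
  cont : ContinuousOn (extMinor μ c) {z | OffSeg (A n) (B n) z}
  ne : ∀ z, OffSeg (A n) (B n) z → extMinor μ c z ≠ 0
  lead : ∀ C : ℂ, Tendsto (fun t : ℝ => ((t : ℂ) * Complex.I) ^ countGE n c
      * cauchyMinor μ c (t * Complex.I)) atTop (nhds C) → C ≠ 0

namespace RegMinor

variable {μ : ℕ → Measure ℝ} {A B : ℕ → ℝ} {m n : ℕ}

theorem mk_of_eq {c : Fin n → ℕ} {g : ℂ → ℂ}
    (hg : ContinuousOn g {z | OffSeg (A n) (B n) z})
    (he : ∀ z, z.im ≠ 0 → cauchyMinor μ c z = g z)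
    (hne : ∀ z, OffSeg (A n) (B n) z → g z ≠ 0)
    (lead : ∀ C : ℂ, Tendsto (fun t : ℝ => ((t : ℂ) * Complex.I) ^ countGE n c
      * cauchyMinor μ c (t * Complex.I)) atTop (nhds C) → C ≠ 0) :
    RegMinor μ A B c := by
  have h1 : ∀ z ∈ {z | OffSeg (A n) (B n) z}, extMinor μ c z = g z :=
    extReal_eqOn (isOpen_offSeg _ _) hg fun z _ hz => he z hz
  exact ⟨hg.congr h1, fun z hz => by rw [h1 z hz]; exact hne z hz, lead⟩

theorem perm_of_cont {c : Fin n → ℕ} (h : NikGen μ A B m)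
    (hc : ContinuousOn (extMinor μ c) {z | OffSeg (A n) (B n) z}) (π : Equiv.Perm (Fin n)) :
    ContinuousOn (extMinor μ (c ∘ π)) {z | OffSeg (A n) (B n) z} ∧ ∀ z, OffSeg (A n) (B n) z →
      extMinor μ (c ∘ π) z = (Equiv.Perm.sign π : ℤ) * extMinor μ c z := by
  have hg : ContinuousOn (fun z => ((Equiv.Perm.sign π : ℤ) : ℂ) * extMinor μ c z)
    {z | OffSeg (A n) (B n) z} := continuousOn_const.mul hc
  have he : ∀ z ∈ {z | OffSeg (A n) (B n) z},
      extMinor μ (c ∘ π) z = ((Equiv.Perm.sign π : ℤ) : ℂ) * extMinor μ c z :=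
    extReal_eqOn (isOpen_offSeg _ _) hg fun z _ hz => by
      rw [NikGen.cauchyMinor_perm, h.extMinor_eq c hz]
  exact ⟨hg.congr he, he⟩

theorem perm {c : Fin n → ℕ} (h : NikGen μ A B m) (hc : RegMinor μ A B c)
    (π : Equiv.Perm (Fin n)) : RegMinor μ A B (c ∘ π) := by
  have hs : ((Equiv.Perm.sign π : ℤ) : ℂ) * ((Equiv.Perm.sign π : ℤ) : ℂ) = 1 := by
    rcases Int.units_eq_one_or (Equiv.Perm.sign π) with h | h <;> simp [h]
  have hs0 : ((Equiv.Perm.sign π : ℤ) : ℂ) ≠ 0 := fun h0 => by simp [h0] at hs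
  refine mk_of_eq (continuousOn_const.mul hc.cont)
    (fun z hz => by rw [Pi.mul_apply, NikGen.cauchyMinor_perm, h.extMinor_eq c hz])
    (fun z hz => mul_ne_zero hs0 (hc.ne z hz)) fun C hC hC0 => ?_
  refine hc.lead _ ?_ (mul_eq_zero_of_right ((Equiv.Perm.sign π : ℤ) : ℂ) hC0)
  refine (hC.const_mul _).congr fun t => ?_
  rw [NikGen.cauchyMinor_perm, countGE_perm]
  linear_combination (((t : ℂ) * Complex.I) ^ countGE n c
    * cauchyMinor μ c (t * Complex.I)) * hs

theorem extMinor_real {c : Fin n → ℕ} (h : NikGen μ A B m) (hc : RegMinor μ A B c) {x : ℝ}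
    (hx : OffSeg (A n) (B n) (x : ℂ)) : extMinor μ c (x : ℂ) = ((extMinor μ c (x : ℂ)).re : ℂ) := by
  have hconj : ∀ z, OffSeg (A n) (B n) z → OffSeg (A n) (B n) (starRingEnd ℂ z) := by
    intro z hz y hy he
    apply hz y hy
    rw [← Complex.conj_conj z, he, Complex.conj_ofReal]
  have h1 := extReal_eqOn (f := cauchyMinor μ c)
    (g := fun z => starRingEnd ℂ (extMinor μ c (starRingEnd ℂ z)))
    (isOpen_offSeg (A n) (B n)) (Complex.continuous_conj.comp_continuousOn
      (hc.cont.comp Complex.continuous_conj.continuousOn hconj)) (fun z _ hz => by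
        rw [h.extMinor_eq c (by simpa using hz), NikGen.cauchyMinor_conj, Complex.conj_conj])
        (x : ℂ) hx
  rw [Complex.conj_ofReal] at h1
  exact (Complex.conj_eq_iff_re.1 h1.symm).symm

end RegMinor

/-- The `n`-th minor along `c` extends continuously off the `n`-th interval. -/
def ContMinor (μ : ℕ → Measure ℝ) (A B : ℕ → ℝ) {n : ℕ} (c : Fin n → ℕ) : Prop :=
  ContinuousOn (extMinor μ c) {z | OffSeg (A n) (B n) z}

/-- Appending a label to a tuple of labels. -/
abbrev app {n : ℕ} (c : Fin n → ℕ) (k : ℕ) : Fin (n + 1) → ℕ := Fin.snoc c k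

/-- The integral representation of the quotients `extMinor (J, k) / extMinor (J, a)` with respect
to a single measure. -/
structure Exchange (μ : ℕ → Measure ℝ) (A B : ℕ → ℝ) (m : ℕ) {i : ℕ} (J : Fin i → ℕ) (a : ℕ)
    (κ : Measure ℝ) : Prop where
  fin : IsFiniteMeasure κ
  null : κ (Icc (A (i + 1)) (B (i + 1)))ᶜ = 0
  good : i + 1 ≤ m → Good κ (A (i + 1)) (B (i + 1))
  cont : ∀ k ≤ m, k ≠ a → (∀ x, J x ≠ k) → ContMinor μ A B (app (app J a) k)
  rep : ∀ k ≤ m, k ≠ a → (∀ x, J x ≠ k) → ∃ ℓ : ℂ[X], ∀ z, OffSeg (A (i + 1)) (B (i + 1)) z →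
    extMinor μ (app J k) z = extMinor μ (app J a) z *
      (ℓ.eval z + ∫ y : ℝ, (extMinor μ J y * extMinor μ (app (app J a) k) y) * (z - y)⁻¹ ∂κ)

/-- All structural facts about the tuple `(J, a)`. -/
structure Regular (μ : ℕ → Measure ℝ) (A B : ℕ → ℝ) (m : ℕ) {i : ℕ} (J : Fin i → ℕ)
    (a : ℕ) : Prop where
  contJ : ContMinor μ A B J
  reg : RegMinor μ A B (app J a)
  ex : ∃ κ, Exchange μ A B m J a κ

section Structure

variable {μ : ℕ → Measure ℝ} {A B : ℕ → ℝ} {m i : ℕ}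

theorem ContMinor.continuousOn_Icc_succ (h : NikGen μ A B m) {n : ℕ} {c : Fin n → ℕ}
    (hc : ContMinor μ A B c) :
    ContinuousOn (fun x : ℝ => extMinor μ c (x : ℂ)) (Icc (A (n + 1)) (B (n + 1))) :=
  hc.comp Complex.continuous_ofReal.continuousOn fun _ hx => h.offSeg_pred hx

theorem ContMinor.continuousOn_Icc_pred (h : NikGen μ A B m) {n : ℕ} {c : Fin (n + 1) → ℕ}
    (hc : ContMinor μ A B c) :
    ContinuousOn (fun x : ℝ => extMinor μ c (x : ℂ)) (Icc (A n) (B n)) :=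
  hc.comp Complex.continuous_ofReal.continuousOn fun _ hx => h.offSeg_succ hx

theorem continuousOn_poly_add_cauchy {κ : Measure ℝ} [IsFiniteMeasure κ] {a b : ℝ}
    (hκ : κ (Icc a b)ᶜ = 0) {φ : ℝ → ℂ} (hφ : ContinuousOn φ (Icc a b)) (ℓ : ℂ[X]) :
    ContinuousOn (fun z => ℓ.eval z + ∫ y, φ y * (z - (y : ℂ))⁻¹ ∂κ) {z | OffSeg a b z} :=
  ℓ.continuous.continuousOn.add (continuousOn_cauchy hκ hφ)

theorem continuousOn_weight (h : NikGen μ A B m) {J : Fin i → ℕ} {c : Fin (i + 2) → ℕ}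
    (hJ : ContMinor μ A B J) (hc : ContMinor μ A B c) :
    ContinuousOn (fun y : ℝ => extMinor μ J (y : ℂ) * extMinor μ c (y : ℂ))
      (Icc (A (i + 1)) (B (i + 1))) :=
  (hJ.continuousOn_Icc_succ h).mul (hc.continuousOn_Icc_pred h)

/-- Minors occurring in an exchange relation extend continuously. -/
theorem Exchange.contMinor (h : NikGen μ A B m) {J : Fin i → ℕ} {a : ℕ} {κ : Measure ℝ}
    (hκ : Exchange μ A B m J a κ) (hJ : ContMinor μ A B J) (ha : ContMinor μ A B (app J a))
    {k : ℕ} (hk : k ≤ m) (hka : k ≠ a) (hkJ : ∀ x, J x ≠ k) : ContMinor μ A B (app J k) := by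
  obtain ⟨ℓ, hℓ⟩ := hκ.rep k hk hka hkJ
  have := hκ.fin
  exact (ha.mul (continuousOn_poly_add_cauchy hκ.null
    (continuousOn_weight h hJ (hκ.cont k hk hka hkJ)) ℓ)).congr hℓ

theorem Regular.perm (h : NikGen μ A B m) {J : Fin i → ℕ} {a : ℕ} (hr : Regular μ A B m J a)
    (π : Equiv.Perm (Fin i)) : Regular μ A B m (J ∘ π) a := by
  obtain ⟨hJ, ha, κ, hκ⟩ := hr
  have hs : ((Equiv.Perm.sign π : ℤ) : ℂ) * ((Equiv.Perm.sign π : ℤ) : ℂ) = 1 := by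
    rcases Int.units_eq_one_or (Equiv.Perm.sign π) with h | h <;> simp [h]
  have hJπ := RegMinor.perm_of_cont h hJ π
  have hk1 : ∀ k, ContMinor μ A B (app J k) → ContMinor μ A B (app (J ∘ π) k) ∧
      ∀ z, OffSeg (A (i + 1)) (B (i + 1)) z →
        extMinor μ (app (J ∘ π) k) z = (Equiv.Perm.sign π : ℤ) * extMinor μ (app J k) z := by
    intro k hk
    have := RegMinor.perm_of_cont h hk (permSnoc π)
    rwa [← snoc_comp_perm, sign_permSnoc] at this
  have hk2 : ∀ k, ContMinor μ A B (app (app J a) k) → ContMinor μ A B (app (app (J ∘ π) a) k) ∧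
      ∀ z, OffSeg (A (i + 2)) (B (i + 2)) z → extMinor μ (app (app (J ∘ π) a) k) z
        = (Equiv.Perm.sign π : ℤ) * extMinor μ (app (app J a) k) z := by
    intro k hk
    have := RegMinor.perm_of_cont h hk (permSnoc (permSnoc π))
    rwa [← snoc_comp_perm, ← snoc_comp_perm, sign_permSnoc, sign_permSnoc] at this
  refine ⟨hJπ.1, ?_, κ, hκ.fin, hκ.null, hκ.good, ?_, ?_⟩
  · have := ha.perm h (permSnoc π)
    rwa [← snoc_comp_perm] at this
  · intro k hk hka hkJ
    have hkJ' : ∀ x, J x ≠ k := fun x => by simpa using hkJ (π.symm x)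
    exact (hk2 k (hκ.cont k hk hka hkJ')).1
  · intro k hk hka hkJ
    have hkJ' : ∀ x, J x ≠ k := fun x => by simpa using hkJ (π.symm x)
    obtain ⟨ℓ, hℓ⟩ := hκ.rep k hk hka hkJ'
    refine ⟨ℓ, fun z hz => ?_⟩
    rw [(hk1 k (hκ.contMinor h hJ ha.cont hk hka hkJ')).2 z hz, (hk1 a ha.cont).2 z hz, hℓ z hz,
      mul_assoc]
    congr 3
    apply integral_congr_ae
    filter_upwards [ae_mem_Icc hκ.null] with y hy
    rw [hJπ.2 _ (h.offSeg_pred hy), (hk2 k (hκ.cont k hk hka hkJ')).2 _ (h.offSeg_succ hy)]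
    congr 1
    linear_combination (-extMinor μ J y * extMinor μ (app (app J a) k) y) * hs

theorem extMinor_swap (h : NikGen μ A B m) {J : Fin i → ℕ} {a b : ℕ}
    (hc : ContMinor μ A B (app (app J a) b)) : ContMinor μ A B (app (app J b) a) ∧
      ∀ z, OffSeg (A (i + 2)) (B (i + 2)) z →
        extMinor μ (app (app J b) a) z = -extMinor μ (app (app J a) b) z := by
  obtain ⟨π, hπ, he⟩ := exists_perm_swap J a b
  have := RegMinor.perm_of_cont h hc π
  rw [← he, hπ] at this
  refine ⟨this.1, fun z hz => ?_⟩
  rw [this.2 z hz]; simp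

theorem extMinor_swap' (h : NikGen μ A B m) {J : Fin i → ℕ} {a b k : ℕ}
    (hc : ContMinor μ A B (app (app (app J a) b) k)) :
    ContMinor μ A B (app (app (app J b) a) k) ∧
      ∀ z, OffSeg (A (i + 3)) (B (i + 3)) z →
        extMinor μ (app (app (app J b) a) k) z = -extMinor μ (app (app (app J a) b) k) z := by
  obtain ⟨π, hπ, he⟩ := exists_perm_swap J a b
  have := RegMinor.perm_of_cont h hc (permSnoc π)
  rw [← snoc_comp_perm, ← he, sign_permSnoc, hπ] at this
  refine ⟨this.1, fun z hz => ?_⟩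
  rw [this.2 z hz]; simp

theorem extMinor_plucker (h : NikGen μ A B m) (J : Fin i → ℕ) (a b k : ℕ) {z : ℂ}
    (hz : z.im ≠ 0) :
    extMinor μ (app (app J a) b) z * extMinor μ (app J k) z
      = extMinor μ (app (app J a) k) z * extMinor μ (app J b) z
        - extMinor μ (app (app J b) k) z * extMinor μ (app J a) z := by
  obtain ⟨π, hπ, he⟩ := exists_perm_swap J b k
  have h1 := NikGen.cauchyMinor_perm μ (app (app J b) k) π z
  rw [← he, hπ] at h1
  have h2 := minorDet_plucker (fun q k => cauchyMat μ q k z) J a b k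
  simp only [h.extMinor_eq _ hz]
  simp only [cauchyMinor] at h1 ⊢
  rw [h2, h1]
  push_cast
  ring

theorem Exchange.core (h : NikGen μ A B m) {J : Fin i → ℕ} {a b : ℕ} {τ ρ : Measure ℝ}
    (hJ : ContMinor μ A B J) (ha : RegMinor μ A B (app J a))
    (hab : RegMinor μ A B (app (app J a) b)) (hτ : Exchange μ A B m J a τ)
    (hρ : Exchange μ A B m (app J a) b ρ) (hb : b ≤ m) (hba : b ≠ a) (hbJ : ∀ x, J x ≠ b)
    {k : ℕ} (hk : k ≤ m) (hka : k ≠ a) (hkb : k ≠ b) (hkJ : ∀ x, J x ≠ k) :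
    ContMinor μ A B (app (app J b) k) ∧ ∃ P : ℂ[X], ∀ z, OffSeg (A (i + 2)) (B (i + 2)) z →
      extMinor μ (app (app J b) k) z = extMinor μ (app (app J a) b) z *
        (P.eval z + ∫ y : ℝ, (extMinor μ (app J b) y * extMinor μ (app (app (app J a) b) k) y)
          * (z - y)⁻¹ ∂ρ) := by
  have hkJa : ∀ x, (app J a) x ≠ k := by
    intro x
    refine Fin.lastCases ?_ (fun x => ?_) x
    · simpa using hka.symm
    · simpa using hkJ x
  have := hτ.fin
  have := hρ.fin
  obtain ⟨p, hp⟩ := hτ.rep b hb hba hbJ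
  obtain ⟨pk, hpk⟩ := hτ.rep k hk hka hkJ
  obtain ⟨q, hq⟩ := hρ.rep k hk hkb hkJa
  have hψ := continuousOn_weight h hJ hab.cont
  have hφ := continuousOn_weight h ha.cont (hρ.cont k hk hkb hkJa)
  obtain ⟨P, hP⟩ := poly_add_cauchy_mul hτ.null hρ.null (h.disj (i + 1)) hψ hφ p q
  have hJb := hτ.contMinor h hJ ha.cont hb hba hbJ
  have hw := continuousOn_weight h hJb (hρ.cont k hk hkb hkJa)
  have hg : ContinuousOn (fun z => extMinor μ (app (app J a) b) z *
        ((P - pk).eval z + ∫ y : ℝ, (extMinor μ (app J b) y *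
          extMinor μ (app (app (app J a) b) k) y) * (z - y)⁻¹ ∂ρ))
      {z | OffSeg (A (i + 2)) (B (i + 2)) z} :=
    hab.cont.mul (continuousOn_poly_add_cauchy hρ.null hw _)
  have key : ∀ z ∈ {z | OffSeg (A (i + 2)) (B (i + 2)) z}, z.im ≠ 0 →
      cauchyMinor μ (app (app J b) k) z = extMinor μ (app (app J a) b) z *
        ((P - pk).eval z + ∫ y : ℝ, (extMinor μ (app J b) y *
          extMinor μ (app (app (app J a) b) k) y) * (z - y)⁻¹ ∂ρ) := by
    intro z hz hzim
    have hz1 : OffSeg (A (i + 1)) (B (i + 1)) z := offSeg_of_im_ne hzim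
    have hX := ha.ne z hz1
    have hPz := hP z hz1 hz
    have e1 : ∫ y : ℝ, (q.eval (y : ℂ) + ∫ ξ : ℝ, (extMinor μ (app J a) (ξ : ℂ) *
          extMinor μ (app (app (app J a) b) k) (ξ : ℂ)) * ((y : ℂ) - (ξ : ℂ))⁻¹ ∂ρ)
          * (extMinor μ J (y : ℂ) * extMinor μ (app (app J a) b) (y : ℂ)) * (z - (y : ℂ))⁻¹ ∂τ
        = ∫ y : ℝ, (extMinor μ J y * extMinor μ (app (app J a) k) y) * (z - y)⁻¹ ∂τ := by
      apply integral_congr_ae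
      filter_upwards [ae_mem_Icc hτ.null] with y hy
      rw [hq _ (h.offSeg_succ hy)]
      ring
    have e2 : ∫ ξ : ℝ, (extMinor μ (app J a) (ξ : ℂ) *
          extMinor μ (app (app (app J a) b) k) (ξ : ℂ)) * (p.eval (ξ : ℂ) + ∫ y : ℝ,
            (extMinor μ J (y : ℂ) * extMinor μ (app (app J a) b) (y : ℂ))
              * ((ξ : ℂ) - (y : ℂ))⁻¹ ∂τ) * (z - (ξ : ℂ))⁻¹ ∂ρ
        = ∫ y : ℝ, (extMinor μ (app J b) y * extMinor μ (app (app (app J a) b) k) y)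
          * (z - y)⁻¹ ∂ρ := by
      apply integral_congr_ae
      filter_upwards [ae_mem_Icc hρ.null] with y hy
      rw [hp _ (h.offSeg_pred hy)]
      ring
    rw [e1, e2] at hPz
    have h1 := extMinor_plucker h J a b k hzim
    rw [h.extMinor_eq (app (app J b) k) hzim] at h1
    apply mul_right_cancel₀ hX
    have hqz := hq z hz
    have hpz := hp z hz1
    have hpkz := hpk z hz1
    rw [eval_sub]
    rw [hqz, hpz, hpkz] at h1
    linear_combination h1 + extMinor μ (app (app J a) b) z * extMinor μ (app J a) z * hPz
  have he := extReal_eqOn (isOpen_offSeg (A (i + 2)) (B (i + 2))) hg key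
  exact ⟨hg.congr he, P - pk, he⟩

/-- Exchanging the roles of two labels of a tuple keeps the measure. -/
theorem Regular.exchange (h : NikGen μ A B m) {J : Fin i → ℕ} {a b : ℕ}
    (ha : Regular μ A B m J a) (hab : Regular μ A B m (app J a) b) (hb : b ≤ m)
    (hba : b ≠ a) (hbJ : ∀ x, J x ≠ b) : Regular μ A B m (app J b) a := by
  obtain ⟨hJ, ha, τ, hτ⟩ := ha
  obtain ⟨-, hab, ρ, hρ⟩ := hab
  have hreg : RegMinor μ A B (app (app J b) a) := by
    obtain ⟨π, hπ, he⟩ := exists_perm_swap J a b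
    have := hab.perm h π
    rwa [← he] at this
  have hne : ∀ k, k ≠ a → (∀ x, (app J b) x ≠ k) → k ≠ b ∧ (∀ x, J x ≠ k) ∧
      ∀ x, (app J a) x ≠ k := by
    intro k hka hk
    have h1 : ∀ x, J x ≠ k := fun x => by simpa using hk x.castSucc
    refine ⟨fun e => hk (Fin.last i) (by simp [e]), h1, fun x => ?_⟩
    refine Fin.lastCases ?_ (fun x => ?_) x
    · simpa using hka.symm
    · simpa using h1 x
  refine ⟨hτ.contMinor h hJ ha.cont hb hba hbJ, hreg, ρ, hρ.fin, hρ.null, hρ.good, ?_, ?_⟩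
  · intro k hk hka hkJ
    obtain ⟨hkb, hkJ', hkJa⟩ := hne k hka hkJ
    exact (extMinor_swap' h (hρ.cont k hk hkb hkJa)).1
  · intro k hk hka hkJ
    obtain ⟨hkb, hkJ', hkJa⟩ := hne k hka hkJ
    obtain ⟨-, P, hP⟩ := Exchange.core h hJ ha hab hτ hρ hb hba hbJ hk hka hkb hkJ'
    refine ⟨-P, fun z hz => ?_⟩
    rw [hP z hz, (extMinor_swap h hab.cont).2 z hz, neg_mul, ← mul_neg]
    congr 1
    rw [eval_neg, neg_add, neg_neg]
    congr 1
    rw [← integral_neg]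
    apply integral_congr_ae
    filter_upwards [ae_mem_Icc hρ.null] with y hy
    rw [(extMinor_swap' h (hρ.cont k hk hkb hkJa)).2 _ (h.offSeg_succ hy)]
    ring

end Structure

section Base

variable {μ : ℕ → Measure ℝ} {A B : ℕ → ℝ} {m i : ℕ}

theorem cauchyMinor_app_val (μ : ℕ → Measure ℝ) (n k : ℕ) (z : ℂ) :
    cauchyMinor μ (app (fun x : Fin n => (x : ℕ)) k) z = cauchyMat μ n k z := by
  rw [cauchyMinor, minorDet, Matrix.det_of_isUpperTriangular, Fin.prod_univ_castSucc]
  · simp [cauchyMat, cauchyIter]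
  · intro a b hab
    change b < a at hab
    have hb : b ≠ Fin.last n := fun e => absurd (Fin.le_last a) (by rw [← e]; exact not_le.2 hab)
    obtain ⟨b, rfl⟩ := Fin.exists_castSucc_eq.2 hb
    have : (b : ℕ) < a := by simpa [Fin.lt_def] using hab
    simp [cauchyMat, this]

theorem app_val (n : ℕ) : app (fun x : Fin n => (x : ℕ)) n = fun x : Fin (n + 1) => (x : ℕ) := by
  ext x
  refine Fin.lastCases ?_ (fun x => ?_) x <;> simp

theorem cauchyMinor_val (μ : ℕ → Measure ℝ) (n : ℕ) (z : ℂ) :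
    cauchyMinor μ (fun x : Fin n => (x : ℕ)) z = 1 := by
  rcases n with _ | n
  · simp [cauchyMinor, minorDet]
  · rw [← app_val, cauchyMinor_app_val]; simp [cauchyMat, cauchyIter]

theorem extMinor_val (μ : ℕ → Measure ℝ) (n : ℕ) (z : ℂ) :
    extMinor μ (fun x : Fin n => (x : ℕ)) z = 1 :=
  extReal_eqOn isOpen_univ continuousOn_const (fun z _ _ => cauchyMinor_val μ n z) z (mem_univ z)

theorem extMinor_app_val (h : NikGen μ A B m) {n k : ℕ} (hk : n ≤ k) :
    ∀ z, OffSeg (A (n + 1)) (B (n + 1)) z →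
    extMinor μ (app (fun x : Fin n => (x : ℕ)) k) z = cauchyIter μ (k - n) n z :=
  extReal_eqOn (isOpen_offSeg _ _) (h.continuousOn_cauchyIter _ _) fun z _ _ => by
    rw [cauchyMinor_app_val, cauchyMat, if_neg (by omega)]

/-- The initial tuple is regular. -/
theorem Regular.val (h : NikGen μ A B m) (i : ℕ) :
    Regular μ A B m (fun x : Fin i => (x : ℕ)) i := by
  have h1 : ∀ n, ContMinor μ A B (fun x : Fin n => (x : ℕ)) := fun n =>
    continuousOn_const.congr fun z _ => extMinor_val μ n z
  have hgt : ∀ k, k ≠ i → (∀ x : Fin i, (x : ℕ) ≠ k) → i < k := by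
    intro k hki hk
    by_contra hlt
    exact hk ⟨k, by omega⟩ rfl
  refine ⟨h1 i, ?_, μ (i + 1), h.fin _, h.null _, fun hi => h.good _ (by omega) hi, ?_, ?_⟩
  · rw [app_val]
    refine ⟨h1 (i + 1), fun z _ => by simp [extMinor_val], fun C hC => ?_⟩
    have h0 : countGE (i + 1) (fun x : Fin (i + 1) => (x : ℕ)) = 0 := by
      rw [countGE]
      exact Finset.sum_eq_zero fun x _ => if_neg (by omega)
    simp only [h0, cauchyMinor_val, pow_zero, one_mul] at hC
    rw [← tendsto_nhds_unique tendsto_const_nhds hC]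
    exact one_ne_zero
  · intro k hk hki hkJ
    have := hgt k hki hkJ
    rw [app_val]
    exact (h.continuousOn_cauchyIter _ _).congr (extMinor_app_val h this)
  · intro k hk hki hkJ
    have hlt := hgt k hki hkJ
    refine ⟨0, fun z hz => ?_⟩
    rw [extMinor_app_val h hlt.le z hz, app_val, extMinor_val, eval_zero, one_mul, zero_add,
      show k - i = (k - (i + 1)) + 1 by omega, cauchyIter]
    apply integral_congr_ae
    filter_upwards [ae_mem_Icc (h.null (i + 1))] with y hy
    rw [extMinor_val, one_mul, extMinor_app_val h hlt _ (h.offSeg_succ hy)]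

end Base

theorem Good.integral_ne_zero {τ : Measure ℝ} {a b : ℝ} (h : Good τ a b) {ψ : ℝ → ℝ}
    (hψ : ContinuousOn ψ (Icc a b)) (hne : ∀ x ∈ Icc a b, ψ x ≠ 0) : ∫ x, ψ x ∂τ ≠ 0 := by
  by_cases hs : ∀ x ∈ Icc a b, 0 < ψ x
  · exact (h.integral_pos hψ (fun x hx => (hs x hx).le) ∅ fun x hx h0 => absurd h0 (hne x hx)).ne'
  · have hs' : ∀ x ∈ Icc a b, ψ x < 0 := by
      push Not at hs
      obtain ⟨x, hx, hx0⟩ := hs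
      intro y hy
      by_contra! hy0
      obtain ⟨w, hw, hw0⟩ := isPreconnected_Icc.intermediate_value hx hy hψ ⟨hx0, hy0⟩
      exact hne w hw hw0
    have := h.integral_pos (f := fun x => -ψ x) hψ.neg (fun x hx => by linarith [hs' x hx]) ∅
      fun x hx h0 => absurd (neg_eq_zero.1 h0) (hne x hx)
    rw [integral_neg] at this
    exact fun h0 => by rw [h0] at this; simp at this

section Swap

variable {μ : ℕ → Measure ℝ} {A B : ℕ → ℝ} {m i : ℕ}

/-- Comparison of the leading behaviour of two minors at infinity. -/
theorem tendsto_quotient (h : NikGen μ A B m) {n : ℕ} {c d : Fin n → ℕ} {g : ℂ → ℂ}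
    (hc : RegMinor μ A B c) {p e : ℕ} (he : countGE n d + e = countGE n c + p)
    (hg : ∀ z, z.im ≠ 0 → cauchyMinor μ d z = cauchyMinor μ c z * g z) :
    ∃ Cc Cg : ℂ, Cc ≠ 0 ∧
      Tendsto (fun t : ℝ => ((t : ℂ) * Complex.I) ^ p * g (t * Complex.I)
        / ((t : ℂ) * Complex.I) ^ e) atTop (nhds Cg) ∧
      Tendsto (fun t : ℝ => ((t : ℂ) * Complex.I) ^ countGE n d
        * cauchyMinor μ d (t * Complex.I)) atTop (nhds (Cc * Cg)) := by
  obtain ⟨Cc, hCc⟩ := h.tendsto_cauchyMinor c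
  obtain ⟨Cd, hCd⟩ := h.tendsto_cauchyMinor d
  have h0 := hc.lead Cc hCc
  refine ⟨Cc, Cd / Cc, h0, ?_, by rwa [mul_div_cancel₀ _ h0]⟩
  refine (hCd.div hCc h0).congr' ?_
  filter_upwards [eventually_gt_atTop 0] with t ht
  have hz : (t : ℂ) * Complex.I ≠ 0 := by simp [ht.ne']
  have him : ((t : ℂ) * Complex.I).im ≠ 0 := by simp [ht.ne']
  have hX : cauchyMinor μ c (t * Complex.I) ≠ 0 := by
    rw [← h.extMinor_eq c him]; exact hc.ne _ (offSeg_of_im_ne him)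
  have hpow : ((t : ℂ) * Complex.I) ^ countGE n d * ((t : ℂ) * Complex.I) ^ e
      = ((t : ℂ) * Complex.I) ^ countGE n c * ((t : ℂ) * Complex.I) ^ p := by
    rw [← pow_add, ← pow_add, he]
  have hg := hg _ him
  simp only [Pi.div_apply]
  generalize (t : ℂ) * Complex.I = z at *
  rw [hg, div_eq_div_iff (mul_ne_zero (pow_ne_zero _ hz) hX) (pow_ne_zero _ hz)]
  linear_combination (cauchyMinor μ c z * g z) * hpow

theorem tendsto_cauchy_zero {κ : Measure ℝ} [IsFiniteMeasure κ] {a b : ℝ}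
    (hκ : κ (Icc a b)ᶜ = 0) {φ : ℝ → ℂ} (hφ : ContinuousOn φ (Icc a b)) :
    Tendsto (fun t : ℝ => ∫ y, φ y * (t * Complex.I - (y : ℂ))⁻¹ ∂κ) atTop (nhds 0) := by
  have := NikGen.tendsto_inv_mul_I.mul (tendsto_mul_cauchy hκ hφ)
  rw [zero_mul] at this
  refine this.congr' ?_
  filter_upwards [eventually_gt_atTop 0] with t ht
  have hz : (t : ℂ) * Complex.I ≠ 0 := by simp [ht.ne']
  rw [inv_mul_cancel_left₀ hz]

/-- Replacing a light label by a heavy one. -/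
theorem Regular.swap (h : NikGen μ A B m) {J : Fin i → ℕ} {a j : ℕ} (hJ : RegMinor μ A B J)
    (ha : Regular μ A B m J a) (haj : Regular μ A B m (app J a) j) (hai : a < i + 1)
    (hij : i + 1 ≤ j) (hjm : j ≤ m) (hjJ : ∀ x, J x ≠ j) :
    Regular μ A B m J j := by
  obtain ⟨hJc, ha, τ, hτ⟩ := ha
  obtain ⟨-, haj, ρ, hρ⟩ := haj
  have hja : j ≠ a := by omega
  have hgood := hτ.good (by omega)
  have := hτ.fin
  have := hρ.fin
  obtain ⟨p, hp⟩ := hτ.rep j hjm hja hjJ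
  have hw := continuousOn_weight h hJc haj.cont
  set ψ : ℝ → ℝ := fun y => (extMinor μ J (y : ℂ) * extMinor μ (app (app J a) j) (y : ℂ)).re
    with hψdef
  have hψc : ContinuousOn ψ (Icc (A (i + 1)) (B (i + 1))) :=
    Complex.continuous_re.comp_continuousOn hw
  have hψe : ∀ y ∈ Icc (A (i + 1)) (B (i + 1)), (ψ y : ℂ)
      = extMinor μ J (y : ℂ) * extMinor μ (app (app J a) j) (y : ℂ) := by
    intro y hy
    obtain ⟨r, hr⟩ : ∃ r : ℝ, extMinor μ J (y : ℂ) = (r : ℂ) :=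
      ⟨_, hJ.extMinor_real h (h.offSeg_pred hy)⟩
    obtain ⟨s, hs⟩ : ∃ s : ℝ, extMinor μ (app (app J a) j) (y : ℂ) = (s : ℂ) :=
      ⟨_, haj.extMinor_real h (h.offSeg_succ hy)⟩
    simp only [hψdef]
    rw [hr, hs, ← Complex.ofReal_mul, Complex.ofReal_re]
  have hψ0 : ∀ y ∈ Icc (A (i + 1)) (B (i + 1)), ψ y ≠ 0 := by
    intro y hy h0
    have := hψe y hy
    rw [h0, Complex.ofReal_zero] at this
    exact mul_ne_zero (hJ.ne _ (h.offSeg_pred hy)) (haj.ne _ (h.offSeg_succ hy)) this.symm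
  have hψcc : ContinuousOn (fun y => (ψ y : ℂ)) (Icc (A (i + 1)) (B (i + 1))) :=
    Complex.continuous_ofReal.comp_continuousOn hψc
  have hp : ∀ z, OffSeg (A (i + 1)) (B (i + 1)) z → extMinor μ (app J j) z
      = extMinor μ (app J a) z * (p.eval z + ∫ y, (ψ y : ℂ) * (z - (y : ℂ))⁻¹ ∂τ) := by
    intro z hz
    rw [hp z hz]
    congr 2
    apply integral_congr_ae
    filter_upwards [ae_mem_Icc hτ.null] with y hy
    rw [hψe y hy]
  obtain ⟨Ca, Cg, hCa, hg, hCj⟩ := tendsto_quotient h (d := app J j) (p := 1) (e := 0) ha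
    (by simp only [countGE_snoc]; rw [if_pos hij, if_neg (by omega)])
    (g := fun z => p.eval z + ∫ y, (ψ y : ℂ) * (z - (y : ℂ))⁻¹ ∂τ) (fun z hz => by
      rw [← h.extMinor_eq _ hz, ← h.extMinor_eq _ hz, hp z (offSeg_of_im_ne hz)])
  have hp0 : p = 0 := by
    apply eq_zero_of_tendsto_zero
    have h1 := NikGen.tendsto_inv_mul_I.mul hg
    have h2 := h1.sub (tendsto_cauchy_zero hτ.null hψcc)
    rw [zero_mul, sub_zero] at h2
    refine h2.congr' ?_
    filter_upwards [eventually_gt_atTop 0] with t ht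
    have hz : (t : ℂ) * Complex.I ≠ 0 := by simp [ht.ne']
    rw [pow_zero, div_one, pow_one, inv_mul_cancel_left₀ hz]
    ring
  simp only [hp0, eval_zero, zero_add] at hp hg
  have hCg : Cg = ((∫ y, ψ y ∂τ : ℝ) : ℂ) := by
    rw [← integral_complex_ofReal]
    exact tendsto_nhds_unique hg (by simpa using tendsto_mul_cauchy hτ.null hψcc)
  have hCg0 : Cg ≠ 0 := by
    rw [hCg]
    exact_mod_cast hgood.integral_ne_zero hψc hψ0
  obtain ⟨κ, hκ, α, β, hinv⟩ := hgood.inverse_density hψc hψ0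
  have hκfin := hκ.fin
  have hY : RegMinor μ A B (app J j) := by
    refine ⟨hτ.contMinor h hJc ha.cont hjm hja hjJ, fun z hz => ?_, fun C hC => ?_⟩
    · rw [hp z hz]
      exact mul_ne_zero (ha.ne z hz) (hinv z hz).1
    · rw [tendsto_nhds_unique hC hCj]
      exact mul_ne_zero hCa hCg0
  have hkne : ∀ k, k ≠ a → (∀ x, J x ≠ k) → ∀ x, (app J a) x ≠ k := by
    intro k hka hk x
    refine Fin.lastCases ?_ (fun x => ?_) x
    · simpa using hka.symm
    · simpa using hk x
  have hcont : ∀ k ≤ m, k ≠ j → (∀ x, J x ≠ k) → ContMinor μ A B (app (app J j) k) := by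
    intro k hk hkj hkJ
    by_cases hka : k = a
    · subst hka
      exact (extMinor_swap h haj.cont).1
    · exact (Exchange.core h hJc ha haj hτ hρ hjm hja hjJ hk hka hkj hkJ).1
  refine ⟨hJc, hY, κ, hκ.fin, hκ.null, fun _ => hκ, hcont, ?_⟩
  intro k hk hkj hkJ
  by_cases hka : k = a
  · subst hka
    refine ⟨C (α : ℂ) * X + C (β : ℂ), fun z hz => ?_⟩
    have h1 : ∫ y : ℝ, extMinor μ J y * extMinor μ (app (app J j) k) y * (z - y)⁻¹ ∂κ
        = -∫ y, (ψ y : ℂ) * (z - (y : ℂ))⁻¹ ∂κ := by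
      rw [← integral_neg]
      apply integral_congr_ae
      filter_upwards [ae_mem_Icc hκ.null] with y hy
      rw [(extMinor_swap h haj.cont).2 _ (h.offSeg_succ hy), hψe y hy]
      ring
    obtain ⟨hne, hi⟩ := hinv z hz
    rw [h1, hp z hz]
    simp only [eval_add, eval_mul, eval_C, eval_X]
    rw [← sub_eq_add_neg, ← hi, mul_assoc, mul_inv_cancel₀ hne, mul_one]
  · obtain ⟨-, P, hP⟩ := Exchange.core h hJc ha haj hτ hρ hjm hja hjJ hk hka hkj hkJ
    obtain ⟨q, hq⟩ := hρ.rep k hk hkj (hkne k hka hkJ)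
    have hkJa := hkne k hka hkJ
    have hφ := continuousOn_weight h hY.cont (c := app (app (app J a) j) k)
      (hρ.cont k hk hkj hkJa)
    obtain ⟨R, hR⟩ := poly_add_cauchy_mul hκ.null hρ.null (h.disj (i + 1))
      (ψ := fun y => -(ψ y : ℂ)) hψcc.neg hφ (C (α : ℂ) * X + C (β : ℂ)) P
    refine ⟨q - R, eqOn_of_eq_im_ne (isOpen_offSeg _ _) (hτ.contMinor h hJc ha.cont hk hka hkJ)
      (hY.cont.mul (continuousOn_poly_add_cauchy hκ.null
        (continuousOn_weight h hJc (hcont k hk hkj hkJ)) _)) ?_⟩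
    intro z hz hzim
    have hz2 : OffSeg (A (i + 2)) (B (i + 2)) z := offSeg_of_im_ne hzim
    obtain ⟨hne, hi⟩ := hinv z hz
    have hR := hR z hz hz2
    have hpoly : ∀ w, OffSeg (A (i + 1)) (B (i + 1)) w →
        (C (α : ℂ) * X + C (β : ℂ)).eval w + ∫ y : ℝ, -(ψ y : ℂ) * (w - (y : ℂ))⁻¹ ∂κ
          = (∫ y, (ψ y : ℂ) * (w - (y : ℂ))⁻¹ ∂τ)⁻¹ := by
      intro w hw
      rw [(hinv w hw).2]
      simp only [eval_add, eval_mul, eval_C, eval_X, neg_mul, integral_neg]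
      ring
    have e1 : ∫ y : ℝ, (P.eval (y : ℂ) + ∫ ξ : ℝ, (extMinor μ (app J j) (ξ : ℂ) *
          extMinor μ (app (app (app J a) j) k) (ξ : ℂ)) * ((y : ℂ) - (ξ : ℂ))⁻¹ ∂ρ)
          * (-(ψ y : ℂ)) * (z - (y : ℂ))⁻¹ ∂κ
        = -∫ y : ℝ, (extMinor μ J y * extMinor μ (app (app J j) k) y) * (z - y)⁻¹ ∂κ := by
      rw [← integral_neg]
      apply integral_congr_ae
      filter_upwards [ae_mem_Icc hκ.null] with y hy
      rw [hP _ (h.offSeg_succ hy), hψe y hy]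
      ring
    have e2 : ∫ ξ : ℝ, (extMinor μ (app J j) (ξ : ℂ) *
          extMinor μ (app (app (app J a) j) k) (ξ : ℂ)) *
            ((C (α : ℂ) * X + C (β : ℂ)).eval (ξ : ℂ) + ∫ y : ℝ, -(ψ y : ℂ)
              * ((ξ : ℂ) - (y : ℂ))⁻¹ ∂κ) * (z - (ξ : ℂ))⁻¹ ∂ρ
        = ∫ ξ : ℝ, (extMinor μ (app J a) ξ * extMinor μ (app (app (app J a) j) k) ξ)
          * (z - ξ)⁻¹ ∂ρ := by
      apply integral_congr_ae
      filter_upwards [ae_mem_Icc hρ.null] with ξ hξ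
      have hξ1 := h.offSeg_pred (j := i + 1) hξ
      rw [hpoly _ hξ1, hp _ hξ1]
      have := (hinv _ hξ1).1
      generalize ∫ y, (ψ y : ℂ) * ((ξ : ℂ) - (y : ℂ))⁻¹ ∂τ = w at this
      field_simp
    rw [e1, e2, hpoly z hz] at hR
    have h1 := extMinor_plucker h J a j k hzim
    have hD := haj.ne z hz2
    have hPz := hP z hz2
    have hqz := hq z hz2
    have hpz := hp z hz
    rw [eval_sub]
    apply mul_left_cancel₀ hD
    rw [h1, hPz, hqz]
    have hX : extMinor μ (app J a) z
        = extMinor μ (app J j) z * (∫ y, (ψ y : ℂ) * (z - (y : ℂ))⁻¹ ∂τ)⁻¹ := by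
      rw [hpz, mul_inv_cancel_right₀ hne]
    rw [hX]
    linear_combination (-extMinor μ (app (app J a) j) z * extMinor μ (app J j) z) * hR

end Swap

theorem sum_range_le_sum_of_injective {n : ℕ} (c : Fin n → ℕ) (hc : Function.Injective c) :
    ∑ x ∈ Finset.range n, x ≤ ∑ x, c x := by
  have hcard : (Finset.univ.image c).card = n := by
    rw [Finset.card_image_of_injective _ hc, Finset.card_univ, Fintype.card_fin]
  have h1 : ∑ x, c x = ∑ x, (Finset.univ.image c).orderEmbOfFin hcard x := by
    have h2 : ∑ x ∈ Finset.univ.image c, x = ∑ x, c x :=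
      Finset.sum_image fun x _ y _ h => hc h
    rw [← h2]
    conv_lhs => rw [← Finset.image_orderEmbOfFin_univ (Finset.univ.image c) hcard]
    exact Finset.sum_image fun x _ y _ h => ((Finset.univ.image c).orderEmbOfFin hcard).injective h
  rw [h1, ← Fin.sum_univ_eq_sum_range]
  refine Finset.sum_le_sum fun x _ => ?_
  obtain ⟨f, hf⟩ : ∃ f : Fin n → ℕ, f = fun x => (Finset.univ.image c).orderEmbOfFin hcard x :=
    ⟨_, rfl⟩
  have hmono : StrictMono f := hf ▸ OrderEmbedding.strictMono _
  have : ∀ k (hk : k < n), k ≤ f ⟨k, hk⟩ := by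
    intro k
    induction k with
    | zero => intro _; exact Nat.zero_le _
    | succ k ih =>
      intro hk
      have h3 := ih (by omega)
      have h4 : f ⟨k, by omega⟩ < f ⟨k + 1, hk⟩ := hmono (Fin.mk_lt_mk.2 (Nat.lt_succ_self k))
      omega
  have := this x x.2
  rwa [hf] at this

theorem exists_perm_of_range_eq {n : ℕ} {f g : Fin n → ℕ} (hf : Function.Injective f)
    (hg : Function.Injective g) (h : Set.range f = Set.range g) :
    ∃ π : Equiv.Perm (Fin n), f = g ∘ π := by
  refine ⟨(Equiv.ofInjective f hf).trans ((Equiv.setCongr h).trans (Equiv.ofInjective g hg).symm),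
    funext fun x => ?_⟩
  have := Equiv.apply_ofInjective_symm hg (Equiv.setCongr h (Equiv.ofInjective f hf x))
  exact this.symm

theorem app_injective {n : ℕ} {c : Fin n → ℕ} {k : ℕ} :
    Function.Injective (app c k) ↔ Function.Injective c ∧ ∀ x, c x ≠ k := by
  rw [Fin.snoc_injective_iff]
  simp

theorem sum_app {n : ℕ} (c : Fin n → ℕ) (k : ℕ) : ∑ x, app c k x = ∑ x, c x + k := by
  simp [Fin.sum_univ_castSucc]

section Induction

variable {μ : ℕ → Measure ℝ} {A B : ℕ → ℝ} {m : ℕ}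

theorem regMinor_zero (J : Fin 0 → ℕ) : RegMinor μ A B J := by
  obtain rfl : J = fun x : Fin 0 => (x : ℕ) := Subsingleton.elim _ _
  refine ⟨continuousOn_const.congr fun z _ => extMinor_val μ 0 z,
    fun z _ => by simp [extMinor_val], fun C hC => ?_⟩
  simp only [countGE, Finset.univ_eq_empty, Finset.sum_empty, cauchyMinor_val, pow_zero,
    one_mul] at hC
  rw [← tendsto_nhds_unique tendsto_const_nhds hC]
  exact one_ne_zero

theorem exists_not_mem_le {i : ℕ} (J : Fin i → ℕ) : ∃ a ≤ i, ∀ x, J x ≠ a := by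
  by_contra! hcon
  have h1 : Finset.range (i + 1) ⊆ Finset.univ.image J := by
    intro a ha
    obtain ⟨x, hx⟩ := hcon a (by simpa [Nat.lt_succ_iff] using ha)
    exact Finset.mem_image.2 ⟨x, Finset.mem_univ _, hx⟩
  have h2 := (Finset.card_le_card h1).trans Finset.card_image_le
  simp at h2

theorem Regular.of_forall_lt (h : NikGen μ A B m) {i : ℕ} {J : Fin i → ℕ} {a : ℕ}
    (hinj : Function.Injective J) (hm : a ≤ m) (hmax : ∀ x, J x < a)
    (ih : ∀ (n : ℕ) (J' : Fin n → ℕ) (a' : ℕ), Function.Injective (app J' a') →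
      (∀ x, app J' a' x ≤ m) → ∑ x, app J' a' x + ∑ x ∈ Finset.range (i + 1), x
        < ∑ x, app J a x + ∑ x ∈ Finset.range (n + 1), x → Regular μ A B m J' a') :
    Regular μ A B m J a := by
  have hJm : ∀ x, J x ≤ m := fun x => (hmax x).le.trans hm
  have hai : i ≤ a := by
    have h1 : Finset.univ.image J ⊆ Finset.range a := by
      intro y hy
      obtain ⟨x, -, rfl⟩ := Finset.mem_image.1 hy
      exact Finset.mem_range.2 (hmax x)
    have h2 := Finset.card_le_card h1
    rwa [Finset.card_image_of_injective _ hinj, Finset.card_univ, Fintype.card_fin,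
      Finset.card_range] at h2
  rcases hai.eq_or_lt with rfl | hai
  · obtain ⟨π, hπ⟩ := exists_perm_of_range_eq (f := J) (g := fun x : Fin i => (x : ℕ)) hinj
      Fin.val_injective (by
        have h1 : Finset.univ.image J ⊆ Finset.range i := by
          intro y hy
          obtain ⟨x, -, rfl⟩ := Finset.mem_image.1 hy
          exact Finset.mem_range.2 (hmax x)
        have h2 := Finset.eq_of_subset_of_card_le h1 (by
          rw [Finset.card_image_of_injective _ hinj, Finset.card_univ, Fintype.card_fin,
            Finset.card_range])
        ext y
        have h3 := Finset.ext_iff.1 h2 y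
        simp only [Finset.mem_image, Finset.mem_univ, true_and, Finset.mem_range] at h3
        rw [Set.mem_range, h3, Set.mem_range]
        exact ⟨fun hy => ⟨⟨y, hy⟩, rfl⟩, fun ⟨x, hx⟩ => hx ▸ x.2⟩)
    rw [hπ]
    exact (Regular.val h i).perm h π
  · obtain ⟨b, hbi, hbJ⟩ := exists_not_mem_le J
    have hba : b ≠ a := by omega
    have hJreg : RegMinor μ A B J := by
      rcases i with _ | i
      · exact regMinor_zero J
      · have he : app (fun x : Fin i => J x.castSucc) (J (Fin.last i)) = J := Fin.snoc_init_self J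
        have := ih i (fun x : Fin i => J x.castSucc) (J (Fin.last i)) (by rwa [he])
          (fun x => by rw [he]; exact hJm x) (by
            rw [he, sum_app, Finset.sum_range_succ _ (i + 1)]
            omega)
        rw [← he]
        exact this.reg
    have hb : Regular μ A B m J b := ih i J b (app_injective.2 ⟨hinj, hbJ⟩)
      (fun x => by
        refine Fin.lastCases ?_ (fun x => ?_) x
        · simpa using (show b ≤ m by omega)
        · simpa using hJm x) (by rw [sum_app, sum_app]; omega)
    have hab : Regular μ A B m (app J b) a := ih (i + 1) (app J b) a
      (app_injective.2 ⟨app_injective.2 ⟨hinj, hbJ⟩, fun x => by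
        refine Fin.lastCases ?_ (fun x => ?_) x
        · simpa using hba
        · simpa using (hmax x).ne⟩)
      (fun x => by
        refine Fin.lastCases ?_ (fun x => ?_) x
        · simpa using hm
        · rw [app, Fin.snoc_castSucc]
          refine Fin.lastCases ?_ (fun x => ?_) x
          · simpa using (show b ≤ m by omega)
          · simpa using hJm x)
      (by rw [sum_app, sum_app, sum_app, Finset.sum_range_succ _ (i + 1)]; omega)
    exact Regular.swap h hJreg hb hab (by omega) (by omega) hm fun x => (hmax x).ne

theorem regular_aux (h : NikGen μ A B m) (L : ℕ) : ∀ (i : ℕ) (J : Fin i → ℕ) (a : ℕ),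
    Function.Injective (app J a) → (∀ x, app J a x ≤ m) →
    ∑ x, app J a x < L + ∑ x ∈ Finset.range (i + 1), x → Regular μ A B m J a := by
  induction L with
  | zero =>
    intro i J a hinj _ hlt
    have := sum_range_le_sum_of_injective _ hinj
    omega
  | succ L ihL =>
    have hmaxcase : ∀ (i : ℕ) (J : Fin i → ℕ) (a : ℕ), Function.Injective (app J a) →
        (∀ x, app J a x ≤ m) → ∑ x, app J a x < L + 1 + ∑ x ∈ Finset.range (i + 1), x →
        (∀ x, J x < a) → Regular μ A B m J a := by
      intro i J a hinj hm hlt hmax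
      refine Regular.of_forall_lt h (app_injective.1 hinj).1 (by simpa using hm (Fin.last i)) hmax
        fun n J' a' hinj' hm' hlt' => ihL n J' a' hinj' hm' (by omega)
    intro i
    induction i with
    | zero => exact fun J a hinj hm hlt => hmaxcase 0 J a hinj hm hlt fun x => x.elim0
    | succ i ihi =>
      intro J a hinj hm hlt
      by_cases hmax : ∀ x, J x < a
      · exact hmaxcase _ J a hinj hm hlt hmax
      · obtain ⟨x, hx⟩ := Finite.exists_max J
        obtain ⟨hJ, hJa⟩ := app_injective.1 hinj
        have hax : a < J x := by
          push Not at hmax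
          obtain ⟨y, hy⟩ := hmax
          exact lt_of_le_of_ne (hy.trans (hx y)) (hJa x).symm
        have hJm : ∀ y, J y ≤ m := fun y => by simpa using hm y.castSucc
        have ham : a ≤ m := by simpa using hm (Fin.last _)
        set J0 : Fin i → ℕ := fun y => J (x.succAbove y) with hJ0
        have hne : ∀ y, J0 y ≠ J x := fun y e => Fin.succAbove_ne x y (hJ e)
        have hJ0inj : Function.Injective J0 := hJ.comp Fin.succAbove_right_injective
        have hsum : ∑ y, J y = ∑ y, J0 y + J x := by
          rw [Fin.sum_univ_succAbove J x, add_comm]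
        have h0 : Function.Injective (app J0 a) := app_injective.2 ⟨hJ0inj, fun y => hJa _⟩
        have h0m : ∀ y, app J0 a y ≤ m := fun y => by
          refine Fin.lastCases ?_ (fun y => ?_) y
          · simpa using ham
          · simpa using hJm _
        have h0b : ∀ y, app J0 a y < J x := fun y => by
          refine Fin.lastCases ?_ (fun y => ?_) y
          · simpa using hax
          · simpa using lt_of_le_of_ne (hx _) (hne y)
        have hreg1 : Regular μ A B m (app J0 a) (J x) := by
          refine hmaxcase _ _ _ (app_injective.2 ⟨h0, fun y => (h0b y).ne⟩) ?_ ?_ h0b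
          · intro y
            refine Fin.lastCases ?_ (fun y => ?_) y
            · simpa using hJm x
            · simpa using h0m y
          · rw [sum_app, sum_app]
            rw [sum_app] at hlt
            omega
        have hix : i + 1 ≤ J x := by
          have h1 : Finset.univ.image (app J0 a) ⊆ Finset.range (J x) := by
            intro y hy
            obtain ⟨w, -, rfl⟩ := Finset.mem_image.1 hy
            exact Finset.mem_range.2 (h0b w)
          have h2 := Finset.card_le_card h1
          rwa [Finset.card_image_of_injective _ h0, Finset.card_univ, Fintype.card_fin,
            Finset.card_range] at h2
        have hreg0 : Regular μ A B m J0 a := by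
          refine ihi J0 a h0 h0m ?_
          rw [sum_app] at hlt ⊢
          rw [Finset.sum_range_succ _ (i + 1)] at hlt
          omega
        have hfin := Regular.exchange h hreg0 hreg1 (hJm x) hax.ne' hne
        obtain ⟨π, hπ⟩ := exists_perm_of_range_eq (f := J) (g := app J0 (J x)) hJ
          (app_injective.2 ⟨hJ0inj, hne⟩) (by
            ext y
            constructor
            · rintro ⟨w, rfl⟩
              rcases eq_or_ne w x with rfl | hw
              · exact ⟨Fin.last _, by simp⟩
              · obtain ⟨v, rfl⟩ := Fin.exists_succAbove_eq hw
                exact ⟨v.castSucc, by simp [hJ0]⟩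
            · rintro ⟨w, rfl⟩
              refine Fin.lastCases ?_ (fun w => ?_) w
              · exact ⟨x, by simp⟩
              · exact ⟨x.succAbove w, by simp [hJ0]⟩)
        rw [hπ]
        exact hfin.perm h π

/-- Every tuple of distinct labels is regular. -/
theorem regular_of_injective (h : NikGen μ A B m) {i : ℕ} {J : Fin i → ℕ} {a : ℕ}
    (hinj : Function.Injective (app J a)) (hm : ∀ x, app J a x ≤ m) : Regular μ A B m J a :=
  regular_aux h (∑ x, app J a x + 1) i J a hinj hm (by omega)

theorem regMinor_of_injective (h : NikGen μ A B m) {i : ℕ} {J : Fin i → ℕ}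
    (hinj : Function.Injective J) (hm : ∀ x, J x ≤ m) : RegMinor μ A B J := by
  rcases i with _ | i
  · exact regMinor_zero J
  · have he : app (fun x : Fin i => J x.castSucc) (J (Fin.last i)) = J := Fin.snoc_init_self J
    rw [← he]
    exact (regular_of_injective h (by rwa [he]) (by rwa [he])).reg

end Induction

theorem exists_sign_of_ne_zero {s : Set ℝ} (hs : s.OrdConnected) {g : ℝ → ℝ}
    (hg : ContinuousOn g s) (h0 : ∀ x ∈ s, g x ≠ 0) :
    ∃ ε : ℝ, (ε = 1 ∨ ε = -1) ∧ ∀ x ∈ s, 0 < ε * g x := by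
  by_cases hpos : ∀ x ∈ s, 0 < g x
  · exact ⟨1, Or.inl rfl, fun x hx => by simpa using hpos x hx⟩
  · push Not at hpos
    obtain ⟨x, hx, hx0⟩ := hpos
    refine ⟨-1, Or.inr rfl, fun y hy => ?_⟩
    by_contra! hcon
    obtain ⟨w, hw, hw0⟩ := hs.isPreconnected.intermediate_value hx hy hg ⟨hx0, by linarith⟩
    exact h0 w hw hw0

/-- A continuous function with finitely many zeros has the sign of a polynomial whose roots are
among these zeros. -/
theorem exists_sign_changes {g : ℝ → ℝ} (Z : Finset ℝ) : ∀ {s : Set ℝ}, s.OrdConnected →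
    ContinuousOn g s → (∀ x, x ∈ Z ↔ x ∈ s ∧ g x = 0) →
    ∃ Z' ⊆ Z, ∃ ε : ℝ, (ε = 1 ∨ ε = -1) ∧ ∀ x ∈ s, 0 ≤ ε * g x * ∏ z ∈ Z', (x - z) := by
  induction Z using Finset.induction_on_max with
  | empty =>
    intro s hs hg hZ
    obtain ⟨ε, hε, hpos⟩ := exists_sign_of_ne_zero hs hg fun x hx h0 => by
      simpa using (hZ x).2 ⟨hx, h0⟩
    exact ⟨∅, Finset.empty_subset _, ε, hε, fun x hx => by simpa using (hpos x hx).le⟩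
  | insert a Z hlt ih =>
    intro s hs hg hZ
    have ha0 : g a = 0 := ((hZ a).1 (Finset.mem_insert_self a Z)).2
    obtain ⟨Z', hZ', ε, hε, hpos⟩ := ih (s := s ∩ Iio a) (hs.inter ordConnected_Iio)
      (hg.mono inter_subset_left) (fun x => by
        constructor
        · intro hx
          have := (hZ x).1 (Finset.mem_insert_of_mem hx)
          exact ⟨⟨this.1, hlt x hx⟩, this.2⟩
        · rintro ⟨⟨hx, hxa⟩, hx0⟩
          exact Finset.mem_of_mem_insert_of_ne ((hZ x).2 ⟨hx, hx0⟩) (ne_of_lt hxa))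
    obtain ⟨δ, hδ, hδpos⟩ := exists_sign_of_ne_zero (s := s ∩ Ioi a) (hs.inter ordConnected_Ioi)
      (hg.mono inter_subset_left) (fun x hx hx0 => by
        rcases Finset.mem_insert.1 ((hZ x).2 ⟨hx.1, hx0⟩) with rfl | hxZ
        · exact lt_irrefl x (mem_Ioi.1 hx.2)
        · exact lt_asymm (hlt x hxZ) hx.2)
    have haZ' : a ∉ Z' := fun h => lt_irrefl _ (hlt a (hZ' h))
    have hprod : ∀ x, a ≤ x → 0 ≤ ∏ z ∈ Z', (x - z) := fun x hx =>
      Finset.prod_nonneg fun z hz => by linarith [hlt z (hZ' hz)]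
    by_cases hεδ : ε = δ
    · refine ⟨Z', hZ'.trans (Finset.subset_insert a Z), ε, hε, fun x hx => ?_⟩
      rcases lt_trichotomy x a with hxa | rfl | hxa
      · exact hpos x ⟨hx, hxa⟩
      · simp [ha0]
      · rw [hεδ]
        exact mul_nonneg (hδpos x ⟨hx, hxa⟩).le (hprod x hxa.le)
    · have hδε : δ = -ε := by
        rcases hε with rfl | rfl <;> rcases hδ with rfl | rfl <;> simp_all
      refine ⟨insert a Z', Finset.insert_subset_insert a hZ', -ε, by
        rcases hε with rfl | rfl <;> simp, fun x hx => ?_⟩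
      rw [Finset.prod_insert haZ']
      rcases lt_trichotomy x a with hxa | rfl | hxa
      · have h1 := hpos x ⟨hx, hxa⟩
        have : -ε * g x * ((x - a) * ∏ z ∈ Z', (x - z))
            = (a - x) * (ε * g x * ∏ z ∈ Z', (x - z)) := by ring
        rw [this]
        exact mul_nonneg (by linarith) h1
      · simp
      · rw [← hδε]
        exact mul_nonneg (hδpos x ⟨hx, hxa⟩).le (mul_nonneg (by linarith) (hprod x hxa.le))

theorem prod_sub_eq_eval (Z : Finset ℝ) (x : ℝ) :
    ∏ z ∈ Z, (x - z) = (∏ z ∈ Z, (X - C z) : ℝ[X]).eval x := by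
  simp [eval_prod]

/-- A function orthogonal to the polynomials of degree `< M` has at least `M` zeros. -/
theorem Good.exists_zeros {κ : Measure ℝ} {a b : ℝ} (h : Good κ a b) {W L : ℝ → ℝ}
    (hW : ContinuousOn W (Icc a b)) (hW0 : ∀ x ∈ Icc a b, W x ≠ 0)
    (hL : ContinuousOn L (Icc a b)) {M : ℕ}
    (horth : ∀ P : ℝ[X], P.natDegree < M → ∫ y, P.eval y * (W y * L y) ∂κ = 0) :
    ∃ Z : Finset ℝ, M ≤ Z.card ∧ ∀ x ∈ Z, x ∈ Icc a b ∧ L x = 0 := by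
  by_cases hinf : {x | x ∈ Icc a b ∧ L x = 0}.Infinite
  · obtain ⟨Z, hZ, hcard⟩ := hinf.exists_subset_card_eq M
    exact ⟨Z, hcard.ge, fun x hx => hZ hx⟩
  · rw [Set.not_infinite] at hinf
    refine ⟨hinf.toFinset, ?_, fun x hx => hinf.mem_toFinset.1 hx⟩
    by_contra! hlt
    obtain ⟨Z', hZ', ε, hε, hpos⟩ := exists_sign_changes hinf.toFinset (s := Icc a b)
      ordConnected_Icc hL fun x => hinf.mem_toFinset
    obtain ⟨δ, hδ, hδpos⟩ := exists_sign_of_ne_zero ordConnected_Icc hW hW0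
    have hε0 : ε ≠ 0 := by rcases hε with rfl | rfl <;> norm_num
    have h1 := h.integral_pos (f := fun x => (δ * W x) * (ε * L x * ∏ z ∈ Z', (x - z)))
      ((continuousOn_const.mul hW).mul ((continuousOn_const.mul hL).mul (by fun_prop)))
      (fun x hx => mul_nonneg (hδpos x hx).le (hpos x hx)) hinf.toFinset (fun x hx h0 => by
        rcases mul_eq_zero.1 h0 with h0 | h0
        · exact absurd h0 (hδpos x hx).ne'
        · rcases mul_eq_zero.1 h0 with h0 | h0
          · exact hinf.mem_toFinset.2 ⟨hx, (mul_eq_zero.1 h0).resolve_left hε0⟩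
          · obtain ⟨z, hz, hz0⟩ := Finset.prod_eq_zero_iff.1 h0
            rw [sub_eq_zero.1 hz0]
            exact hZ' hz)
    have h2 := horth (∏ z ∈ Z', (X - C z)) (by
      rw [natDegree_finsetProd_X_sub_C_eq_card]
      exact (Finset.card_le_card hZ').trans_lt hlt)
    have h3 : ∫ x, (δ * W x) * (ε * L x * ∏ z ∈ Z', (x - z)) ∂κ
        = (δ * ε) * ∫ y, (∏ z ∈ Z', (X - C z) : ℝ[X]).eval y * (W y * L y) ∂κ := by
      rw [← integral_const_mul]
      congr 1
      ext x
      rw [prod_sub_eq_eval]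
      ring
    rw [h3, h2, mul_zero] at h1
    exact lt_irrefl _ h1

section ZeroBound

variable {μ : ℕ → Measure ℝ} {A B : ℕ → ℝ} {m : ℕ}

/-- Vanishing of a polynomial plus a Cauchy transform at the points of `Z` gives orthogonality. -/
theorem integral_div_nodal_eq_zero {κ : Measure ℝ} [IsFiniteMeasure κ] {a b : ℝ}
    (hκ : κ (Icc a b)ᶜ = 0) {φ : ℝ → ℂ} (hφ : ContinuousOn φ (Icc a b)) (q : ℂ[X]) (Z : Finset ℝ)
    (hZ : ∀ x ∈ Z, x ∉ Icc a b ∧ q.eval (x : ℂ) + ∫ y, φ y * ((x : ℂ) - (y : ℂ))⁻¹ ∂κ = 0)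
    (r : ℂ[X]) (hr : r.natDegree + q.natDegree + 1 < Z.card) :
    ∫ y, r.eval (y : ℂ) * φ y * (∏ x ∈ Z, ((y : ℂ) - (x : ℂ)))⁻¹ ∂κ = 0 := by
  have hinj : Set.InjOn (fun x : ℝ => (x : ℂ)) Z := Complex.ofReal_injective.injOn
  have hdeg : ∀ s : ℂ[X], s.natDegree < Z.card → s.degree < Z.card := fun s hs =>
    degree_le_natDegree.trans_lt (by exact_mod_cast hs)
  have h1 : ∀ y ∈ Icc a b, r.eval (y : ℂ) * φ y * (∏ x ∈ Z, ((y : ℂ) - (x : ℂ)))⁻¹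
      = ∑ x ∈ Z, Lagrange.nodalWeight Z (fun x : ℝ => (x : ℂ)) x * r.eval (x : ℂ)
          * -(φ y * ((x : ℂ) - (y : ℂ))⁻¹) := by
    intro y hy
    have hne : ∀ x ∈ Z, (y : ℂ) ≠ (x : ℂ) := fun x hx e =>
      (hZ x hx).1 (by rw [← Complex.ofReal_injective e]; exact hy)
    have h2 := Lagrange.eval_interpolate_not_at_node (s := Z) (v := fun x : ℝ => (x : ℂ))
      (x := (y : ℂ)) (fun x : ℝ => r.eval (x : ℂ)) hne
    rw [← Lagrange.eq_interpolate hinj (hdeg r (by omega)), Lagrange.eval_nodal] at h2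
    have h3 : ∏ x ∈ Z, ((y : ℂ) - (x : ℂ)) ≠ 0 :=
      Finset.prod_ne_zero_iff.2 fun x hx => sub_ne_zero.2 (hne x hx)
    rw [h2, mul_right_comm, mul_right_comm _ _ (_⁻¹), mul_inv_cancel₀ h3, one_mul, Finset.sum_mul]
    refine Finset.sum_congr rfl fun x hx => ?_
    rw [← neg_sub (y : ℂ) (x : ℂ), inv_neg]
    ring
  rw [integral_congr_ae ((ae_mem_Icc hκ).mono h1), integral_finsetSum]
  · have h4 := Lagrange.coeff_eq_sum hinj (P := r * q)
      (hdeg _ (natDegree_mul_le.trans_lt (by omega)))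
    rw [coeff_eq_zero_of_natDegree_lt (natDegree_mul_le.trans_lt (by omega))] at h4
    rw [h4]
    refine Finset.sum_congr rfl fun x hx => ?_
    rw [integral_const_mul, integral_neg]
    have h5 := (hZ x hx).2
    rw [eval_mul, Lagrange.nodalWeight, Finset.prod_inv_distrib, div_eq_mul_inv]
    linear_combination (-(∏ j ∈ Z.erase x, ((x : ℂ) - (j : ℂ)))⁻¹ * r.eval (x : ℂ)) * h5
  · intro x hx
    exact ((integrable_cauchy hκ hφ (offSeg_ofReal.2 (hZ x hx).1)).neg).const_mul _

theorem tendsto_eval_div_pow {p : ℂ[X]} {d : ℕ} (hp : p.natDegree ≤ d) :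
    ∃ c : ℂ, Tendsto (fun t : ℝ => p.eval (t * Complex.I) / (t * Complex.I) ^ d) atTop
      (nhds c) := by
  refine ⟨∑ k ∈ Finset.range (d + 1), p.coeff k * 0 ^ (d - k), ?_⟩
  have h1 : Tendsto (fun t : ℝ => ∑ k ∈ Finset.range (d + 1), p.coeff k *
      ((t : ℂ) * Complex.I)⁻¹ ^ (d - k)) atTop
      (nhds (∑ k ∈ Finset.range (d + 1), p.coeff k * 0 ^ (d - k))) :=
    tendsto_finsetSum _ fun k _ => (NikGen.tendsto_inv_mul_I.pow _).const_mul _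
  refine h1.congr' ?_
  filter_upwards [eventually_gt_atTop 0] with t ht
  have hz : (t : ℂ) * Complex.I ≠ 0 := by simp [ht.ne']
  rw [eval_eq_sum_range' (Nat.lt_succ_of_le hp), Finset.sum_div]
  refine Finset.sum_congr rfl fun k hk => ?_
  have hk : k ≤ d := by simpa [Nat.lt_succ_iff] using hk
  rw [mul_div_assoc, inv_pow, pow_sub₀ _ hz hk]
  field_simp

theorem tendsto_quotient_div_pow (h : NikGen μ A B m) {n : ℕ} {c d : Fin n → ℕ} {g : ℂ → ℂ}
    (hc : RegMinor μ A B c) {e : ℕ} (he : countGE n c ≤ countGE n d + e)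
    (hg : ∀ z, z.im ≠ 0 → cauchyMinor μ d z = cauchyMinor μ c z * g z) :
    ∃ C : ℂ, Tendsto (fun t : ℝ => g (t * Complex.I) / ((t : ℂ) * Complex.I) ^ e) atTop
      (nhds C) := by
  obtain ⟨-, Cg, -, hC, -⟩ := tendsto_quotient h (p := countGE n d + e - countGE n c) (e := e) hc
    (by omega) hg
  refine ⟨_, ((NikGen.tendsto_inv_mul_I.pow (countGE n d + e - countGE n c)).mul hC).congr' ?_⟩
  filter_upwards [eventually_gt_atTop 0] with t ht
  have hz : (t : ℂ) * Complex.I ≠ 0 := by simp [ht.ne']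
  rw [inv_pow, mul_div_assoc, inv_mul_cancel_left₀ (pow_ne_zero _ hz)]

theorem exists_poly_sum {κ : Measure ℝ} [IsFiniteMeasure κ] {a b : ℝ}
    (hκ : κ (Icc a b)ᶜ = 0) (K : Finset ℕ) (p ℓ : ℕ → ℂ[X]) (φ : ℕ → ℝ → ℂ)
    (hφ : ∀ k ∈ K, ContinuousOn (φ k) (Icc a b)) :
    ∃ q : ℂ[X], ∀ z, OffSeg a b z →
      ∑ k ∈ K, (p k).eval z * ((ℓ k).eval z + ∫ y, φ k y * (z - (y : ℂ))⁻¹ ∂κ)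
        = q.eval z + ∫ y, (∑ k ∈ K, (p k).eval (y : ℂ) * φ k y) * (z - (y : ℂ))⁻¹ ∂κ := by
  have h1 : ∀ k, ∃ q : ℂ[X], k ∈ K → ∀ z, OffSeg a b z →
      (p k).eval z * ∫ y, φ k y * (z - (y : ℂ))⁻¹ ∂κ
        = q.eval z + ∫ y, (p k).eval (y : ℂ) * φ k y * (z - (y : ℂ))⁻¹ ∂κ := by
    intro k
    by_cases hk : k ∈ K
    · obtain ⟨q, hq⟩ := exists_poly_divided_difference hκ (hφ k hk) (p k)
      exact ⟨q, fun _ z hz => hq z hz⟩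
    · exact ⟨0, fun h => absurd h hk⟩
  choose q hq using h1
  refine ⟨∑ k ∈ K, (p k * ℓ k + q k), fun z hz => ?_⟩
  simp only [Finset.sum_mul]
  rw [integral_finsetSum, eval_finsetSum, ← Finset.sum_add_distrib]
  · refine Finset.sum_congr rfl fun k hk => ?_
    have := hq k hk z hz
    rw [eval_add, eval_mul]
    linear_combination this
  · intro k hk
    exact integrable_cauchy hκ (((p k).continuous.comp Complex.continuous_ofReal).continuousOn.mul
      (hφ k hk)) hz

end ZeroBound

section ZeroBoundMain

variable {μ : ℕ → Measure ℝ} {A B : ℕ → ℝ} {m : ℕ}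

theorem eval_map_ofReal (p : ℝ[X]) (x : ℝ) :
    (p.map Complex.ofRealHom).eval (x : ℂ) = ((p.eval x : ℝ) : ℂ) := by
  rw [eval_map]
  exact eval₂_at_apply Complex.ofRealHom x

theorem natDegree_poly_quotient_le (h : NikGen μ A B m) {i : ℕ} {J : Fin i → ℕ} {j : ℕ}
    (hj : RegMinor μ A B (app J j)) {K : Finset ℕ} {n : ℕ → ℕ} {pj : ℂ[X]} {p : ℕ → ℂ[X]}
    (hpj : pj.degree < n j) (hp : ∀ k ∈ K, (p k).degree < n k)
    (hmax : ∀ k ∈ K, n k < n j ∨ n k = n j ∧ j < k) {f : ℕ → ℂ → ℂ}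
    (hf : ∀ k ∈ K, ∀ z, z.im ≠ 0 →
      cauchyMinor μ (app J k) z = cauchyMinor μ (app J j) z * f k z) {q : ℂ[X]} {v : ℂ → ℂ}
    (hq : ∀ z, z.im ≠ 0 → pj.eval z + ∑ k ∈ K, (p k).eval z * f k z = q.eval z + v z)
    (hv : Tendsto (fun t : ℝ => v (t * Complex.I)) atTop (nhds 0)) :
    q.natDegree ≤ n j - 1 := by
  have hnat : ∀ {s : ℂ[X]} {d : ℕ}, s.degree < d → s.natDegree ≤ d - 1 := by
    intro s d hs
    rcases eq_or_ne s 0 with rfl | hs0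
    · simp
    · have := (natDegree_lt_iff_degree_lt hs0).2 hs
      omega
  have hterm : ∀ k ∈ K, ∃ C : ℂ, Tendsto (fun t : ℝ => (p k).eval (t * Complex.I)
      * f k (t * Complex.I) / ((t : ℂ) * Complex.I) ^ (n j - 1)) atTop (nhds C) := by
    intro k hk
    have main : ∀ d e, (p k).natDegree ≤ d → countGE (i + 1) (app J j)
        ≤ countGE (i + 1) (app J k) + e → d + e = n j - 1 → ∃ C : ℂ,
        Tendsto (fun t : ℝ => (p k).eval (t * Complex.I)
          * f k (t * Complex.I) / ((t : ℂ) * Complex.I) ^ (n j - 1)) atTop (nhds C) := by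
      intro d e hd he hde
      obtain ⟨C1, h1⟩ := tendsto_eval_div_pow hd
      obtain ⟨C2, h2⟩ := tendsto_quotient_div_pow h hj he (hf k hk)
      refine ⟨_, (h1.mul h2).congr fun t => ?_⟩
      rw [← hde, pow_add, div_mul_div_comm]
    simp only [countGE_snoc] at main
    have hkd := hnat (hp k hk)
    rcases hmax k hk with hlt | ⟨heq, hjk⟩
    · rcases Nat.eq_zero_or_pos (n k) with h0 | h0
      · have hk0 : p k = 0 := by
          have := hp k hk
          rw [h0, Nat.cast_zero, Nat.WithBot.lt_zero_iff] at this
          exact degree_eq_bot.1 this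
        exact ⟨0, by simp [hk0]⟩
      · exact main (n j - 2) 1 (by omega) (by split_ifs <;> omega) (by omega)
    · exact main (n j - 1) 0 (by omega) (by split_ifs <;> omega) (by omega)
  choose! C hC using hterm
  obtain ⟨Cj, hCj⟩ := tendsto_eval_div_pow (hnat hpj)
  have h1 := (hCj.add (tendsto_finsetSum K hC)).sub
    ((NikGen.tendsto_inv_mul_I.pow (n j - 1)).mul hv)
  refine natDegree_le_of_tendsto (h1.congr' ?_)
  filter_upwards [eventually_gt_atTop 0] with t ht
  have hz : (t : ℂ) * Complex.I ≠ 0 := by simp [ht.ne']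
  have him : ((t : ℂ) * Complex.I).im ≠ 0 := by simp [ht.ne']
  have := hq _ him
  rw [← Finset.sum_div, inv_pow, ← div_eq_inv_mul, ← add_div, ← sub_div, this, add_sub_cancel_right]

theorem zero_bound (h : NikGen μ A B m) (r : ℕ) : ∀ (K : Finset ℕ), K.card = r →
    ∀ (i : ℕ) (J : Fin i → ℕ), Function.Injective J → (∀ x, J x ≤ m) →
    (∀ k ∈ K, k ≤ m ∧ ∀ x, J x ≠ k) → ∀ (n : ℕ → ℕ) (p : ℕ → ℝ[X]),
    (∀ k ∈ K, (p k).degree < n k) → ∀ Z : Finset ℝ,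
    (∀ x ∈ Z, x ∉ Icc (A (i + 1)) (B (i + 1)) ∧
      ∑ k ∈ K, (((p k).eval x : ℝ) : ℂ) * extMinor μ (app J k) (x : ℂ) = 0) →
    ∑ k ∈ K, n k ≤ Z.card → ∀ k ∈ K, p k = 0 := by
  induction r with
  | zero => 
    intro K hK i J _ _ _ n p _ Z _ _ k hk
    rw [Finset.card_eq_zero.1 hK] at hk
    simp at hk
  | succ r ih =>
    intro K hK i J hJ hJm hKJ n p hp Z hZ hcard
    have hKne : K.Nonempty := Finset.card_pos.1 (by omega)
    obtain ⟨j, hjK, hjmax⟩ : ∃ j ∈ K, ∀ k ∈ K.erase j, n k < n j ∨ n k = n j ∧ j < k := by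
      obtain ⟨a, haK, hamax⟩ := K.exists_max_image n hKne
      obtain ⟨j, hj, hjmin⟩ := (K.filter fun k => n k = n a).exists_min_image id
        ⟨a, by simp [haK]⟩
      simp only [Finset.mem_filter, id] at hj hjmin
      refine ⟨j, hj.1, fun k hk => ?_⟩
      obtain ⟨hkj, hkK⟩ := Finset.mem_erase.1 hk
      rcases (hamax k hkK).lt_or_eq with hlt | heq
      · exact Or.inl (by omega)
      · exact Or.inr ⟨by omega, lt_of_le_of_ne (hjmin k ⟨hkK, heq⟩) hkj.symm⟩
    obtain ⟨hjm, hjJ⟩ := hKJ j hjK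
    have hJj : Function.Injective (app J j) := app_injective.2 ⟨hJ, hjJ⟩
    have hJjm : ∀ x, app J j x ≤ m := fun x => by
      refine Fin.lastCases ?_ (fun x => ?_) x
      · simpa using hjm
      · simpa using hJm x
    have hKJ' : ∀ k ∈ K.erase j, k ≤ m ∧ ∀ x, app J j x ≠ k := fun k hk => by
      obtain ⟨hkj, hkK⟩ := Finset.mem_erase.1 hk
      refine ⟨(hKJ k hkK).1, fun x => ?_⟩
      refine Fin.lastCases ?_ (fun x => ?_) x
      · simpa using hkj.symm
      · simpa using (hKJ k hkK).2 x
    have hJreg := regMinor_of_injective h hJ hJm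
    have hjreg := regMinor_of_injective h hJj hJjm
    have hsum : ∑ k ∈ K, n k = n j + ∑ k ∈ K.erase j, n k := (Finset.add_sum_erase K n hjK).symm
    have hrest : ∀ k ∈ K.erase j, p k = 0 := by
      rcases Finset.eq_empty_or_nonempty (K.erase j) with he | ⟨k0, hk0⟩
      · intro k hk
        rw [he] at hk
        simp at hk
      rcases Nat.eq_zero_or_pos (n j) with hnj | hnj
      · intro k hk
        have h1 := hp k (Finset.mem_of_mem_erase hk)
        have h2 : n k = 0 := by rcases hjmax k hk with h | h <;> omega
        rw [h2, Nat.cast_zero, Nat.WithBot.lt_zero_iff] at h1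
        exact degree_eq_bot.1 h1
      have hJjk : ∀ k ∈ K.erase j, Function.Injective (app (app J j) k) := fun k hk =>
        app_injective.2 ⟨hJj, (hKJ' k hk).2⟩
      have hJjkm : ∀ k ∈ K.erase j, ∀ x, app (app J j) k x ≤ m := fun k hk x => by
        refine Fin.lastCases ?_ (fun x => ?_) x
        · simpa using (hKJ' k hk).1
        · simpa using hJjm x
      have him : i + 1 ≤ m := by
        have := Fintype.card_le_of_injective (fun x : Fin (i + 2) =>
          (⟨app (app J j) k0 x, Nat.lt_succ_of_le (hJjkm k0 hk0 x)⟩ : Fin (m + 1)))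
          fun x y e => hJjk k0 hk0 (by simpa using e)
        simp only [Fintype.card_fin] at this
        omega
      obtain ⟨-, -, κ, hκ⟩ := regular_of_injective h hJj hJjm
      have hgood := hκ.good him
      have := hκ.fin
      have hrep : ∀ k, ∃ ℓ : ℂ[X], k ∈ K.erase j → ∀ z, OffSeg (A (i + 1)) (B (i + 1)) z →
          extMinor μ (app J k) z = extMinor μ (app J j) z * (ℓ.eval z +
            ∫ y : ℝ, (extMinor μ J y * extMinor μ (app (app J j) k) y) * (z - y)⁻¹ ∂κ) := by
        intro k
        by_cases hk : k ∈ K.erase j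
        · obtain ⟨hkj, hkK⟩ := Finset.mem_erase.1 hk
          obtain ⟨ℓ, hℓ⟩ := hκ.rep k (hKJ k hkK).1 hkj (hKJ k hkK).2
          exact ⟨ℓ, fun _ => hℓ⟩
        · exact ⟨0, fun h => absurd h hk⟩
      choose ℓ hℓ using hrep
      have hregk : ∀ k ∈ K.erase j, RegMinor μ A B (app (app J j) k) := fun k hk =>
        regMinor_of_injective h (hJjk k hk) (hJjkm k hk)
      have hφ : ∀ k ∈ K.erase j, ContinuousOn (fun y : ℝ => extMinor μ J (y : ℂ) *
          extMinor μ (app (app J j) k) (y : ℂ)) (Icc (A (i + 1)) (B (i + 1))) := fun k hk =>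
        continuousOn_weight h hJreg.cont (hregk k hk).cont
      obtain ⟨q0, hq0⟩ := exists_poly_sum hκ.null (K.erase j)
        (fun k => (p k).map Complex.ofRealHom) ℓ _ hφ
      set Φ : ℝ → ℂ := fun y => ∑ k ∈ K.erase j, ((p k).map Complex.ofRealHom).eval (y : ℂ) *
        (extMinor μ J (y : ℂ) * extMinor μ (app (app J j) k) (y : ℂ)) with hΦ
      have hΦc : ContinuousOn Φ (Icc (A (i + 1)) (B (i + 1))) :=
        continuousOn_finsetSum _ fun k hk => (((p k).map Complex.ofRealHom).continuous.comp
          Complex.continuous_ofReal).continuousOn.mul (hφ k hk)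
      set q : ℂ[X] := (p j).map Complex.ofRealHom + q0 with hqdef
      have hqdeg : q.natDegree ≤ n j - 1 := by
        refine natDegree_poly_quotient_le h hjreg (K := K.erase j) (n := n)
          (pj := (p j).map Complex.ofRealHom) (p := fun k => (p k).map Complex.ofRealHom)
          (f := fun k z => (ℓ k).eval z +
            ∫ y : ℝ, (extMinor μ J y * extMinor μ (app (app J j) k) y) * (z - y)⁻¹ ∂κ)
          (v := fun z => ∫ y : ℝ, Φ y * (z - y)⁻¹ ∂κ)
          (degree_map_le.trans_lt (hp j hjK)) (fun k hk =>
            degree_map_le.trans_lt (hp k (Finset.mem_of_mem_erase hk))) hjmax ?_ ?_ ?_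
        · intro k hk z hz
          rw [← h.extMinor_eq _ hz, ← h.extMinor_eq _ hz, hℓ k hk z (offSeg_of_im_ne hz)]
        · intro z hz
          rw [hq0 z (offSeg_of_im_ne hz), hqdef, eval_add]
          ring
        · exact tendsto_cauchy_zero hκ.null hΦc
      have hZq : ∀ x ∈ Z, x ∉ Icc (A (i + 1)) (B (i + 1)) ∧
          q.eval (x : ℂ) + ∫ y, Φ y * ((x : ℂ) - (y : ℂ))⁻¹ ∂κ = 0 := by
        intro x hx
        obtain ⟨hx1, hx2⟩ := hZ x hx
        have hxo : OffSeg (A (i + 1)) (B (i + 1)) (x : ℂ) := offSeg_ofReal.2 hx1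
        refine ⟨hx1, ?_⟩
        apply mul_left_cancel₀ (hjreg.ne _ hxo)
        rw [mul_zero, ← hx2, ← Finset.add_sum_erase K _ hjK, hqdef, eval_add, add_assoc,
          ← hq0 _ hxo, mul_add, Finset.mul_sum]
        congr 1
        · rw [eval_map_ofReal, mul_comm]
        · refine Finset.sum_congr rfl fun k hk => ?_
          rw [hℓ k hk _ hxo, eval_map_ofReal]
          ring
      have hreJ : ∀ y ∈ Icc (A (i + 1)) (B (i + 1)),
          extMinor μ J (y : ℂ) = ((extMinor μ J (y : ℂ)).re : ℂ) := fun y hy =>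
        hJreg.extMinor_real h (h.offSeg_pred hy)
      have hrek : ∀ k ∈ K.erase j, ∀ y ∈ Icc (A (i + 1)) (B (i + 1)),
          extMinor μ (app (app J j) k) (y : ℂ)
            = ((extMinor μ (app (app J j) k) (y : ℂ)).re : ℂ) := fun k hk y hy =>
        (hregk k hk).extMinor_real h (h.offSeg_succ hy)
      have hprod0 : ∀ y ∈ Icc (A (i + 1)) (B (i + 1)), ∏ x ∈ Z, (y - x) ≠ 0 := fun y hy =>
        Finset.prod_ne_zero_iff.2 fun x hx => sub_ne_zero.2 fun e => (hZ x hx).1 (e ▸ hy)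
      obtain ⟨Z1, hZ1, hZ1'⟩ := hgood.exists_zeros (M := Z.card - n j)
        (W := fun y => (extMinor μ J (y : ℂ)).re * (∏ x ∈ Z, (y - x))⁻¹)
        (L := fun y => ∑ k ∈ K.erase j, (p k).eval y * (extMinor μ (app (app J j) k) (y : ℂ)).re)
        ((Complex.continuous_re.comp_continuousOn (ContMinor.continuousOn_Icc_succ h hJreg.cont)).mul
          (ContinuousOn.inv₀ (by fun_prop) hprod0))
        (fun y hy => mul_ne_zero (fun h0 => hJreg.ne _ (h.offSeg_pred hy) (by
          rw [hreJ y hy, h0, Complex.ofReal_zero])) (inv_ne_zero (hprod0 y hy)))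
        (continuousOn_finsetSum _ fun k hk => (p k).continuous.continuousOn.mul
          (Complex.continuous_re.comp_continuousOn
            (ContMinor.continuousOn_Icc_pred h (hregk k hk).cont)))
        (by
          intro P hP
          have h1 := integral_div_nodal_eq_zero hκ.null hΦc q Z hZq (P.map Complex.ofRealHom)
            (by rw [natDegree_map]; omega)
          rw [← Complex.ofReal_eq_zero, ← integral_complex_ofReal, ← h1]
          apply integral_congr_ae
          filter_upwards [ae_mem_Icc hκ.null] with y hy
          rw [eval_map_ofReal, hΦ]
          simp only
          push_cast
          rw [← hreJ y hy, Finset.mul_sum, Finset.mul_sum, Finset.mul_sum, Finset.sum_mul]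
          refine Finset.sum_congr rfl fun k hk => ?_
          rw [← hrek k hk y hy, eval_map_ofReal]
          ring)
      refine ih (K.erase j) (by rw [Finset.card_erase_of_mem hjK, hK]; rfl) (i + 1) (app J j) hJj
        hJjm hKJ' n p (fun k hk => hp k (Finset.mem_of_mem_erase hk)) Z1 (fun x hx => ?_) (by omega)
      obtain ⟨hxI, hx0⟩ := hZ1' x hx
      refine ⟨fun hx2 => Set.disjoint_left.1 (h.disj (i + 1)) hxI hx2, ?_⟩
      rw [← Complex.ofReal_zero, ← hx0]
      push_cast
      exact Finset.sum_congr rfl fun k hk => by rw [← hrek k hk x hxI]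
    intro k hk
    by_cases hkj : k = j
    · rw [hkj]
      refine eq_zero_of_degree_lt_of_eval_finset_eq_zero Z ((hp j hjK).trans_le (by
        exact_mod_cast (show n j ≤ Z.card by omega))) fun x hx => ?_
      obtain ⟨hx1, hx2⟩ := hZ x hx
      rw [← Finset.add_sum_erase K _ hjK, Finset.sum_eq_zero fun k hk => by
        rw [hrest k hk]; simp, add_zero] at hx2
      exact_mod_cast (mul_eq_zero.1 hx2).resolve_right (hjreg.ne _ (offSeg_ofReal.2 hx1))
    · exact hrest k (Finset.mem_erase.2 ⟨hkj, hk⟩)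

end ZeroBoundMain

/-- The linear form `∑ pₖ Fₖ` with polynomial coefficients. -/
def polyForm (F : ℕ → ℝ → ℝ) (m : ℕ) (p : ℕ → ℝ[X]) (x : ℝ) : ℝ :=
  ∑ k ∈ Finset.range (m + 1), (p k).eval x * F k x

/-- `F 0, …, F m` is an algebraic Chebyshev system on `U`: a form whose coefficients have degrees
`< n k` and which has at least `∑ n k` zeros on `U` is trivial. -/
def IsATSystem (F : ℕ → ℝ → ℝ) (m : ℕ) (U : Set ℝ) : Prop :=
  ∀ (n : ℕ → ℕ) (p : ℕ → ℝ[X]), (∀ k ≤ m, (p k).degree < n k) → ∀ Z : Finset ℝ,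
    (∀ x ∈ Z, x ∈ U ∧ polyForm F m p x = 0) → ∑ k ∈ Finset.range (m + 1), n k ≤ Z.card →
    ∀ k ≤ m, p k = 0

theorem polyForm_add (F : ℕ → ℝ → ℝ) (m : ℕ) (p q : ℕ → ℝ[X]) (c : ℝ) (x : ℝ) :
    polyForm F m (fun k => p k + c • q k) x = polyForm F m p x + c * polyForm F m q x := by
  simp only [polyForm, eval_add, eval_smul, smul_eq_mul, Finset.mul_sum, ← Finset.sum_add_distrib]
  exact Finset.sum_congr rfl fun k _ => by ring

theorem polyForm_eq_zero {F : ℕ → ℝ → ℝ} {m : ℕ} {p : ℕ → ℝ[X]} (hp : ∀ k ≤ m, p k = 0)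
    (x : ℝ) : polyForm F m p x = 0 :=
  Finset.sum_eq_zero fun k hk => by
    rw [hp k (Nat.lt_succ_iff.1 (Finset.mem_range.1 hk)), eval_zero, zero_mul]

theorem continuousOn_polyForm {F : ℕ → ℝ → ℝ} {m : ℕ} {s : Set ℝ}
    (hF : ∀ k ≤ m, ContinuousOn (F k) s) (p : ℕ → ℝ[X]) : ContinuousOn (polyForm F m p) s :=
  continuousOn_finsetSum _ fun k hk =>
    (p k).continuous.continuousOn.mul (hF k (Nat.lt_succ_iff.1 (Finset.mem_range.1 hk)))

theorem exists_le_sum_eq (n : ℕ → ℕ) (r : ℕ) : ∀ T ≤ ∑ k ∈ Finset.range r, n k,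
    ∃ n' : ℕ → ℕ, (∀ k, n' k ≤ n k) ∧ ∑ k ∈ Finset.range r, n' k = T := by
  intro T hT
  induction T with
  | zero => exact ⟨fun _ => 0, fun _ => Nat.zero_le _, by simp⟩
  | succ T ih =>
    obtain ⟨n', hn', hsum⟩ := ih (by omega)
    have hlt : ∑ k ∈ Finset.range r, n' k < ∑ k ∈ Finset.range r, n k := by omega
    obtain ⟨k, hk, hklt⟩ := Finset.exists_lt_of_sum_lt hlt
    refine ⟨Function.update n' k (n' k + 1), fun j => ?_, ?_⟩
    · by_cases hj : j = k
      · subst hj; simpa using hklt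
      · simpa [hj] using hn' j
    · rw [Finset.sum_update_of_mem hk, ← hsum, ← Finset.add_sum_erase _ _ hk,
        Finset.sdiff_singleton_eq_erase]
      omega

/-- Interpolation by forms of an algebraic Chebyshev system. -/
theorem IsATSystem.interpolation {F : ℕ → ℝ → ℝ} {m : ℕ} {U : Set ℝ} (h : IsATSystem F m U)
    {n : ℕ → ℕ} {Z : Finset ℝ} (hZ : ∀ x ∈ Z, x ∈ U)
    (hcard : ∑ k ∈ Finset.range (m + 1), n k = Z.card) (v : ℝ → ℝ) :
    ∃ p : ℕ → ℝ[X], (∀ k ≤ m, (p k).degree < n k) ∧ ∀ x ∈ Z, polyForm F m p x = v x := by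
  classical
  let T : ((k : Fin (m + 1)) → degreeLT ℝ (n k)) →ₗ[ℝ] (Z → ℝ) :=
    { toFun := fun p x => ∑ k : Fin (m + 1), (p k : ℝ[X]).eval (x : ℝ) * F k x
      map_add' := fun p q => by
        ext x
        simp only [Pi.add_apply, Submodule.coe_add, eval_add, add_mul, Finset.sum_add_distrib]
      map_smul' := fun c p => by
        ext x
        simp only [Pi.smul_apply, Submodule.coe_smul, eval_smul, smul_eq_mul, mul_assoc,
          Finset.mul_sum, RingHom.id_apply] }
  let extCoeff : ((k : Fin (m + 1)) → degreeLT ℝ (n k)) → ℕ → ℝ[X] := fun p k =>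
    if hk : k < m + 1 then (p ⟨k, hk⟩ : ℝ[X]) else 0
  have hdeg : ∀ p, ∀ k ≤ m, (extCoeff p k).degree < n k := fun p k hk => by
    simp only [extCoeff, dif_pos (Nat.lt_succ_of_le hk)]
    exact mem_degreeLT.1 (p ⟨k, Nat.lt_succ_of_le hk⟩).2
  have hform : ∀ p, ∀ x : Z, polyForm F m (extCoeff p) x = T p x := fun p x => by
    simp only [polyForm, T, LinearMap.coe_mk, AddHom.coe_mk]
    rw [Finset.sum_range]
    exact Finset.sum_congr rfl fun k _ => by simp only [extCoeff, dif_pos k.2]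
  have hinj : Function.Injective T := by
    rw [injective_iff_map_eq_zero]
    intro p hp
    have h0 := h n (extCoeff p) (hdeg p) Z (fun x hx => ⟨hZ x hx, by
      rw [hform p ⟨x, hx⟩, hp]; rfl⟩) hcard.le
    ext1 k
    have := h0 k (Nat.lt_succ_iff.1 k.2)
    simp only [extCoeff, dif_pos k.2] at this
    exact Subtype.ext this
  have hfin : Module.finrank ℝ ((k : Fin (m + 1)) → degreeLT ℝ (n k))
      = Module.finrank ℝ (Z → ℝ) := by
    have : ∀ k : Fin (m + 1), Module.Finite ℝ (degreeLT ℝ (n k)) := fun k =>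
      Module.Finite.equiv (degreeLTEquiv ℝ (n k)).symm
    have : ∀ k : Fin (m + 1), Module.Free ℝ (degreeLT ℝ (n k)) := fun k =>
      Module.Free.of_equiv (degreeLTEquiv ℝ (n k)).symm
    rw [Module.finrank_pi_fintype, Module.finrank_pi, Fintype.card_coe, ← hcard, Finset.sum_range]
    refine Finset.sum_congr rfl fun k _ => ?_
    rw [(degreeLTEquiv ℝ (n k)).finrank_eq, Module.finrank_pi, Fintype.card_fin]
  have : ∀ k : Fin (m + 1), Module.Finite ℝ (degreeLT ℝ (n k)) := fun k =>
    Module.Finite.equiv (degreeLTEquiv ℝ (n k)).symm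
  obtain ⟨p, hp⟩ := (LinearMap.injective_iff_surjective_of_finrank_eq_finrank hfin).1 hinj
    (fun x => v x)
  exact ⟨extCoeff p, hdeg p, fun x hx => by rw [hform p ⟨x, hx⟩, hp]⟩

/-- If `g ≥ 0` near its zero `z` and `g` is positive at points on both sides of `z`, then
subtracting a small multiple of a function that is positive at `z` creates two zeros. -/
theorem exists_two_zeros {g H : ℝ → ℝ} {c z d : ℝ} (hcz : c < z) (hzd : z < d)
    (hg : ContinuousOn g (Icc c d)) (hH : ContinuousOn H (Icc c d)) (hgz : g z = 0)
    (hHz : H z = 1) (hc : 0 < g c) (hd : 0 < g d) :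
    ∃ η : ℝ, 0 < η ∧ ∃ x ∈ Ioo c z, ∃ y ∈ Ioo z d, g x + -η * H x = 0 ∧ g y + -η * H y = 0 := by
  obtain ⟨η, hη, h1, h2⟩ : ∃ η : ℝ, 0 < η ∧ 0 < g c + -η * H c ∧ 0 < g d + -η * H d := by
    have hlim : ∀ u w : ℝ, 0 < u → ∀ᶠ η : ℝ in nhdsWithin 0 (Ioi 0), 0 < u + -η * w := by
      intro u w hu
      have : Tendsto (fun η : ℝ => u + -η * w) (nhds 0) (nhds (u + -0 * w)) := by
        apply Continuous.tendsto
        fun_prop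
      refine (this.mono_left nhdsWithin_le_nhds).eventually (lt_mem_nhds (by simpa using hu))
    obtain ⟨η, h1, h2, h3⟩ := ((hlim _ (H c) hc).and ((hlim _ (H d) hd).and
      self_mem_nhdsWithin)).exists
    exact ⟨η, h3, h1, h2⟩
  have hcont : ContinuousOn (fun x => g x + -η * H x) (Icc c d) :=
    hg.add (continuousOn_const.mul hH)
  have hz : g z + -η * H z < 0 := by rw [hgz, hHz]; linarith
  obtain ⟨x, hx, hx0⟩ := intermediate_value_Ioo' hcz.le
    (hcont.mono (Icc_subset_Icc_right hzd.le)) ⟨hz, h1⟩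
  obtain ⟨y, hy, hy0⟩ := intermediate_value_Ioo hzd.le
    (hcont.mono (Icc_subset_Icc_left hcz.le)) ⟨hz, h2⟩
  exact ⟨η, hη, x, hx, y, hy, hx0, hy0⟩

/-- A form of an algebraic Chebyshev system changing sign exactly at prescribed points. -/
theorem IsATSystem.exists_prescribed_signs {F : ℕ → ℝ → ℝ} {m : ℕ} {U : Set ℝ}
    (h : IsATSystem F m U) (hU : IsOpen U) (hUc : U.OrdConnected) (hUi : U.Infinite)
    (hF : ∀ k ≤ m, ContinuousOn (F k) U) {n : ℕ → ℕ} {Z : Finset ℝ} (hZ : ∀ x ∈ Z, x ∈ U)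
    (hcard : ∑ k ∈ Finset.range (m + 1), n k = Z.card + 1) :
    ∃ p : ℕ → ℝ[X], (∀ k ≤ m, (p k).degree < n k) ∧
      (∀ x ∈ U, polyForm F m p x = 0 → x ∈ Z) ∧
      ∃ ε : ℝ, (ε = 1 ∨ ε = -1) ∧ ∀ x ∈ U, 0 ≤ ε * polyForm F m p x * ∏ z ∈ Z, (x - z) := by
  classical
  obtain ⟨x₀, hx₀U, hx₀Z⟩ := hUi.exists_notMem_finset Z
  obtain ⟨p, hp, hpv⟩ := h.interpolation (n := n) (Z := insert x₀ Z)
    (fun x hx => by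
      rcases Finset.mem_insert.1 hx with rfl | hx
      exacts [hx₀U, hZ x hx])
    (by rw [hcard, Finset.card_insert_of_notMem hx₀Z]) (fun x => if x = x₀ then 1 else 0)
  have hpx₀ : polyForm F m p x₀ = 1 := by
    rw [hpv x₀ (Finset.mem_insert_self _ _), if_pos rfl]
  have hpZ : ∀ x ∈ Z, polyForm F m p x = 0 := fun x hx => by
    rw [hpv x (Finset.mem_insert_of_mem hx), if_neg (ne_of_mem_of_not_mem hx hx₀Z)]
  have hzero : ∀ x ∈ U, polyForm F m p x = 0 → x ∈ Z := by
    intro x hx hx0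
    by_contra hxZ
    have := polyForm_eq_zero (F := F) (h n p hp (insert x Z) (fun y hy => by
      rcases Finset.mem_insert.1 hy with rfl | hy
      exacts [⟨hx, hx0⟩, ⟨hZ y hy, hpZ y hy⟩])
      (by rw [hcard, Finset.card_insert_of_notMem hxZ])) x₀
    rw [hpx₀] at this
    exact one_ne_zero this
  have hcont := continuousOn_polyForm hF p
  refine ⟨p, hp, hzero, ?_⟩
  obtain ⟨Z', hZ', ε, hε, hpos⟩ := exists_sign_changes Z hUc hcont fun x =>
    ⟨fun hx => ⟨hZ x hx, hpZ x hx⟩, fun hx => hzero x hx.1 hx.2⟩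
  suffices hZZ : Z ⊆ Z' by
    obtain rfl := hZ'.antisymm hZZ
    exact ⟨ε, hε, hpos⟩
  intro z hz
  by_contra hzZ'
  have hε0 : ε ≠ 0 := by rcases hε with rfl | rfl <;> norm_num
  obtain ⟨q, hq, hqv⟩ := h.interpolation (n := n) (Z := insert x₀ Z)
    (fun x hx => by
      rcases Finset.mem_insert.1 hx with rfl | hx
      exacts [hx₀U, hZ x hx])
    (by rw [hcard, Finset.card_insert_of_notMem hx₀Z]) (fun x => if x = z then 1 else 0)
  have hqz : polyForm F m q z = 1 := by
    rw [hqv z (Finset.mem_insert_of_mem hz), if_pos rfl]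
  have hqZ : ∀ x ∈ Z, x ≠ z → polyForm F m q x = 0 := fun x hx hxz => by
    rw [hqv x (Finset.mem_insert_of_mem hx), if_neg hxz]
  -- a neighbourhood of `z` in which `z` is the only zero
  have hnhds : U \ (Z.erase z : Finset ℝ) ∈ nhds z :=
    (hU.sdiff (Finset.finite_toSet _).isClosed).mem_nhds ⟨hZ z hz, by simp⟩
  obtain ⟨r, hr, hball⟩ := Metric.mem_nhds_iff.1 hnhds
  have hI : Icc (z - r / 2) (z + r / 2) ⊆ U \ (Z.erase z : Finset ℝ) := fun y hy => hball (by
    rw [Real.ball_eq_Ioo]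
    exact ⟨by linarith [hy.1], by linarith [hy.2]⟩)
  obtain ⟨δ, hδ, hδpos⟩ := exists_sign_of_ne_zero (s := Icc (z - r / 2) (z + r / 2))
    (g := fun x => ∏ z ∈ Z', (x - z)) ordConnected_Icc (by fun_prop) (fun x hx h0 => by
      obtain ⟨w, hw, hw0⟩ := Finset.prod_eq_zero_iff.1 h0
      obtain rfl : x = w := sub_eq_zero.1 hw0
      refine (hI hx).2 ?_
      simp only [Finset.coe_erase, Set.mem_sdiff, Finset.mem_coe, mem_singleton_iff]
      exact ⟨hZ' hw, fun hxz => hzZ' (hxz ▸ hw)⟩)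
  have hδ0 : δ ≠ 0 := by rcases hδ with rfl | rfl <;> norm_num
  have hgpos : ∀ y ∈ Icc (z - r / 2) (z + r / 2), y ≠ z → 0 < δ * ε * polyForm F m p y := by
    intro y hy hyz
    have h1 := hpos y (hI hy).1
    have h2 := hδpos y hy
    have h3 : polyForm F m p y ≠ 0 := fun h0 => (hI hy).2 (by
      simpa [hyz] using hzero y (hI hy).1 h0)
    have hδδ : δ * δ = 1 := by rcases hδ with rfl | rfl <;> norm_num
    refine lt_of_le_of_ne ?_ (mul_ne_zero (mul_ne_zero hδ0 hε0) h3).symm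
    by_contra! hneg
    have h4 : δ * ε * polyForm F m p y * (δ * ∏ z ∈ Z', (y - z)) < 0 :=
      mul_neg_of_neg_of_pos hneg h2
    have h5 : δ * ε * polyForm F m p y * (δ * ∏ z ∈ Z', (y - z))
        = (δ * δ) * (ε * polyForm F m p y * ∏ z ∈ Z', (y - z)) := by ring
    rw [h5, hδδ, one_mul] at h4
    exact absurd h1 h4.not_ge
  have hIU : Icc (z - r / 2) (z + r / 2) ⊆ U := fun y hy => (hI hy).1
  obtain ⟨η, hη, x, hx, y, hy, hx0, hy0⟩ := exists_two_zeros (c := z - r / 2) (z := z)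
    (d := z + r / 2) (g := fun x => δ * ε * polyForm F m p x) (H := polyForm F m q)
    (by linarith) (by linarith) (continuousOn_const.mul (hcont.mono hIU))
    ((continuousOn_polyForm hF q).mono hIU) (by simp [hpZ z hz]) hqz
    (hgpos _ ⟨le_rfl, by linarith⟩ (by linarith)) (hgpos _ ⟨by linarith, le_rfl⟩ (by linarith))
  have hform : ∀ x, polyForm F m (fun k => (δ * ε) • p k + (-η) • q k) x
      = δ * ε * polyForm F m p x + -η * polyForm F m q x := fun x => by
    rw [polyForm_add]
    congr 1
    simp only [polyForm, eval_smul, smul_eq_mul, Finset.mul_sum, mul_assoc]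
  have hxI : x ∈ Icc (z - r / 2) (z + r / 2) := ⟨hx.1.le, by linarith [hx.2]⟩
  have hyI : y ∈ Icc (z - r / 2) (z + r / 2) := ⟨by linarith [hy.1], hy.2.le⟩
  have hxn : x ∉ Z.erase z := (hI hxI).2
  have hyn : y ∉ Z.erase z := (hI hyI).2
  have hxy : x ≠ y := (hx.2.trans hy.1).ne
  have h0 := h n (fun k => (δ * ε) • p k + (-η) • q k) (fun k hk =>
    (degree_add_le _ _).trans_lt (max_lt ((degree_smul_le _ _).trans_lt (hp k hk))
      ((degree_smul_le _ _).trans_lt (hq k hk)))) (insert x (insert y (Z.erase z)))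
    (fun w hw => by
      rcases Finset.mem_insert.1 hw with rfl | hw
      · exact ⟨hIU hxI, by rw [hform]; exact hx0⟩
      rcases Finset.mem_insert.1 hw with rfl | hw
      · exact ⟨hIU hyI, by rw [hform]; exact hy0⟩
      · have hwZ := Finset.mem_of_mem_erase hw
        exact ⟨hZ w hwZ, by rw [hform, hpZ w hwZ, hqZ w hwZ (Finset.ne_of_mem_erase hw)]; simp⟩)
    (by
      rw [hcard, Finset.card_insert_of_notMem (by simp [hxy, Finset.mem_erase] at hxn ⊢; tauto),
        Finset.card_insert_of_notMem hyn, Finset.card_erase_of_mem hz]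
      have := Finset.card_pos.2 ⟨z, hz⟩
      omega)
  have := polyForm_eq_zero (F := F) h0 z
  rw [hform, hpZ z hz, hqz] at this
  linarith

/-- The mixed type orthogonality relations. -/
def MixedOrtho (κ : Measure ℝ) (F G : ℕ → ℝ → ℝ) (m₁ m₂ : ℕ) (n : ℕ → ℕ) (p : ℕ → ℝ[X]) : Prop :=
  ∀ i ≤ m₂, ∀ ν < n i, ∫ x, x ^ ν * (G i x * polyForm F m₁ p x) ∂κ = 0

/-- A mixed type orthogonal form with at most as many coefficients as there are orthogonality
relations is trivial. -/
theorem MixedOrtho.eq_zero {κ : Measure ℝ} {a b : ℝ} (hκ : Good κ a b) {F G : ℕ → ℝ → ℝ}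
    {m₁ m₂ : ℕ} {U : Set ℝ} (hF : IsATSystem F m₁ (Icc a b)) (hG : IsATSystem G m₂ U)
    (hFc : ∀ k ≤ m₁, ContinuousOn (F k) (Icc a b)) (hGc : ∀ k ≤ m₂, ContinuousOn (G k) U)
    (hU : IsOpen U) (hUc : U.OrdConnected) (hUi : U.Infinite) (hIU : Icc a b ⊆ U)
    {n₁ n₂ : ℕ → ℕ}
    (hn : ∑ k ∈ Finset.range (m₁ + 1), n₁ k ≤ ∑ k ∈ Finset.range (m₂ + 1), n₂ k)
    {p : ℕ → ℝ[X]} (hp : ∀ k ≤ m₁, (p k).degree < n₁ k) (ho : MixedOrtho κ F G m₁ m₂ n₂ p) :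
    ∀ k ≤ m₁, p k = 0 := by
  set L := polyForm F m₁ p with hL
  have hLc : ContinuousOn L (Icc a b) := continuousOn_polyForm hFc p
  by_contra hne
  have hfew : ∀ Z : Finset ℝ, (∀ x ∈ Z, x ∈ Icc a b ∧ L x = 0) →
      Z.card < ∑ k ∈ Finset.range (m₁ + 1), n₁ k := fun Z hZ => by
    by_contra! hle
    exact hne (hF n₁ p hp Z hZ hle)
  have hfin : {x | x ∈ Icc a b ∧ L x = 0}.Finite := by
    by_contra hinf
    obtain ⟨Z, hZ, hcard⟩ := Set.Infinite.exists_subset_card_eq hinf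
      (∑ k ∈ Finset.range (m₁ + 1), n₁ k)
    exact absurd (hfew Z fun x hx => hZ hx) (by omega)
  obtain ⟨Z, hZ, ε, hε, hpos⟩ := exists_sign_changes hfin.toFinset (s := Icc a b)
    ordConnected_Icc hLc fun x => hfin.mem_toFinset
  have hZmem : ∀ x ∈ Z, x ∈ Icc a b ∧ L x = 0 := fun x hx => hfin.mem_toFinset.1 (hZ hx)
  obtain ⟨n', hn', hsum⟩ := exists_le_sum_eq n₂ (m₂ + 1) (Z.card + 1)
    ((Nat.succ_le_of_lt (hfew Z hZmem)).trans hn)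
  obtain ⟨q, hq, hqz, δ, hδ, hqpos⟩ := hG.exists_prescribed_signs hU hUc hUi hGc
    (Z := Z) (fun x hx => hIU (hZmem x hx).1) hsum
  set B := polyForm G m₂ q with hB
  have hBc : ContinuousOn B (Icc a b) := (continuousOn_polyForm hGc q).mono hIU
  have hε0 : ε ≠ 0 := by rcases hε with rfl | rfl <;> norm_num
  have hδ0 : δ ≠ 0 := by rcases hδ with rfl | rfl <;> norm_num
  have h1 : 0 < ∫ x, (ε * δ) * (B x * L x) ∂κ := by
    refine hκ.integral_pos (by fun_prop) (fun x hx => ?_) hfin.toFinset fun x hx h0 => ?_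
    · by_cases hxZ : x ∈ Z
      · simp [(hZmem x hxZ).2]
      · have hprod : ∏ z ∈ Z, (x - z) ≠ 0 := Finset.prod_ne_zero_iff.2 fun z hz h0 =>
          hxZ (sub_eq_zero.1 h0 ▸ hz)
        have h2 := mul_nonneg (hpos x hx) (hqpos x (hIU hx))
        have h3 : (ε * L x * ∏ z ∈ Z, (x - z)) * (δ * B x * ∏ z ∈ Z, (x - z))
            = (ε * δ * (B x * L x)) * (∏ z ∈ Z, (x - z)) ^ 2 := by ring
        have h4 : (0 : ℝ) < (∏ z ∈ Z, (x - z)) ^ 2 := by positivity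
        refine nonneg_of_mul_nonneg_left ?_ h4
        rwa [← h3]
    · rcases mul_eq_zero.1 h0 with h0 | h0
      · exact absurd h0 (mul_ne_zero hε0 hδ0)
      · rcases mul_eq_zero.1 h0 with h0 | h0
        · exact hZ (hqz x (hIU hx) h0)
        · exact hfin.mem_toFinset.2 ⟨hx, h0⟩
  have h2 : ∫ x, B x * L x ∂κ = 0 := by
    have h3 : ∀ x, B x * L x = ∑ i ∈ Finset.range (m₂ + 1),
        ∑ ν ∈ Finset.range (n₂ i), (q i).coeff ν * (x ^ ν * (G i x * L x)) := fun x => by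
      rw [hB, polyForm, Finset.sum_mul]
      refine Finset.sum_congr rfl fun i hi => ?_
      have hdeg : (q i).degree < n₂ i := (hq i (Nat.lt_succ_iff.1 (Finset.mem_range.1 hi))).trans_le
        (by exact_mod_cast hn' i)
      by_cases h0 : q i = 0
      · simp [h0]
      rw [eval_eq_sum_range' ((natDegree_lt_iff_degree_lt h0).2 hdeg), Finset.sum_mul,
        Finset.sum_mul]
      exact Finset.sum_congr rfl fun ν _ => by ring
    simp_rw [h3]
    have hfint : ∀ i ≤ m₂, ∀ ν, Integrable
        (fun x => (q i).coeff ν * (x ^ ν * (G i x * L x))) κ := fun i hi ν => by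
      have := (hGc i hi).mono hIU
      exact hκ.integrable (by fun_prop)
    rw [integral_finsetSum _ fun i hi => integrable_finsetSum _ fun ν _ =>
      hfint i (Nat.lt_succ_iff.1 (Finset.mem_range.1 hi)) ν]
    refine Finset.sum_eq_zero fun i hi => ?_
    have hi' := Nat.lt_succ_iff.1 (Finset.mem_range.1 hi)
    rw [integral_finsetSum _ fun ν _ => hfint i hi' ν]
    refine Finset.sum_eq_zero fun ν hν => ?_
    rw [integral_const_mul, ho i hi' ν (Finset.mem_range.1 hν), mul_zero]
  rw [integral_const_mul, h2, mul_zero] at h1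
  exact lt_irrefl _ h1

theorem MixedOrtho.add_smul {κ : Measure ℝ} {a b : ℝ} (hκ : Good κ a b) {F G : ℕ → ℝ → ℝ}
    {m₁ m₂ : ℕ} (hFc : ∀ k ≤ m₁, ContinuousOn (F k) (Icc a b))
    (hGc : ∀ k ≤ m₂, ContinuousOn (G k) (Icc a b)) {n : ℕ → ℕ} {p q : ℕ → ℝ[X]}
    (hp : MixedOrtho κ F G m₁ m₂ n p) (hq : MixedOrtho κ F G m₁ m₂ n q) (c : ℝ) :
    MixedOrtho κ F G m₁ m₂ n (fun k => p k + c • q k) := by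
  intro i hi ν hν
  have hG := hGc i hi
  have hpc := continuousOn_polyForm hFc p
  have hqc := continuousOn_polyForm hFc q
  have h1 : ∀ x, x ^ ν * (G i x * polyForm F m₁ (fun k => p k + c • q k) x)
      = x ^ ν * (G i x * polyForm F m₁ p x) + c * (x ^ ν * (G i x * polyForm F m₁ q x)) :=
    fun x => by rw [polyForm_add]; ring
  simp_rw [h1]
  rw [integral_add (hκ.integrable (by fun_prop)) (hκ.integrable (by fun_prop)),
    integral_const_mul, hp i hi ν hν, hq i hi ν hν, mul_zero, add_zero]

/-- Mixed type orthogonal forms have coefficients of maximal degree and are unique up to a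
constant factor. -/
theorem mixedOrtho_perfect {κ : Measure ℝ} {a b : ℝ} (hκ : Good κ a b) {F G : ℕ → ℝ → ℝ}
    {m₁ m₂ : ℕ} {U : Set ℝ} (hF : IsATSystem F m₁ (Icc a b)) (hG : IsATSystem G m₂ U)
    (hFc : ∀ k ≤ m₁, ContinuousOn (F k) (Icc a b)) (hGc : ∀ k ≤ m₂, ContinuousOn (G k) U)
    (hU : IsOpen U) (hUc : U.OrdConnected) (hUi : U.Infinite) (hIU : Icc a b ⊆ U)
    {n₁ n₂ : ℕ → ℕ}
    (hn : ∑ k ∈ Finset.range (m₁ + 1), n₁ k = ∑ k ∈ Finset.range (m₂ + 1), n₂ k + 1)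
    {P : (ℕ → ℝ[X]) → Prop} (hP : ∀ p, P p → (¬ ∀ k ≤ m₁, p k = 0) ∧
      (∀ k ≤ m₁, (p k).degree < n₁ k) ∧ MixedOrtho κ F G m₁ m₂ n₂ p) :
    (∀ p, P p → ∀ k ≤ m₁, (n₁ k = 0 ∧ p k = 0) ∨ (p k ≠ 0 ∧ (p k).natDegree + 1 = n₁ k)) ∧
    (∀ p q, P p → P q → ∃ c : ℝ, c ≠ 0 ∧ ∀ k ≤ m₁, q k = c • p k) := by
  have hzero : ∀ p : ℕ → ℝ[X], (∀ k ≤ m₁, (p k).degree < n₁ k) → MixedOrtho κ F G m₁ m₂ n₂ p →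
      ∀ k ≤ m₁, n₁ k ≠ 0 → (p k).coeff (n₁ k - 1) = 0 → ∀ j ≤ m₁, p j = 0 := by
    intro p hp ho k hk hnk hcoeff
    refine MixedOrtho.eq_zero hκ hF hG hFc hGc hU hUc hUi hIU
      (n₁ := Function.update n₁ k (n₁ k - 1)) ?_ (fun j hj => ?_) ho
    · have hkr : k ∈ Finset.range (m₁ + 1) := Finset.mem_range.2 (Nat.lt_succ_of_le hk)
      rw [← Finset.add_sum_erase _ _ hkr] at hn
      rw [Finset.sum_update_of_mem hkr, Finset.sdiff_singleton_eq_erase]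
      omega
    · by_cases hjk : j = k
      · subst hjk
        rw [Function.update_self, degree_lt_iff_coeff_zero]
        intro l hl
        rcases hl.eq_or_lt with rfl | hl
        · exact hcoeff
        · exact coeff_eq_zero_of_degree_lt ((hp j hj).trans_le (by exact_mod_cast (by omega)))
      · rw [Function.update_of_ne hjk]
        exact hp j hj
  have hlead : ∀ p, P p → ∀ k ≤ m₁, n₁ k ≠ 0 → (p k).coeff (n₁ k - 1) ≠ 0 := by
    intro p hp k hk hnk h0
    obtain ⟨h1, h2, h3⟩ := hP p hp
    exact h1 (hzero p h2 h3 k hk hnk h0)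
  refine ⟨fun p hp k hk => ?_, fun p q hp hq => ?_⟩
  · have hdeg := (hP p hp).2.1 k hk
    by_cases hnk : n₁ k = 0
    · refine Or.inl ⟨hnk, ?_⟩
      rw [hnk] at hdeg
      simpa using hdeg
    · have h0 := hlead p hp k hk hnk
      have hne : p k ≠ 0 := fun h => h0 (by rw [h, coeff_zero])
      refine Or.inr ⟨hne, ?_⟩
      have h1 := le_natDegree_of_ne_zero h0
      have h2 := (natDegree_lt_iff_degree_lt hne).2 hdeg
      omega
  · obtain ⟨k, hk, hnk⟩ : ∃ k ≤ m₁, n₁ k ≠ 0 := by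
      by_contra! hcon
      rw [Finset.sum_eq_zero fun k hk => hcon k (Nat.lt_succ_iff.1 (Finset.mem_range.1 hk))] at hn
      omega
    obtain ⟨-, hp2, hp3⟩ := hP p hp
    obtain ⟨-, hq2, hq3⟩ := hP q hq
    have hpk := hlead p hp k hk hnk
    have hqk := hlead q hq k hk hnk
    set c := (q k).coeff (n₁ k - 1) / (p k).coeff (n₁ k - 1) with hc
    refine ⟨c, div_ne_zero hqk hpk, fun j hj => ?_⟩
    have := hzero (fun k => q k + (-c) • p k) (fun k hk => (degree_add_le _ _).trans_lt
      (max_lt (hq2 k hk) ((degree_smul_le _ _).trans_lt (hp2 k hk))))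
      (MixedOrtho.add_smul hκ hFc (fun k hk => (hGc k hk).mono hIU) hq3 hp3 (-c)) k hk hnk (by
        rw [coeff_add, coeff_smul, smul_eq_mul, hc, neg_mul, div_mul_cancel₀ _ hpk, add_neg_cancel])
      j hj
    rw [neg_smul] at this
    exact add_neg_eq_zero.1 this

theorem msupport_eq_support (μ : Measure ℝ) : SignedM.msupport μ = μ.support := by
  ext x
  rw [Measure.mem_support_iff_forall]
  constructor
  · intro h U hU
    obtain ⟨V, hVU, hV, hxV⟩ := mem_nhds_iff.1 hU
    exact (pos_iff_ne_zero.2 (h V hV hxV)).trans_le (measure_mono hVU)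
  · exact fun h U hU hx => (h U (hU.mem_nhds hx)).ne'

theorem SignedM.supp_eq (s : SignedM) : s.supp = (s.pos + s.neg).support := by
  rw [← msupport_eq_support]
  ext x
  simp only [supp, msupport, mem_union, mem_ofPred_eq, Measure.add_apply, ne_eq, add_eq_zero,
    not_and_or]
  constructor
  · rintro (h | h) U hU hx
    exacts [Or.inl (h U hU hx), Or.inr (h U hU hx)]
  · intro h
    by_contra! hcon
    obtain ⟨⟨U, hU, hxU, hU0⟩, V, hV, hxV, hV0⟩ := hcon
    rcases h (U ∩ V) (hU.inter hV) ⟨hxU, hxV⟩ with h | h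
    · exact h (measure_mono_null inter_subset_left hU0)
    · exact h (measure_mono_null inter_subset_right hV0)

theorem IsM.good {s : SignedM} {Δ : Set ℝ} (h : IsM s Δ) :
    Good (s.pos + s.neg) (sInf s.supp) (sSup s.supp) := by
  have := h.posFinite
  have := h.negFinite
  refine ⟨inferInstance, ?_, fun Z hZ => ?_⟩
  · refine measure_mono_null (compl_subset_compl.2 fun x hx => ?_)
      (Measure.measure_compl_support (μ := s.pos + s.neg))
    rw [← s.supp_eq] at hx
    exact ⟨csInf_le h.compactSupp.bddBelow hx, le_csSup h.compactSupp.bddAbove hx⟩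
  · refine h.infiniteSupp (Z.finite_toSet.subset fun x hx => ?_)
    rw [s.supp_eq] at hx
    by_contra hxZ
    exact (Measure.mem_support_iff_forall x).1 hx _
      (Z.finite_toSet.isClosed.isOpen_compl.mem_nhds hxZ) |>.ne' hZ

/-- The density version of the integral for positive and negative parts. -/
theorem integral_withDensity_sub {μ : Measure ℝ} [IsFiniteMeasure μ] {a b : ℝ}
    (hμ : μ (Icc a b)ᶜ = 0) {f g : ℝ → ℝ} (hf : ContinuousOn f (Icc a b))
    (hg : ContinuousOn g (Icc a b)) :
    ∫ x, f x ∂μ.withDensity (fun x => ENNReal.ofReal (g x)) -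
      ∫ x, f x ∂μ.withDensity (fun x => ENNReal.ofReal (-g x)) = ∫ x, g x * f x ∂μ := by
  have hgm : AEMeasurable g μ := (integrable_of_continuousOn_Icc hμ hg).aemeasurable
  have hgm' : AEMeasurable (fun x => ENNReal.ofReal (-g x)) μ := hgm.neg.ennreal_ofReal
  rw [integral_withDensity_eq_integral_toReal_smul₀ hgm.ennreal_ofReal (by simp),
    integral_withDensity_eq_integral_toReal_smul₀ hgm' (by simp),
    ← integral_sub]
  · refine integral_congr_ae (Eventually.of_forall fun x => ?_)
    simp only [smul_eq_mul, ENNReal.toReal_ofReal']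
    rcases le_total 0 (g x) with h | h
    · rw [max_eq_left h, max_eq_right (by linarith)]; ring
    · rw [max_eq_right h, max_eq_left (by linarith)]; ring
  · simp only [smul_eq_mul, ENNReal.toReal_ofReal']
    exact integrable_of_continuousOn_Icc hμ (by fun_prop)
  · simp only [smul_eq_mul, ENNReal.toReal_ofReal']
    exact integrable_of_continuousOn_Icc hμ (by fun_prop)

/-- Integrals against a signed measure of constant sign. -/
theorem IsM.exists_sign {s : SignedM} {Δ : Set ℝ} (h : IsM s Δ) :
    ∃ ε : ℝ, (ε = 1 ∨ ε = -1) ∧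
      (∀ f : ℝ → ℂ, s.cintegral f = ε * ∫ x, f x ∂(s.pos + s.neg)) ∧
      (∀ f : ℝ → ℝ, s.rintegral f = ε * ∫ x, f x ∂(s.pos + s.neg)) ∧
      ∀ f g : ℝ → ℝ, ContinuousOn f (Icc (sInf s.supp) (sSup s.supp)) →
        ContinuousOn g (Icc (sInf s.supp) (sSup s.supp)) →
        (s.withDensityR g).rintegral f = ε * ∫ x, g x * f x ∂(s.pos + s.neg) := by
  have := h.posFinite
  have := h.negFinite
  have hnull := h.good.null
  rcases h.constSign with h0 | h0
  · refine ⟨-1, Or.inr rfl, fun f => ?_, fun f => ?_, fun f g hf hg => ?_⟩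
    · simp [SignedM.cintegral, h0]
    · simp [SignedM.rintegral, h0]
    · rw [h0, zero_add] at hnull ⊢
      rw [← integral_withDensity_sub hnull hf hg]
      simp [SignedM.rintegral, SignedM.withDensityR, h0, withDensity_zero_left]
  · refine ⟨1, Or.inl rfl, fun f => ?_, fun f => ?_, fun f g hf hg => ?_⟩
    · simp [SignedM.cintegral, h0]
    · simp [SignedM.rintegral, h0]
    · rw [h0, add_zero] at hnull ⊢
      rw [← integral_withDensity_sub hnull hf hg]
      simp [SignedM.rintegral, SignedM.withDensityR, h0, withDensity_zero_left]

/-- The positive generating measures of a Nikishin system, extended by zero. -/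
def genMeasure (σ : ℕ → SignedM) (m j : ℕ) : Measure ℝ :=
  if j ≤ m then (σ j).pos + (σ j).neg else 0

/-- The left endpoints of the supporting intervals. -/
def genLeft (σ : ℕ → SignedM) (m j : ℕ) : ℝ := if j ≤ m then sInf (σ j).supp else 1

/-- The right endpoints of the supporting intervals. -/
def genRight (σ : ℕ → SignedM) (m j : ℕ) : ℝ := if j ≤ m then sSup (σ j).supp else 0

theorem nikGen_of_isM {σ : ℕ → SignedM} {m : ℕ} {Δ : ℕ → Set ℝ} (hσ : ∀ j ≤ m, IsM (σ j) (Δ j))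
    (hdisj : ∀ j, j + 1 ≤ m → Δ j ∩ Δ (j + 1) = ∅) :
    NikGen (genMeasure σ m) (genLeft σ m) (genRight σ m) m := by
  have hgood : ∀ j ≤ m, Good (genMeasure σ m j) (genLeft σ m j) (genRight σ m j) := fun j hj => by
    simpa only [genMeasure, genLeft, genRight, if_pos hj] using (hσ j hj).good
  refine ⟨fun j => ?_, fun j => ?_, fun j _ hj => hgood j hj, fun j => ?_⟩
  · by_cases hj : j ≤ m
    · exact (hgood j hj).fin
    · rw [genMeasure, if_neg hj]
      infer_instance
  · by_cases hj : j ≤ m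
    · exact (hgood j hj).null
    · simp [genMeasure, if_neg hj]
  · by_cases hj : j + 1 ≤ m
    · rw [disjoint_iff_inter_eq_empty, ← hdisj j hj, (hσ j (by omega)).hullEq,
        (hσ (j + 1) hj).hullEq]
      simp only [genLeft, genRight, if_pos hj, if_pos (show j ≤ m by omega)]
    · simp [genLeft, genRight, show ¬ j < m by omega]

theorem ofReal_inv_sub (x y : ℝ) : (((x - y)⁻¹ : ℝ) : ℂ) = ((x : ℂ) - (y : ℂ))⁻¹ := by
  push_cast
  rfl

/-- The Cauchy transforms of a Nikishin system are, up to sign, iterated Cauchy transforms of the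
positive generating measures. -/
theorem exists_sign_nikSys {σ : ℕ → SignedM} {m : ℕ} {Δ : ℕ → Set ℝ}
    (hσ : ∀ j ≤ m, IsM (σ j) (Δ j)) (hdisj : ∀ j, j + 1 ≤ m → Δ j ∩ Δ (j + 1) = ∅) (d : ℕ) :
    ∀ q, q + 1 + d ≤ m → ∃ δ : ℝ, δ ≠ 0 ∧
      ∀ x : ℝ, x ∉ Icc (genLeft σ m (q + 1)) (genRight σ m (q + 1)) →
        (((nikSys σ (q + 1) (q + 1 + d)).cauchyR x : ℝ) : ℂ)
          = δ * cauchyIter (genMeasure σ m) (d + 1) q (x : ℂ) := by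
  have hgen := nikGen_of_isM hσ hdisj
  induction d with
  | zero =>
    intro q hq
    have hq' : q + 1 ≤ m := hq
    obtain ⟨ε, hε, -, hr, -⟩ := (hσ (q + 1) hq').exists_sign
    refine ⟨ε, by rcases hε with rfl | rfl <;> norm_num, fun x hx => ?_⟩
    rw [nikSys, dif_neg (by omega), SignedM.cauchyR, hr]
    simp only [cauchyIter, one_mul, genMeasure, if_pos hq']
    rw [Complex.ofReal_mul, ← integral_complex_ofReal]
    simp_rw [ofReal_inv_sub]
  | succ d ih =>
    intro q hq
    have hq' : q + 1 ≤ m := by omega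
    obtain ⟨ε, hε, -, -, hw⟩ := (hσ (q + 1) hq').exists_sign
    obtain ⟨δ, hδ, ih⟩ := ih (q + 1) (by omega)
    refine ⟨ε * δ, mul_ne_zero (by rcases hε with rfl | rfl <;> norm_num) hδ, fun x hx => ?_⟩
    have hIcc : Icc (sInf (σ (q + 1)).supp) (sSup (σ (q + 1)).supp)
        = Icc (genLeft σ m (q + 1)) (genRight σ m (q + 1)) := by
      simp only [genLeft, genRight, if_pos hq']
    have hg : ∀ y ∈ Icc (genLeft σ m (q + 1)) (genRight σ m (q + 1)),
        (((nikSys σ (q + 1 + 1) (q + 1 + 1 + d)).cauchyR y : ℝ) : ℂ)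
          = δ * cauchyIter (genMeasure σ m) (d + 1) (q + 1) (y : ℂ) := fun y hy =>
      ih y fun hy' => (hgen.disj (q + 1)).le_bot ⟨hy, hy'⟩
    have hgc : ContinuousOn (nikSys σ (q + 1 + 1) (q + 1 + 1 + d)).cauchyR
        (Icc (genLeft σ m (q + 1)) (genRight σ m (q + 1))) := by
      have h1 := hgen.continuousOn_cauchyIter_Icc (d + 1) (q + 1)
      have h2 : ContinuousOn (fun y : ℝ =>
          ((δ : ℂ) * cauchyIter (genMeasure σ m) (d + 1) (q + 1) (y : ℂ)).re)
          (Icc (genLeft σ m (q + 1)) (genRight σ m (q + 1))) :=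
        Complex.continuous_re.comp_continuousOn (continuousOn_const.mul h1)
      exact h2.congr fun y hy => by simp only [← hg y hy, Complex.ofReal_re]
    rw [show q + 1 + (d + 1) = q + 1 + 1 + d by omega, nikSys, dif_pos (by omega), SignedM.nik,
      SignedM.cauchyR, hw _ _ _ (hIcc ▸ hgc)]
    · rw [cauchyIter, Complex.ofReal_mul, ← integral_complex_ofReal, Complex.ofReal_mul, mul_assoc]
      congr 1
      rw [← integral_const_mul]
      have hae := ae_mem_Icc (hgen.null (q + 1))
      simp only [genMeasure, if_pos hq'] at hae ⊢
      refine integral_congr_ae ?_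
      filter_upwards [hae] with y hy
      rw [Complex.ofReal_mul, hg y hy, ofReal_inv_sub, mul_assoc]
    · rw [hIcc]
      exact ContinuousOn.inv₀ (by fun_prop) fun y hy => sub_ne_zero.2 fun hxy => hx (hxy ▸ hy)

theorem sh1R_eq {σ : ℕ → SignedM} {m : ℕ} {Δ : ℕ → Set ℝ}
    (hσ : ∀ j ≤ m, IsM (σ j) (Δ j)) (hdisj : ∀ j, j + 1 ≤ m → Δ j ∩ Δ (j + 1) = ∅) {k : ℕ}
    (hk : k ≤ m) : ∃ δ : ℝ, δ ≠ 0 ∧ ∀ x : ℝ, x ∉ Icc (genLeft σ m 1) (genRight σ m 1) →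
      ((sh1R σ k x : ℝ) : ℂ) = δ * cauchyIter (genMeasure σ m) k 0 (x : ℂ) := by
  cases k with
  | zero => exact ⟨1, one_ne_zero, fun x _ => by simp [sh1R, cauchyIter]⟩
  | succ d =>
    obtain ⟨δ, hδ, h⟩ := exists_sign_nikSys hσ hdisj d 0 (by omega)
    refine ⟨δ, hδ, fun x hx => ?_⟩
    rw [← h x hx, sh1R, if_neg (Nat.succ_ne_zero d), show 0 + 1 + d = d + 1 by omega, zero_add]

theorem continuousOn_sh1R {σ : ℕ → SignedM} {m : ℕ} {Δ : ℕ → Set ℝ}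
    (hσ : ∀ j ≤ m, IsM (σ j) (Δ j)) (hdisj : ∀ j, j + 1 ≤ m → Δ j ∩ Δ (j + 1) = ∅) {k : ℕ}
    (hk : k ≤ m) : ContinuousOn (sh1R σ k) (Icc (genLeft σ m 1) (genRight σ m 1))ᶜ := by
  obtain ⟨δ, -, h⟩ := sh1R_eq hσ hdisj hk
  have h1 : ContinuousOn (fun y : ℝ => cauchyIter (genMeasure σ m) k 0 (y : ℂ))
      (Icc (genLeft σ m 1) (genRight σ m 1))ᶜ :=
    ((nikGen_of_isM hσ hdisj).continuousOn_cauchyIter k 0).comp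
      Complex.continuous_ofReal.continuousOn fun y hy => offSeg_ofReal.2 hy
  have h2 : ContinuousOn (fun y : ℝ =>
      ((δ : ℂ) * cauchyIter (genMeasure σ m) k 0 (y : ℂ)).re)
      (Icc (genLeft σ m 1) (genRight σ m 1))ᶜ :=
    Complex.continuous_re.comp_continuousOn (continuousOn_const.mul h1)
  exact h2.congr fun y hy => by simp only [← h y hy, Complex.ofReal_re]

/-- The Cauchy transforms `ŝ_{1,k}` of a Nikishin system form an algebraic Chebyshev system off
the interval supporting `s_{1,k}`. -/
theorem isATSystem_sh1R {σ : ℕ → SignedM} {m : ℕ} {Δ : ℕ → Set ℝ}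
    (hσ : ∀ j ≤ m, IsM (σ j) (Δ j)) (hdisj : ∀ j, j + 1 ≤ m → Δ j ∩ Δ (j + 1) = ∅) {U : Set ℝ}
    (hU : Disjoint U (Icc (genLeft σ m 1) (genRight σ m 1))) : IsATSystem (sh1R σ) m U := by
  have hgen := nikGen_of_isM hσ hdisj
  choose! δ hδ hsh using fun k (hk : k ≤ m) => sh1R_eq hσ hdisj hk
  intro n p hp Z hZ hcard k hk
  have hZU : ∀ x ∈ Z, x ∉ Icc (genLeft σ m 1) (genRight σ m 1) := fun x hx hx' =>
    hU.le_bot ⟨(hZ x hx).1, hx'⟩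
  have hrange : ∀ {k}, k ∈ Finset.range (m + 1) → k ≤ m := fun hk =>
    Nat.lt_succ_iff.1 (Finset.mem_range.1 hk)
  have h0 := zero_bound hgen (m + 1) (Finset.range (m + 1)) (Finset.card_range _) 0
    (fun x : Fin 0 => (x : ℕ)) (fun x => x.elim0) (fun x => x.elim0)
    (fun k hk => ⟨hrange hk, fun x => x.elim0⟩) n (fun k => δ k • p k)
    (fun k hk => (degree_smul_le _ _).trans_lt (hp k (hrange hk))) Z
    (fun x hx => ⟨hZU x hx, ?_⟩) hcard k (Finset.mem_range.2 (Nat.lt_succ_of_le hk))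
  · exact (smul_eq_zero.1 h0).resolve_left (hδ k hk)
  · have h1 := (hZ x hx).2
    rw [← Complex.ofReal_eq_zero, polyForm, Complex.ofReal_sum] at h1
    rw [← h1]
    refine Finset.sum_congr rfl fun k hk => ?_
    rw [extMinor_app_val hgen (Nat.zero_le k) _ (offSeg_ofReal.2 (hZU x hx)), Nat.sub_zero,
      Complex.ofReal_mul, hsh k (hrange hk) x (hZU x hx), eval_smul, smul_eq_mul,
      Complex.ofReal_mul]
    ring

/-- An interval missing a segment extends to an open infinite interval missing it. -/
theorem exists_isOpen_superset_disjoint {a b c d : ℝ} (hab : a ≤ b)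
    (h : Disjoint (Icc a b) (Icc c d)) : ∃ U : Set ℝ, IsOpen U ∧ U.OrdConnected ∧ U.Infinite ∧
      Icc a b ⊆ U ∧ Disjoint U (Icc c d) := by
  rcases lt_or_ge d c with hcd | hcd
  · exact ⟨univ, isOpen_univ, ordConnected_univ, infinite_univ, subset_univ _, by
      simp [Icc_eq_empty hcd.not_ge]⟩
  rcases lt_or_ge b c with hbc | hbc
  · exact ⟨Iio c, isOpen_Iio, ordConnected_Iio, Iio_infinite c,
      fun x hx => hx.2.trans_lt hbc, disjoint_left.2 fun x hx hx' => hx'.1.not_gt hx⟩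
  rcases lt_or_ge d a with hda | hda
  · exact ⟨Ioi d, isOpen_Ioi, ordConnected_Ioi, Ioi_infinite d,
      fun x hx => hda.trans_le hx.1, disjoint_left.2 fun x hx hx' => hx'.2.not_gt hx⟩
  · exact absurd (h.le_bot (show max a c ∈ Icc a b ⊓ Icc c d from
      ⟨⟨le_max_left _ _, max_le hab hbc⟩, le_max_right _ _, max_le hda hcd⟩)) (by simp)

/-- Mixed type vector polynomials satisfy orthogonality relations. -/
theorem IsMixedVP.mixedOrtho {σ1 σ2 : ℕ → SignedM} {m1 m2 : ℕ} {n1 n2 : ℕ → ℕ}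
    {p : ℕ → ℝ[X]} (h : IsMixedVP σ1 σ2 m1 m2 n1 n2 p) {Δ : Set ℝ} (hM : IsM (σ2 0) Δ)
    (hF : ∀ k ≤ m1, ContinuousOn (sh1R σ1 k) (Icc (sInf (σ2 0).supp) (sSup (σ2 0).supp)))
    (hG : ∀ i ≤ m2, ContinuousOn (sh1R σ2 i) (Icc (sInf (σ2 0).supp) (sSup (σ2 0).supp))) :
    MixedOrtho ((σ2 0).pos + (σ2 0).neg) (sh1R σ1) (sh1R σ2) m1 m2 n2 p := by
  intro i hi
  set κ := (σ2 0).pos + (σ2 0).neg with hκdef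
  set a := sInf (σ2 0).supp
  set b := sSup (σ2 0).supp
  have hκ : Good κ a b := hM.good
  have := hκ.fin
  obtain ⟨ε, hε, hc, -, -⟩ := hM.exists_sign
  have hε0 : ε ≠ 0 := by rcases hε with rfl | rfl <;> norm_num
  obtain ⟨-, -, hO⟩ := h
  obtain ⟨d, C, R, hd⟩ := hO i hi
  have hrange : ∀ {k}, k ∈ Finset.range (m1 + 1) → k ≤ m1 := fun hk =>
    Nat.lt_succ_iff.1 (Finset.mem_range.1 hk)
  have hGF : ∀ k ≤ m1, ContinuousOn (fun x => sh1R σ2 i x * sh1R σ1 k x) (Icc a b) :=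
    fun k hk => (hG i hi).mul (hF k hk)
  choose! P hP using fun k (hk : k ≤ m1) =>
    exists_poly_divided_difference (𝕜 := ℝ) hκ.null (hGF k hk) (p k)
  have hL := continuousOn_polyForm hF p
  have hGi := hG i hi
  have key := moments_eq_zero hκ.null
    (h := fun x => ε * (sh1R σ2 i x * polyForm (sh1R σ1) m1 p x)) (by fun_prop)
    (d - ε • ∑ k ∈ Finset.range (m1 + 1), P k) (n2 i) C ?_
  · intro ν hν
    have h1 := key ν hν
    have h2 : ∀ x, x ^ ν * (ε * (sh1R σ2 i x * polyForm (sh1R σ1) m1 p x))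
        = ε * (x ^ ν * (sh1R σ2 i x * polyForm (sh1R σ1) m1 p x)) := fun x => by ring
    simp_rw [h2] at h1
    rw [integral_const_mul] at h1
    exact (mul_eq_zero.1 h1).resolve_left hε0
  · filter_upwards [eventually_ge_atTop R, eventually_gt_atTop b, eventually_gt_atTop 0]
      with t htR htb ht0
    have hoff : ∀ y ∈ Icc a b, t - y ≠ 0 := fun y hy => by linarith [hy.2]
    have hinv : ContinuousOn (fun y : ℝ => (t - y)⁻¹) (Icc a b) :=
      ContinuousOn.inv₀ (by fun_prop) hoff
    have h1 := hd (t : ℂ) (by rwa [Complex.norm_real, Real.norm_of_nonneg ht0.le])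
    rw [Complex.norm_real, Real.norm_of_nonneg ht0.le] at h1
    have haeval : ∀ q : ℝ[X], aeval (t : ℂ) q = ((q.eval t : ℝ) : ℂ) := fun q => by
      rw [← eval_map_ofReal, aeval_def, eval_map]
      rfl
    have h2 : ∀ k, (σ2 0).cintegral (fun x =>
          ((sh1R σ2 i x * sh1R σ1 k x : ℝ) : ℂ) * ((t : ℂ) - (x : ℂ))⁻¹)
        = ((ε * ∫ x, sh1R σ2 i x * sh1R σ1 k x * (t - x)⁻¹ ∂κ : ℝ) : ℂ) := fun k => by
      rw [hc, Complex.ofReal_mul, ← integral_complex_ofReal]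
      simp_rw [← ofReal_inv_sub, ← Complex.ofReal_mul]
      rfl
    simp_rw [h2, haeval, ← Complex.ofReal_mul] at h1
    rw [← Complex.ofReal_sum, ← Complex.ofReal_sub, Complex.norm_real, Real.norm_eq_abs] at h1
    convert h1 using 2
    have h3 : ∀ k ∈ Finset.range (m1 + 1),
        (p k).eval t * (ε * ∫ x, sh1R σ2 i x * sh1R σ1 k x * (t - x)⁻¹ ∂κ)
          = ε * (P k).eval t +
            ε * ∫ x, (p k).eval x * (sh1R σ2 i x * sh1R σ1 k x) * (t - x)⁻¹ ∂κ := fun k hk => by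
      have := hP k (hrange hk) t fun y hy => sub_ne_zero.1 (hoff y hy)
      simp only [RCLike.ofReal_real_eq_id, id] at this
      rw [mul_left_comm, this, mul_add]
    rw [Finset.sum_congr rfl h3, Finset.sum_add_distrib, ← Finset.mul_sum, ← Finset.mul_sum,
      ← integral_finsetSum]
    · have h4 : ∀ x, ε * (sh1R σ2 i x * polyForm (sh1R σ1) m1 p x) * (t - x)⁻¹
          = ε * ∑ k ∈ Finset.range (m1 + 1),
            (p k).eval x * (sh1R σ2 i x * sh1R σ1 k x) * (t - x)⁻¹ := fun x => by
        rw [polyForm, ← Finset.sum_mul, Finset.mul_sum, mul_assoc]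
        congr 2
        exact Finset.sum_congr rfl fun k _ => by ring
      simp_rw [h4]
      rw [integral_const_mul, eval_sub, eval_smul, eval_finsetSum, smul_eq_mul]
      ring
    · intro k hk
      have := hGF k (hrange hk)
      exact hκ.integrable (by fun_prop)

/-- Theorem 2: mixed type Nikishin systems are perfect, and the mixed type vector
polynomial is unique up to a nonzero constant factor. -/
theorem stmt8
    (m1 m2 : ℕ)
    (σ1 σ2 : ℕ → SignedM) (Δ1 Δ2 : ℕ → Set ℝ)
    (hσ1 : ∀ j ≤ m1, IsM (σ1 j) (Δ1 j))
    (hdisj1 : ∀ j, j + 1 ≤ m1 → Δ1 j ∩ Δ1 (j + 1) = ∅)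
    (hσ2 : ∀ j ≤ m2, IsM (σ2 j) (Δ2 j))
    (hdisj2 : ∀ j, j + 1 ≤ m2 → Δ2 j ∩ Δ2 (j + 1) = ∅)
    (hbase : σ1 0 = σ2 0)
    (n1 n2 : ℕ → ℕ)
    (hn : ∑ j ∈ Finset.range (m1 + 1), n1 j = (∑ j ∈ Finset.range (m2 + 1), n2 j) + 1) :
    (∀ a : ℕ → Polynomial ℝ, IsMixedVP σ1 σ2 m1 m2 n1 n2 a →
      ∀ k ≤ m1, (n1 k = 0 ∧ a k = 0) ∨ (a k ≠ 0 ∧ (a k).natDegree + 1 = n1 k)) ∧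
    (∀ a a' : ℕ → Polynomial ℝ, IsMixedVP σ1 σ2 m1 m2 n1 n2 a →
      IsMixedVP σ1 σ2 m1 m2 n1 n2 a' →
      ∃ c : ℝ, c ≠ 0 ∧ ∀ k ≤ m1, a' k = c • a k) := by
  have hM := hσ2 0 (Nat.zero_le _)
  set a := sInf (σ2 0).supp with ha
  set b := sSup (σ2 0).supp with hb
  have hκ : Good ((σ2 0).pos + (σ2 0).neg) a b := hM.good
  have hd1 : Disjoint (Icc a b) (Icc (genLeft σ1 m1 1) (genRight σ1 m1 1)) := by
    simpa [genLeft, genRight, hbase] using (nikGen_of_isM hσ1 hdisj1).disj 0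
  have hd2 : Disjoint (Icc a b) (Icc (genLeft σ2 m2 1) (genRight σ2 m2 1)) := by
    simpa [genLeft, genRight] using (nikGen_of_isM hσ2 hdisj2).disj 0
  obtain ⟨U, hU, hUc, hUi, hIU, hUd⟩ := exists_isOpen_superset_disjoint hκ.le hd2
  have hFc : ∀ k ≤ m1, ContinuousOn (sh1R σ1 k) (Icc a b) := fun k hk =>
    (continuousOn_sh1R hσ1 hdisj1 hk).mono fun x hx => disjoint_left.1 hd1 hx
  have hGc : ∀ k ≤ m2, ContinuousOn (sh1R σ2 k) U := fun k hk =>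
    (continuousOn_sh1R hσ2 hdisj2 hk).mono fun x hx => disjoint_left.1 hUd hx
  exact mixedOrtho_perfect hκ (isATSystem_sh1R hσ1 hdisj1 hd1) (isATSystem_sh1R hσ2 hdisj2 hUd)
    hFc hGc hU hUc hUi hIU hn fun p hp =>
      ⟨hp.1, hp.2.1, hp.mixedOrtho hM hFc fun k hk => (hGc k hk).mono hIU⟩
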